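/- Let η_+(t) = h_H(t) · t e^{−t²/2} for some H ≥ 50. Let x ≥ 10³, δ ∈ ℝ, and let χ be a primitive Dirichlet character mod q, q ≥ 1. Assume all nontrivial zeros ρ of L(s,χ) with |Im(ρ)| ≤ T₀ lie on the critical line, where T₀ ≥ H + max(4π²|δ|, 100). Then ∑_{n=1}^∞ Λ(n) χ(n) e(δn/x) η_+(n/x) equals η̂_+(−δ)x + O*(err)·x if q = 1, and O*(err)·x if q > 1, where, with T₀' = T₀ − H, err = (9.462 √T₀' e^{−0.1598 T₀'} + 11.287 |δ| e^{−0.1065 (T₀'/(πδ))²}) log(qT₀/2π) + (1.631 √T₀ log(qT₀) + 12.42 √T₀ + 1.321 log q + 34.51) x^{−1/2} + (9 + 11|δ|) x^{−1} + (log q)(11 + 6|δ|) x^{−3/2}. -/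

import Mathlib

open MeasureTheory Set

/-- `e(t) = e^{2πit}`. -/
noncomputable def e2pi (t : ℝ) : ℂ := Complex.exp (2 * Real.pi * Complex.I * t)

/-- `h(t) = t²(2-t)³ e^{t-1/2}` on `[0,2]`, and `0` elsewhere. -/
noncomputable def hcut (t : ℝ) : ℝ :=
  if t ∈ Set.Icc (0:ℝ) 2 then t^2 * (2 - t)^3 * Real.exp (t - 1/2) else 0

/-- The kernel `F_H(y) = sin(H log y)/(π log y)`. -/
noncomputable def FH (H y : ℝ) : ℝ := Real.sin (H * Real.log y) / (Real.pi * Real.log y)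

/-- `h_H = h ∗_M F_H`, the band-limited approximation to `h`. -/
noncomputable def hH (H t : ℝ) : ℝ := ∫ y in Set.Ioi (0:ℝ), hcut (t / y) * FH H y / y

/-- `η₊(t) = h_H(t) · t e^{-t²/2}`. -/
noncomputable def etaPlus (H t : ℝ) : ℝ := hH H t * (t * Real.exp (-t^2 / 2))

set_option linter.all false
open Real renaming exp → rx, pi → pp, log → lg, cos → cs, sin → sn
theorem mll {a b c : ℝ} (h : b ≤ c) (h0 : 0 ≤ a) : a*b ≤ a*c := mul_le_mul_of_nonneg_left h h0
theorem mlr {a b c : ℝ} (h : b ≤ c) (h0 : 0 ≤ a) : b*a ≤ c*a := mul_le_mul_of_nonneg_right h h0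


section plancherel
open FourierTransform SchwartzMap

theorem pl_aux (f : ℝ → ℂ) (h1 : Integrable f) (h2 : MemLp f 2) :
    MemLp (𝓕 f) 2 ∧ eLpNorm (𝓕 f) 2 volume = eLpNorm f 2 volume := by
  have hc : Continuous (𝓕 f) := by
    exact VectorFourier.fourierIntegral_continuous Real.continuous_fourierChar
      (by exact continuous_inner) h1
  set F := h2.toLp f with hF
  have key : (𝓕 F : Lp (α := ℝ) ℂ 2 volume) =ᵐ[volume] 𝓕 f := by
    refine ae_eq_of_integral_contDiff_smul_eq ((Lp.memLp _).locallyIntegrable (by norm_num))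
      hc.locallyIntegrable ?_
    intro g hg hgs
    have hg' : ContDiff ℝ (⊤:ℕ∞) (fun x => (g x : ℂ)) := Complex.ofRealCLM.contDiff.comp hg
    have hgs' : HasCompactSupport (fun x => (g x : ℂ)) := hgs.comp_left (g := fun r : ℝ => (r:ℂ)) (by simp)
    set φ : 𝓢(ℝ, ℂ) := hgs'.toSchwartzMap hg' with hφ
    have e1 := congrArg (fun T => T φ) (Lp.fourier_toTemperedDistribution_eq F)
    simp only [TemperedDistribution.fourier_apply, Lp.toTemperedDistribution_apply] at e1
    have e2 : ∫ x, g x • (𝓕 F : Lp (α := ℝ) ℂ 2 volume) x = ∫ x, φ x • (𝓕 F : Lp (α := ℝ) ℂ 2 volume) x := by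
      apply integral_congr_ae; filter_upwards with x
      simp [hφ]
    rw [e2, ← e1]
    have e3 : ∫ x, (𝓕 φ) x • F x = ∫ x, (𝓕 φ) x • f x := by
      apply integral_congr_ae
      filter_upwards [h2.coeFn_toLp] with x hx
      rw [hx]
    rw [e3, SchwartzMap.fourier_coe]
    have := VectorFourier.integral_fourierIntegral_smul_eq_flip (L := innerₗ ℝ) (μ := volume) (ν := volume)
      (f := (φ : ℝ → ℂ)) (g := f) Real.continuous_fourierChar (by exact continuous_inner) φ.integrable h1
    rw [show (innerₗ ℝ : ℝ →ₗ[ℝ] ℝ →ₗ[ℝ] ℝ).flip = innerₗ ℝ from flip_innerₗ ℝ] at this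
    refine Eq.trans this ?_
    apply integral_congr_ae; filter_upwards with x
    simp [hφ]
    left; rfl
  have m1 : MemLp (𝓕 f) 2 := (memLp_congr_ae key).1 (Lp.memLp _)
  refine ⟨m1, ?_⟩
  rw [← eLpNorm_congr_ae key]
  have := Lp.norm_fourier_eq F
  rw [Lp.norm_def, Lp.norm_def, ENNReal.toReal_eq_toReal_iff' (Lp.eLpNorm_ne_top _) (Lp.eLpNorm_ne_top _)] at this
  rw [this, hF, eLpNorm_congr_ae h2.coeFn_toLp]

/-- Plancherel for integrable, square-integrable functions. -/
theorem plancherel (f : ℝ → ℂ) (h1 : Integrable f) (h2 : Integrable (fun x => ‖f x‖^2)) :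
    Integrable (fun x => ‖𝓕 f x‖^2) ∧ ∫ x, ‖𝓕 f x‖^2 = ∫ x, ‖f x‖^2 := by
  have h2' : MemLp f 2 := (memLp_two_iff_integrable_sq_norm h1.1).2 h2
  obtain ⟨a, b⟩ := pl_aux f h1 h2'
  refine ⟨(memLp_two_iff_integrable_sq_norm a.1).1 a, ?_⟩
  have ha := a.eLpNorm_eq_integral_rpow_norm (by norm_num) (by norm_num)
  have hb := h2'.eLpNorm_eq_integral_rpow_norm (by norm_num) (by norm_num)
  rw [ha, hb] at b
  rw [ENNReal.ofReal_eq_ofReal_iff (by positivity) (by positivity)] at b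
  simp only [ENNReal.toReal_ofNat, Real.rpow_ofNat] at b
  have := congrArg (fun r : ℝ => r^(2:ℝ)) b
  beta_reduce at this
  rwa [← Real.rpow_mul (by positivity), ← Real.rpow_mul (by positivity), inv_mul_cancel₀ (by norm_num),
    Real.rpow_one, Real.rpow_one] at this

end plancherel

section hadamard
open Metric Filter Topology

/-- multiplicity -/
noncomputable def mlt (f : ℂ → ℂ) (ρ : ℂ) : ℕ := analyticOrderNatAt f ρ

theorem had_one {f : ℂ → ℂ} (hf : Differentiable ℂ f) (c : ℂ) (hc : f c ≠ 0) (ρ : ℂ) :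
    ∃ g : ℂ → ℂ, Differentiable ℂ g ∧ (∀ z, f z = (z - ρ)^(mlt f ρ) * g z) ∧ g ρ ≠ 0 := by
  have hA : AnalyticOnNhd ℂ f univ := fun z _ => hf.analyticAt z
  have hne : analyticOrderAt f ρ ≠ ⊤ := by
    refine hA.analyticOrderAt_ne_top_of_isPreconnected isPreconnected_univ (mem_univ c) (mem_univ ρ) ?_
    rw [((hf.analyticAt c).analyticOrderAt_eq_zero).2 hc]; simp
  obtain ⟨g, hg, hg0, hfg⟩ := ((hf.analyticAt ρ).analyticOrderNatAt_eq_iff hne (n := mlt f ρ)).1 rfl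
  classical
  refine ⟨fun z => if z = ρ then g ρ else f z / (z - ρ)^(mlt f ρ), ?_, ?_, by simpa using hg0⟩
  · intro z
    by_cases hz : z = ρ
    · subst hz
      refine hg.differentiableAt.congr_of_eventuallyEq ?_
      filter_upwards [hfg] with w hw
      by_cases h : w = z
      · simp [h]
      · rw [if_neg h, hw, smul_eq_mul, mul_div_cancel_left₀]
        exact pow_ne_zero _ (sub_ne_zero.2 h)
    · have : DifferentiableAt ℂ (fun z => f z / (z - ρ)^(mlt f ρ)) z :=
        (hf z).div (by fun_prop) (pow_ne_zero _ (sub_ne_zero.2 hz))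
      refine this.congr_of_eventuallyEq ?_
      filter_upwards [isOpen_ne.mem_nhds hz] with w hw
      rw [if_neg hw]
  · intro z
    by_cases hz : z = ρ
    · subst hz
      simpa using hfg.self_of_nhds
    · simp only [hz, if_false]
      rw [mul_div_cancel₀]
      exact pow_ne_zero _ (sub_ne_zero.2 hz)

theorem had_fin {f : ℂ → ℂ} (hf : Differentiable ℂ f) (c : ℂ) (hc : f c ≠ 0) (S : Finset ℂ) :
    ∃ g : ℂ → ℂ, Differentiable ℂ g ∧ (∀ z, f z = (∏ ρ ∈ S, (z - ρ)^(mlt f ρ)) * g z) ∧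
      ∀ ρ ∈ S, g ρ ≠ 0 := by
  classical
  induction S using Finset.induction_on with
  | empty => exact ⟨f, hf, by simp, by simp⟩
  | insert ρ S hρ ih =>
    obtain ⟨g, hg, hfg, hg0⟩ := ih
    have hgc : g c ≠ 0 := by
      intro h; apply hc; rw [hfg c, h, mul_zero]
    have hm : mlt g ρ = mlt f ρ := by
      unfold mlt analyticOrderNatAt
      have e : f = (fun z => ∏ ρ ∈ S, (z - ρ)^(mlt f ρ)) * g := by ext z; exact hfg z
      have hP : Differentiable ℂ (fun z => ∏ ρ ∈ S, (z - ρ)^(mlt f ρ)) := by fun_prop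
      have : analyticOrderAt f ρ = analyticOrderAt g ρ := by
        conv_lhs => rw [e]
        rw [analyticOrderAt_mul (hP.analyticAt ρ) (hg.analyticAt ρ),
          ((hP.analyticAt ρ).analyticOrderAt_eq_zero).2, zero_add]
        rw [Finset.prod_ne_zero_iff]
        intro a ha
        refine pow_ne_zero _ (sub_ne_zero.2 ?_)
        rintro rfl; exact hρ ha
      rw [this]
    obtain ⟨k, hk, hgk, hk0⟩ := had_one hg c hgc ρ
    refine ⟨k, hk, ?_, ?_⟩
    · intro z
      rw [hfg z, Finset.prod_insert hρ, hgk z, hm]; ring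
    · intro τ hτ
      rcases Finset.mem_insert.1 hτ with rfl | h
      · exact hk0
      · intro h0; apply hg0 τ h; rw [hgk, h0, mul_zero]

theorem had_bd {f : ℂ → ℂ} (hf : Differentiable ℂ f) (c : ℂ) (hc : f c ≠ 0) {R b : ℝ} (hR : 0 < R)
    (hb : ∀ z ∈ closedBall c (3*R), ‖f z‖ ≤ rx b * ‖f c‖) (S : Finset ℂ)
    (hS : ∀ ρ ∈ S, ρ ∈ closedBall c R) {g : ℂ → ℂ} (hg : Differentiable ℂ g)
    (hfg : ∀ z, f z = (∏ ρ ∈ S, (z - ρ)^(mlt f ρ)) * g z) :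
    ∀ z ∈ closedBall c (3*R), ‖g z‖ * 2^(∑ ρ ∈ S, mlt f ρ) ≤ rx b * ‖g c‖ := by
  set n := ∑ ρ ∈ S, mlt f ρ
  have h1 : ‖f c‖ ≤ R^n * ‖g c‖ := by
    rw [hfg c, norm_mul, norm_prod]
    gcongr
    rw [← Finset.prod_pow_eq_pow_sum]
    apply Finset.prod_le_prod (fun _ _ => norm_nonneg _)
    intro ρ h
    rw [norm_pow]
    gcongr
    have := hS ρ h
    rwa [mem_closedBall', dist_eq_norm] at this
  intro z hz
  have key : ‖g z‖ ≤ rx b * ‖f c‖ / (2*R)^n := by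
    refine Complex.norm_le_of_forall_mem_frontier_norm_le (U := ball c (3*R)) isBounded_ball
      hg.diffContOnCl ?_ (by rw [closure_ball _ (by positivity)]; exact hz)
    intro w hw
    rw [frontier_ball _ (by positivity)] at hw
    have hw' : w ∈ closedBall c (3*R) := sphere_subset_closedBall hw
    have h2 := hb w hw'
    rw [le_div_iff₀ (by positivity)]
    refine le_trans ?_ h2
    rw [hfg w, norm_mul, norm_prod, mul_comm]
    gcongr
    rw [← Finset.prod_pow_eq_pow_sum]
    apply Finset.prod_le_prod (fun _ _ => by positivity)
    intro ρ h
    rw [norm_pow]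
    gcongr
    have h3 := hS ρ h
    rw [mem_closedBall', dist_eq_norm] at h3
    rw [mem_sphere, dist_eq_norm] at hw
    have : ‖w - c‖ ≤ ‖w - ρ‖ + ‖c - ρ‖ := by
      have := norm_sub_le (w - ρ) (c - ρ); simpa using this
    linarith
  calc ‖g z‖ * 2^n ≤ rx b * ‖f c‖ / (2*R)^n * 2^n := by gcongr
    _ ≤ rx b * (R^n * ‖g c‖) / (2*R)^n * 2^n := by gcongr
    _ = rx b * ‖g c‖ := by rw [mul_pow]; field_simp

theorem had_count {f : ℂ → ℂ} (hf : Differentiable ℂ f) (c : ℂ) (hc : f c ≠ 0) {R b : ℝ} (hR : 0 < R)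
    (hb : ∀ z ∈ closedBall c (3*R), ‖f z‖ ≤ rx b * ‖f c‖) (S : Finset ℂ)
    (hS : ∀ ρ ∈ S, ρ ∈ closedBall c R) :
    (∑ ρ ∈ S, (mlt f ρ:ℝ)) ≤ 2 * b := by
  obtain ⟨g, hg, hfg, -⟩ := had_fin hf c hc S
  have hgc : g c ≠ 0 := by
    intro h; apply hc; rw [hfg c, h, mul_zero]
  have h := had_bd hf c hc hR hb S hS hg hfg c (mem_closedBall_self (by positivity))
  have h' : (2:ℝ)^(∑ ρ ∈ S, mlt f ρ) ≤ rx b := by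
    rw [mul_comm] at h
    exact le_of_mul_le_mul_right h (norm_pos_iff.2 hgc)
  have h2 := Real.log_le_log (by positivity) h'
  rw [Real.log_pow, Real.log_exp] at h2
  have := Real.log_two_gt_d9
  push_cast at h2
  have h0 : (0:ℝ) ≤ ∑ ρ ∈ S, (mlt f ρ:ℝ) := by positivity
  nlinarith

theorem had_var {f : ℂ → ℂ} (hf : Differentiable ℂ f) (c : ℂ) (hc : f c ≠ 0) {R b : ℝ} (hR : 0 < R)
    (hb0 : 0 < b)
    (hb : ∀ z ∈ closedBall c (3*R), ‖f z‖ ≤ rx b * ‖f c‖) (S : Finset ℂ)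
    (hS : ∀ ρ ∈ S, ρ ∈ closedBall c R) (hS' : ∀ ρ ∈ closedBall c R, f ρ = 0 → ρ ∈ S)
    (s : ℂ) (hs : f s ≠ 0) (hsR : 8 * ‖s - c‖ < R) :
    ‖logDeriv f s - logDeriv f c - ∑ ρ ∈ S, (mlt f ρ : ℂ) * (1/(s-ρ) - 1/(c-ρ))‖ ≤ 64 * b * ‖s - c‖ / R^2 := by
  obtain ⟨g, hg, hfg, hg0⟩ := had_fin hf c hc S
  have hgc : g c ≠ 0 := by
    intro h; apply hc; rw [hfg c, h, mul_zero]
  have hgs : g s ≠ 0 := by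
    intro h; apply hs; rw [hfg s, h, mul_zero]
  have hbd := had_bd hf c hc hR hb S hS hg hfg
  have hnz : ∀ z ∈ closedBall c R, g z ≠ 0 := by
    intro z hz h
    exact hg0 z (hS' z hz (by rw [hfg z, h, mul_zero])) h
  have hld : ∀ w, f w ≠ 0 → logDeriv f w = (∑ ρ ∈ S, (mlt f ρ : ℂ) * (1/(w-ρ))) + logDeriv g w := by
    intro w hw
    have e : f = fun z => (∏ ρ ∈ S, (z - ρ)^(mlt f ρ)) * g z := by ext z; exact hfg z
    have hP0 : (∏ ρ ∈ S, (w - ρ)^(mlt f ρ)) ≠ 0 := by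
      intro h; apply hw; rw [hfg w, h, zero_mul]
    conv_lhs => rw [e]
    rw [logDeriv_mul w hP0 (by intro h; apply hw; rw [hfg w, h, mul_zero]) (by fun_prop) (hg w)]
    congr 1
    rw [logDeriv_prod (f := fun ρ z => (z - ρ)^(mlt f ρ)) (fun i hi => (Finset.prod_ne_zero_iff.1 hP0) i hi) (fun i hi => by fun_prop)]
    apply Finset.sum_congr rfl
    intro ρ hρ
    rw [logDeriv_fun_pow (by fun_prop)]
    congr 1
    rw [logDeriv_apply, deriv_sub_const]; simp
  have e1 : logDeriv f s - logDeriv f c - ∑ ρ ∈ S, (mlt f ρ : ℂ) * (1/(s-ρ) - 1/(c-ρ))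
      = logDeriv g s - logDeriv g c := by
    rw [hld s hs, hld c hc]
    simp only [mul_sub, Finset.sum_sub_distrib]; ring
  rw [e1]
  -- primitive of logDeriv g
  have hdl : DifferentiableOn ℂ (logDeriv g) (ball c R) := by
    intro z hz
    have : DifferentiableAt ℂ (fun z => deriv g z / g z) z :=
      (hg.deriv z).div (hg z) (hnz z (ball_subset_closedBall hz))
    exact this.differentiableWithinAt
  obtain ⟨L, hL0, hL⟩ := (hdl.isExactOn_ball).with_val_at c 0
  have hexp : ∀ z ∈ ball c R, g z = g c * Complex.exp (L z) := by
    intro z hz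
    have hk : ∀ w ∈ ball c R, HasDerivAt (fun w => g w * Complex.exp (-L w)) 0 w := by
      intro w hw
      have h1 := (hg w).hasDerivAt.mul ((hL w hw).neg.cexp)
      convert! h1 using 1
      rw [logDeriv_apply]
      have := hnz w (ball_subset_closedBall hw)
      simp only [Pi.neg_apply]
      field_simp
      ring
    have := (convex_ball c R).is_const_of_fderivWithin_eq_zero (𝕜 := ℂ) (f := fun w => g w * Complex.exp (-L w))
      (fun w hw => (hk w hw).differentiableAt.differentiableWithinAt)
      (fun w hw => by
        rw [fderivWithin_of_isOpen isOpen_ball hw, (hk w hw).hasFDerivAt.fderiv]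
        ext; simp) hz (mem_ball_self hR)
    simp only [hL0, neg_zero, Complex.exp_zero, mul_one] at this
    rw [← this, mul_assoc, ← Complex.exp_add]; simp
  have hre : ∀ z ∈ ball c R, (L z).re ≤ b := by
    intro z hz
    have h1 := hbd z (closedBall_subset_closedBall (by linarith) (ball_subset_closedBall hz))
    have h2 : ‖g z‖ ≤ rx b * ‖g c‖ := by
      refine le_trans ?_ h1
      exact le_mul_of_one_le_right (norm_nonneg _) (one_le_pow₀ (by norm_num))
    rw [hexp z hz, norm_mul, mul_comm, Complex.norm_exp] at h2
    exact Real.exp_le_exp.1 (le_of_mul_le_mul_right h2 (norm_pos_iff.2 hgc))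
  have hLd : DifferentiableOn ℂ L (ball c R) := fun z hz => (hL z hz).differentiableAt.differentiableWithinAt
  have hBC : ∀ z ∈ closedBall c (R/2), ‖L z‖ ≤ 2 * b := by
    intro z hz
    rw [mem_closedBall, dist_eq_norm] at hz
    have := Complex.borelCaratheodory_zero (f := fun w => L (w + c)) (M := b) (R := R) (z := z - c) hb0
      (hLd.comp (by fun_prop) (fun w hw => by simpa [dist_eq_norm] using hw))
      (fun w hw => hre _ (by simpa [dist_eq_norm] using hw)) hR
      (by simp only [mem_ball, dist_zero_right]; linarith) (by simpa using hL0)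
    simp only [sub_add_cancel] at this
    refine this.trans ?_
    rw [div_le_iff₀ (by linarith)]
    nlinarith
  have hd1 : ∀ z ∈ closedBall c (R/4), ‖logDeriv g z‖ ≤ 8 * b / R := by
    intro z hz
    have hsub : closedBall z (R/4) ⊆ closedBall c (R/2) := closedBall_subset_closedBall' (by
      rw [mem_closedBall] at hz; linarith)
    have := Complex.norm_deriv_le_of_forall_mem_sphere_norm_le (f := L) (c := z) (R := R/4) (C := 2*b)
      (by positivity) (by
        apply DifferentiableOn.diffContOnCl_ball (U := ball c R) hLd
        exact hsub.trans (closedBall_subset_ball (by linarith)))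
      (fun w hw => hBC w (hsub (sphere_subset_closedBall hw)))
    rw [(hL z (closedBall_subset_ball (by linarith) hz)).deriv] at this
    refine this.trans (le_of_eq ?_); field_simp; norm_num
  have hd2 : ∀ z ∈ closedBall c (R/8), ‖deriv (logDeriv g) z‖ ≤ 64 * b / R^2 := by
    intro z hz
    have hsub : closedBall z (R/8) ⊆ closedBall c (R/4) := closedBall_subset_closedBall' (by
      rw [mem_closedBall] at hz; linarith)
    have := Complex.norm_deriv_le_of_forall_mem_sphere_norm_le (f := logDeriv g) (c := z) (R := R/8) (C := 8*b/R)
      (by positivity) (by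
        apply DifferentiableOn.diffContOnCl_ball (U := ball c R) hdl
        exact hsub.trans (closedBall_subset_ball (by linarith)))
      (fun w hw => hd1 w (hsub (sphere_subset_closedBall hw)))
    refine this.trans (le_of_eq ?_); field_simp; norm_num
  have := (convex_closedBall c (R/8)).norm_image_sub_le_of_norm_deriv_le (f := logDeriv g) (x := c) (y := s)
    (C := 64 * b / R^2)
    (fun z hz => (hdl z (closedBall_subset_ball (by linarith) hz)).differentiableAt
      (isOpen_ball.mem_nhds (closedBall_subset_ball (by linarith) hz))) hd2 (mem_closedBall_self (by positivity))
    (by rw [mem_closedBall, dist_eq_norm]; linarith)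
  refine this.trans (le_of_eq ?_); ring

end hadamard

section hadamard2
open Metric Filter Topology

def Growth (f : ℂ → ℂ) : Prop := ∃ C : ℝ, ∀ z, ‖f z‖ ≤ rx (C * (1 + ‖z‖)^(3/2:ℝ))

theorem had_D {f : ℂ → ℂ} (hG : Growth f) (c : ℂ) (hc : f c ≠ 0) :
    ∃ D : ℝ, 0 < D ∧ ∀ R : ℝ, 1 ≤ R → ∀ z ∈ closedBall c (3*R),
      ‖f z‖ ≤ rx (D * R^(3/2:ℝ)) * ‖f c‖ := by
  obtain ⟨C, hC⟩ := hG
  refine ⟨|C| * (4 + ‖c‖)^(3/2:ℝ) + |lg ‖f c‖| + 1, by positivity, ?_⟩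
  intro R hR z hz
  rw [mem_closedBall, dist_eq_norm] at hz
  have hzn : 1 + ‖z‖ ≤ (4 + ‖c‖) * R := by
    have : ‖z‖ ≤ ‖z - c‖ + ‖c‖ := by simpa using norm_add_le (z - c) c
    have h0 := norm_nonneg c
    nlinarith
  have h1 : C * (1 + ‖z‖)^(3/2:ℝ) ≤ |C| * ((4 + ‖c‖)^(3/2:ℝ) * R^(3/2:ℝ)) := by
    rw [← Real.mul_rpow (by positivity) (by positivity)]
    have := le_abs_self C
    gcongr
  have h2 : (1:ℝ) ≤ R^(3/2:ℝ) := Real.one_le_rpow hR (by norm_num)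
  have h3 : ‖f c‖ = rx (lg ‖f c‖) := (Real.exp_log (norm_pos_iff.2 hc)).symm
  rw [h3, ← Real.exp_add]
  refine (hC z).trans (Real.exp_le_exp.2 ?_)
  rw [Real.exp_log (norm_pos_iff.2 hc)]
  have h4 := neg_abs_le (lg ‖f c‖)
  have h5 := abs_nonneg (lg ‖f c‖)
  nlinarith

theorem had_dyad (r : ℝ) : 1/(1+r^2) ≤ ∑' k : ℕ, 4 * (1/4:ℝ)^k * (if r ≤ 2^k then 1 else 0) ∧
    Summable (fun k : ℕ => 4 * (1/4:ℝ)^k * (if r ≤ 2^k then 1 else 0)) := by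
  have hs : Summable (fun k : ℕ => 4 * (1/4:ℝ)^k * (if r ≤ 2^k then 1 else 0)) := by
    refine Summable.of_nonneg_of_le (fun k => by positivity) (fun k => ?_)
      ((summable_geometric_of_lt_one (by norm_num) (by norm_num : (1/4:ℝ) < 1)).mul_left 4)
    split_ifs
    · simp
    · simp
  refine ⟨?_, hs⟩
  classical
  have hex : ∃ k : ℕ, r ≤ 2^k := by
    obtain ⟨k, hk⟩ := pow_unbounded_of_one_lt r (by norm_num : (1:ℝ) < 2)
    exact ⟨k, hk.le⟩
  set k := Nat.find hex with hkdef
  have hk := Nat.find_spec hex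
  refine le_trans ?_ (hs.le_tsum k (fun j _ => by positivity))
  rw [if_pos hk, mul_one]
  rcases Nat.eq_zero_or_pos k with h0 | h0
  · rw [h0, pow_zero, div_le_iff₀ (by positivity)]; nlinarith [sq_nonneg r]
  · have hlt := Nat.find_min hex (m := k - 1) (by omega)
    push Not at hlt
    obtain ⟨j, hj⟩ : ∃ j, k = j + 1 := ⟨k - 1, by omega⟩
    rw [hj] at hlt ⊢
    simp only [Nat.add_sub_cancel] at hlt
    rw [div_le_iff₀ (by positivity)]
    have h2 : (2:ℝ)^j * 2^j ≤ r^2 := by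
      have h00 : (0:ℝ) < 2^j := by positivity
      rw [sq]; gcongr; linarith
    have h4 : (1/4:ℝ)^j * (2^j*2^j) = 1 := by
      rw [← mul_pow, ← mul_pow]; norm_num
    have h5 : (0:ℝ) < (1/4:ℝ)^j := by positivity
    rw [pow_succ]
    nlinarith

theorem had_summable {f : ℂ → ℂ} (hf : Differentiable ℂ f) (hG : Growth f) (c : ℂ) (hc : f c ≠ 0) :
    Summable (fun ρ => (mlt f ρ : ℝ) * (1 / (1 + ‖ρ - c‖^2))) := by
  classical
  obtain ⟨D, hD, hb⟩ := had_D hG c hc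
  have hsum : Summable (fun k : ℕ => 4 * (1/4:ℝ)^k * (2 * (D * ((2:ℝ)^k)^(3/2:ℝ)))) := by
    have e : (fun k : ℕ => 4 * (1/4:ℝ)^k * (2 * (D * ((2:ℝ)^k)^(3/2:ℝ)))) =
        fun k => (8 * D) * ((1/4:ℝ) * (2:ℝ)^(3/2:ℝ))^k := by
      ext k
      rw [mul_pow, ← Real.rpow_natCast ((2:ℝ)^(3/2:ℝ)), ← Real.rpow_natCast (2:ℝ) k, ← Real.rpow_mul (by norm_num),
        ← Real.rpow_mul (by norm_num), mul_comm (k:ℝ)]; ring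
    rw [e]
    apply Summable.mul_left
    apply summable_geometric_of_lt_one (by positivity)
    have : (2:ℝ)^(3/2:ℝ) < 2^(2:ℝ) := Real.rpow_lt_rpow_of_exponent_lt (by norm_num) (by norm_num)
    norm_num at this ⊢
    linarith
  refine summable_of_sum_le (c := ∑' k : ℕ, 4 * (1/4:ℝ)^k * (2 * (D * ((2:ℝ)^k)^(3/2:ℝ))))
    (fun ρ => by positivity) ?_
  intro S
  calc ∑ ρ ∈ S, (mlt f ρ : ℝ) * (1 / (1 + ‖ρ - c‖^2))
      ≤ ∑ ρ ∈ S, (mlt f ρ : ℝ) * ∑' k : ℕ, 4 * (1/4:ℝ)^k * (if ‖ρ - c‖ ≤ 2^k then 1 else 0) := by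
        gcongr with ρ hρ; exact (had_dyad _).1
    _ = ∑' k : ℕ, ∑ ρ ∈ S, (mlt f ρ : ℝ) * (4 * (1/4:ℝ)^k * (if ‖ρ - c‖ ≤ 2^k then 1 else 0)) := by
        rw [Summable.tsum_finsetSum]
        · simp_rw [tsum_mul_left]
        · intro ρ _; exact ((had_dyad _).2).mul_left _
    _ ≤ _ := by
        refine Summable.tsum_le_tsum ?_ (summable_sum fun ρ _ => ((had_dyad _).2).mul_left _) hsum
        intro k
        have h := had_count hf c hc (R := (2:ℝ)^k) (by positivity)
          (hb _ (one_le_pow₀ (by norm_num))) (S.filter (fun ρ => ‖ρ - c‖ ≤ 2^k)) (by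
            intro ρ hρ
            rw [mem_closedBall, dist_eq_norm]; exact (Finset.mem_filter.1 hρ).2)
        rw [Finset.sum_filter] at h
        calc _ = 4 * (1/4:ℝ)^k * ∑ a ∈ S, (if ‖a - c‖ ≤ 2^k then (mlt f a:ℝ) else 0) := by
              rw [Finset.mul_sum]
              apply Finset.sum_congr rfl
              intro a _
              split_ifs <;> ring
          _ ≤ _ := by gcongr

theorem mlt_eq_zero {f : ℂ → ℂ} {ρ : ℂ} (h : f ρ ≠ 0) : mlt f ρ = 0 := by
  by_contra h0
  exact h (apply_eq_zero_of_analyticOrderNatAt_ne_zero h0)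

theorem mlt_pos {f : ℂ → ℂ} (hf : Differentiable ℂ f) {c : ℂ} (hc : f c ≠ 0) {ρ : ℂ} (h : f ρ = 0) : 1 ≤ mlt f ρ := by
  obtain ⟨g, -, h1, -⟩ := had_one hf c hc ρ
  by_contra h0
  have : mlt f ρ = 0 := by omega
  obtain ⟨g, -, h1, h2⟩ := had_one hf c hc ρ
  have := h1 ρ
  rw [‹mlt f ρ = 0›, h] at this
  simp at this
  exact h2 this.symm

theorem had_finite {f : ℂ → ℂ} (hf : Differentiable ℂ f) (hG : Growth f) (c : ℂ) (hc : f c ≠ 0) (R : ℝ) :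
    {ρ | f ρ = 0 ∧ ‖ρ - c‖ ≤ R}.Finite := by
  have hs := had_summable hf hG c hc
  have hev := hs.tendsto_cofinite_zero
  have h2 : ∀ᶠ ρ in cofinite, (mlt f ρ : ℝ) * (1 / (1 + ‖ρ - c‖^2)) < 1 / (1+R^2) :=
    hev.eventually (gt_mem_nhds (by positivity))
  refine (eventually_cofinite.1 h2).subset ?_
  rintro ρ ⟨h0, hR⟩
  simp only [mem_ofPred_eq, not_lt]
  have := mlt_pos hf hc h0
  have h1 : (1:ℝ) ≤ mlt f ρ := by exact_mod_cast this
  calc 1 / (1+R^2) ≤ 1 * (1 / (1 + ‖ρ - c‖^2)) := by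
        rw [one_mul]; gcongr
    _ ≤ _ := by gcongr

theorem had_term_summable {f : ℂ → ℂ} (hf : Differentiable ℂ f) (hG : Growth f) (c : ℂ) (hc : f c ≠ 0)
    (s : ℂ) (hs : f s ≠ 0) :
    Summable (fun ρ => (mlt f ρ : ℂ) * (1/(s-ρ) - 1/(c-ρ))) := by
  have h1 := (had_summable hf hG c hc).mul_left (4 * ‖s - c‖)
  refine Summable.of_norm_bounded_eventually h1 ?_
  have hfin := had_finite hf hG c hc (2 * ‖s - c‖ + 1)
  refine eventually_cofinite.2 (hfin.subset ?_)
  intro ρ hρ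
  by_contra hcon
  apply hρ
  by_cases h0 : f ρ = 0
  · have hgt : 2 * ‖s - c‖ + 1 < ‖ρ - c‖ := by
      by_contra h; exact hcon ⟨h0, not_lt.1 h⟩
    have hsp : ‖ρ - c‖ ≤ 2 * ‖s - ρ‖ := by
      have : ‖ρ - c‖ ≤ ‖s - ρ‖ + ‖s - c‖ := by
        have := norm_sub_le (s - c) (s - ρ); simp at this; linarith
      linarith
    have hn1 : 0 < ‖s - ρ‖ := by linarith [norm_nonneg (s - c)]
    have hn2 : 0 < ‖c - ρ‖ := by rw [norm_sub_rev]; linarith [norm_nonneg (s - c)]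
    have e : 1/(s-ρ) - 1/(c-ρ) = (c - s) / ((s-ρ)*(c-ρ)) := by
      have a1 : s - ρ ≠ 0 := norm_pos_iff.1 hn1
      have a2 : c - ρ ≠ 0 := norm_pos_iff.1 hn2
      field_simp; ring
    rw [e, norm_mul, norm_div, norm_mul, norm_sub_rev c s]
    simp only [Complex.norm_natCast]
    rw [mul_left_comm]
    gcongr
    rw [mul_one_div, div_le_div_iff₀ (by positivity) (by positivity)]
    rw [norm_sub_rev c ρ]
    have : 1 ≤ ‖ρ - c‖ := by linarith [norm_nonneg (s - c)]
    have h5 : 1 + ‖ρ - c‖^2 ≤ 4 * (‖s - ρ‖ * ‖ρ - c‖) := by nlinarith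
    have := norm_nonneg (s - c)
    nlinarith
  · rw [mlt_eq_zero h0]; simp

theorem had_main {f : ℂ → ℂ} (hf : Differentiable ℂ f) (hG : Growth f) (c : ℂ) (hc : f c ≠ 0)
    (s : ℂ) (hs : f s ≠ 0) :
    HasSum (fun ρ => (mlt f ρ : ℂ) * (1/(s-ρ) - 1/(c-ρ))) (logDeriv f s - logDeriv f c) := by
  classical
  have hsm := had_term_summable hf hG c hc s hs
  obtain ⟨D, hD, hb⟩ := had_D hG c hc
  set T : ℕ → Finset ℂ := fun n => (had_finite hf hG c hc (n:ℝ)).toFinset with hT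
  set t : ℂ → ℂ := fun ρ => (mlt f ρ : ℂ) * (1/(s-ρ) - 1/(c-ρ)) with ht
  have lim1 : Tendsto (fun n => ∑ ρ ∈ T n, t ρ) atTop (𝓝 (∑' ρ, t ρ)) := by
    have e : ∀ n, ∑ ρ ∈ T n, t ρ = ∑' ρ, (if ρ ∈ T n then t ρ else 0) := by
      intro n
      rw [tsum_eq_sum (s := T n)]
      · apply Finset.sum_congr rfl; intro ρ h; rw [if_pos h]
      · intro ρ h; rw [if_neg h]
    simp_rw [e]
    refine tendsto_tsum_of_dominated_convergence hsm.norm ?_ ?_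
    · intro ρ
      by_cases h0 : f ρ = 0
      · refine tendsto_const_nhds.congr' ?_
        filter_upwards [eventually_ge_atTop ⌈‖ρ - c‖⌉₊] with n hn
        rw [if_pos]
        simp only [hT, Finite.mem_toFinset, mem_ofPred_eq]
        exact ⟨h0, (Nat.le_ceil _).trans (by exact_mod_cast hn)⟩
      · have : t ρ = 0 := by simp [ht, mlt_eq_zero h0]
        simp [this]
    · filter_upwards with n ρ
      split_ifs
      · rfl
      · simp
  have lim2 : Tendsto (fun n => ∑ ρ ∈ T n, t ρ) atTop (𝓝 (logDeriv f s - logDeriv f c)) := by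
    rw [tendsto_iff_norm_sub_tendsto_zero]
    have hz : Tendsto (fun n : ℕ => 64 * D * ‖s - c‖ * ((n:ℝ)^(-(1/2):ℝ))) atTop (𝓝 0) := by
      have := ((tendsto_rpow_neg_atTop (by norm_num : (0:ℝ) < 1/2)).comp tendsto_natCast_atTop_atTop).const_mul (64 * D * ‖s - c‖)
      simpa using this
    refine squeeze_zero' (Eventually.of_forall fun _ => norm_nonneg _) ?_ hz
    filter_upwards [eventually_ge_atTop 1, eventually_gt_atTop ⌈8 * ‖s - c‖⌉₊] with n hn hn2
    have hn' : (1:ℝ) ≤ n := by exact_mod_cast hn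
    have h := had_var hf c hc (R := n) (b := D * (n:ℝ)^(3/2:ℝ)) (by linarith) (by positivity) (hb n hn') (T n)
      (by
        intro ρ hρ
        simp only [hT, Finite.mem_toFinset, mem_ofPred_eq] at hρ
        rw [mem_closedBall, dist_eq_norm]; exact hρ.2)
      (by
        intro ρ hρ h0
        simp only [hT, Finite.mem_toFinset, mem_ofPred_eq]
        rw [mem_closedBall, dist_eq_norm] at hρ
        exact ⟨h0, hρ⟩) s hs (Nat.lt_of_ceil_lt hn2)
    rw [norm_sub_rev]
    refine h.trans (le_of_eq ?_)
    have : (n:ℝ)^(3/2:ℝ) = (n:ℝ)^(-(1/2):ℝ) * n^2 := by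
      rw [← Real.rpow_natCast (n:ℝ) 2, ← Real.rpow_add (by linarith)]; norm_num
    rw [this]; field_simp
  rw [← tendsto_nhds_unique lim1 lim2]
  exact hsm.hasSum

end hadamard2

section growth
open Metric Filter Topology

theorem Growth.exists_nonneg {f : ℂ → ℂ} (h : Growth f) :
    ∃ C : ℝ, 0 ≤ C ∧ ∀ z, ‖f z‖ ≤ rx (C * (1 + ‖z‖)^(3/2:ℝ)) := by
  obtain ⟨C, hC⟩ := h
  refine ⟨max C 0, le_max_right _ _, fun z => (hC z).trans (Real.exp_le_exp.2 ?_)⟩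
  gcongr; exact le_max_left _ _

theorem growth_one_le (z : ℂ) : (1:ℝ) ≤ (1 + ‖z‖)^(3/2:ℝ) :=
  Real.one_le_rpow (by linarith [norm_nonneg z]) (by norm_num)

theorem Growth.const (a : ℂ) : Growth (fun _ => a) := by
  refine ⟨‖a‖, fun z => ?_⟩
  have h := growth_one_le z
  have h1 : ‖a‖ ≤ rx ‖a‖ := by linarith [Real.add_one_le_exp ‖a‖]
  refine h1.trans (Real.exp_le_exp.2 ?_)
  nlinarith [norm_nonneg a]

theorem Growth.mul {f g : ℂ → ℂ} (hf : Growth f) (hg : Growth g) : Growth (fun z => f z * g z) := by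
  obtain ⟨C, hC⟩ := hf
  obtain ⟨D, hD⟩ := hg
  refine ⟨C + D, fun z => ?_⟩
  rw [norm_mul, add_mul, Real.exp_add]
  exact mul_le_mul (hC z) (hD z) (norm_nonneg _) (Real.exp_nonneg _)

theorem Growth.add {f g : ℂ → ℂ} (hf : Growth f) (hg : Growth g) : Growth (fun z => f z + g z) := by
  obtain ⟨C, hC0, hC⟩ := hf.exists_nonneg
  obtain ⟨D, hD0, hD⟩ := hg.exists_nonneg
  refine ⟨C + D + 1, fun z => ?_⟩
  have h := growth_one_le z
  have h1 : ‖f z‖ ≤ rx ((C + D) * (1 + ‖z‖)^(3/2:ℝ)) := (hC z).trans (Real.exp_le_exp.2 (by gcongr; linarith))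
  have h2 : ‖g z‖ ≤ rx ((C + D) * (1 + ‖z‖)^(3/2:ℝ)) := (hD z).trans (Real.exp_le_exp.2 (by gcongr; linarith))
  have h3 : 2 ≤ rx ((1 + ‖z‖)^(3/2:ℝ)) := by linarith [Real.add_one_le_exp ((1 + ‖z‖)^(3/2:ℝ))]
  rw [show (C + D + 1) * (1 + ‖z‖)^(3/2:ℝ) = (C + D) * (1 + ‖z‖)^(3/2:ℝ) + (1 + ‖z‖)^(3/2:ℝ) by ring, Real.exp_add]
  have h4 := norm_add_le (f z) (g z)
  nlinarith [Real.exp_pos ((C + D) * (1 + ‖z‖)^(3/2:ℝ))]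

theorem Growth.sum {ι : Type*} (S : Finset ι) {f : ι → ℂ → ℂ} (h : ∀ i ∈ S, Growth (f i)) :
    Growth (fun z => ∑ i ∈ S, f i z) := by
  classical
  induction S using Finset.induction_on with
  | empty => simpa using Growth.const 0
  | insert a S ha ih =>
    simp_rw [Finset.sum_insert ha]
    exact (h a (by simp)).add (ih (fun i hi => h i (by simp [hi])))

theorem Growth.exp_lin (a : ℂ) : Growth (fun z => Complex.exp (a * z)) := by
  refine ⟨‖a‖, fun z => ?_⟩
  rw [Complex.norm_exp]
  apply Real.exp_le_exp.2
  have h1 : (a * z).re ≤ ‖a‖ * ‖z‖ := (Complex.re_le_norm _).trans (norm_mul _ _).le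
  have h2 : ‖z‖ ≤ (1 + ‖z‖)^(3/2:ℝ) := by
    have : (1 + ‖z‖)^(1:ℝ) ≤ (1 + ‖z‖)^(3/2:ℝ) :=
      Real.rpow_le_rpow_of_exponent_le (by linarith [norm_nonneg z]) (by norm_num)
    rw [Real.rpow_one] at this; linarith
  nlinarith [norm_nonneg a]

theorem Growth.comp_lin {f : ℂ → ℂ} (hf : Growth f) (a b : ℂ) : Growth (fun z => f (a * z + b)) := by
  obtain ⟨C, hC0, hC⟩ := hf.exists_nonneg
  refine ⟨C * (1 + ‖a‖ + ‖b‖)^(3/2:ℝ), fun z => (hC _).trans (Real.exp_le_exp.2 ?_)⟩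
  rw [mul_assoc, ← Real.mul_rpow (by positivity) (by positivity)]
  gcongr
  have := norm_add_le (a * z) b
  rw [norm_mul] at this
  nlinarith [norm_nonneg a, norm_nonneg b, norm_nonneg z, mul_nonneg (norm_nonneg b) (norm_nonneg z)]

theorem Growth.id : Growth (fun z => z) := by
  refine ⟨1, fun z => ?_⟩
  have h2 : ‖z‖ ≤ (1 + ‖z‖)^(3/2:ℝ) := by
    have : (1 + ‖z‖)^(1:ℝ) ≤ (1 + ‖z‖)^(3/2:ℝ) :=
      Real.rpow_le_rpow_of_exponent_le (by linarith [norm_nonneg z]) (by norm_num)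
    rw [Real.rpow_one] at this; linarith
  linarith [Real.add_one_le_exp (1 * (1 + ‖z‖)^(3/2:ℝ))]

theorem growth_young {p : ℝ} (hp : 0 < p) : ∃ c : ℝ, 0 ≤ c ∧ ∀ σ t : ℝ, 0 ≤ σ → 1 ≤ t →
    t^(σ-1) ≤ rx (c * σ^(3/2:ℝ)) * rx (p/2 * t) := by
  refine ⟨((3 / (3*p/2)^(1/3:ℝ))^(3/2:ℝ)) / (3/2), by positivity, ?_⟩
  intro σ t hσ ht
  have ht0 : 0 < t := by linarith
  have h1 : t^(σ-1) ≤ t^σ := Real.rpow_le_rpow_of_exponent_le ht (by linarith)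
  refine h1.trans ?_
  rw [← Real.exp_add, Real.rpow_def_of_pos ht0]
  apply Real.exp_le_exp.2
  have h2 := Real.log_le_rpow_div ht0.le (by norm_num : (0:ℝ) < 1/3)
  have hpq : (3:ℝ).HolderConjugate (3/2) := by constructor <;> norm_num
  have h3 := Real.young_inequality_of_nonneg (a := (3*p/2)^(1/3:ℝ) * t^(1/3:ℝ)) (b := 3 / (3*p/2)^(1/3:ℝ) * σ)
    (by positivity) (by positivity) hpq
  have e1 : ((3*p/2)^(1/3:ℝ) * t^(1/3:ℝ))^(3:ℝ) / 3 = p/2 * t := by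
    rw [Real.mul_rpow (by positivity) (by positivity), ← Real.rpow_mul (by positivity), ← Real.rpow_mul (by positivity)]
    norm_num; ring
  have e2 : (3 / (3*p/2)^(1/3:ℝ) * σ)^(3/2:ℝ) = (3 / (3*p/2)^(1/3:ℝ))^(3/2:ℝ) * σ^(3/2:ℝ) :=
    Real.mul_rpow (by positivity) (by positivity)
  have e3 : (3*p/2)^(1/3:ℝ) * t^(1/3:ℝ) * (3 / (3*p/2)^(1/3:ℝ) * σ) = 3 * t^(1/3:ℝ) * σ := by
    have : (0:ℝ) < (3*p/2)^(1/3:ℝ) := by positivity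
    field_simp
  rw [e1, e2, e3] at h3
  have h4 : lg t * σ ≤ 3 * t^(1/3:ℝ) * σ := by
    gcongr; linarith
  calc _ ≤ _ := h4.trans h3
    _ = _ := by ring

theorem growth_half (P : WeakFEPair ℂ) {p : ℝ} (hp : 0 < p)
    (hf : (P.f · - P.f₀) =O[atTop] (fun t => rx (-p * t))) :
    ∃ C : ℝ, 0 ≤ C ∧ ∀ s : ℂ, P.k / 2 ≤ s.re → ‖P.Λ₀ s‖ ≤ rx (C * (1 + ‖s‖)^(3/2:ℝ)) := by
  obtain ⟨c, hc0, hc⟩ := growth_young hp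
  have hM := (P.isStrongFEPair_toStrongFEPair.hasMellin (P.k/2 : ℝ)).1
  have hM' : MellinConvergent P.f_modif (P.k/2 : ℝ) := hM
  have hI0 : IntegrableOn (fun t : ℝ => ‖P.f_modif t‖ * t^(P.k/2 - 1)) (Ioi 0) := by
    refine IntegrableOn.congr_fun hM'.norm ?_ measurableSet_Ioi
    intro t ht
    simp only [norm_smul]
    rw [Complex.norm_cpow_eq_rpow_re_of_pos ht, mul_comm]; simp
  have hI1 : IntegrableOn (fun t : ℝ => ‖P.f t - P.f₀‖ * rx (p/2 * t)) (Ici 1) := by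
    refine LocallyIntegrableOn.integrableOn_of_isBigO_atTop (g := fun t => rx (-(p/2) * t)) ?_ ?_ ?_
    · have h1 : LocallyIntegrableOn (fun t => ‖P.f t - P.f₀‖) (Ici 1) :=
        ((P.hf_int.sub (locallyIntegrableOn_const _)).norm).mono_set (fun t ht => by
          simp only [mem_Ici] at ht; simp only [mem_Ioi]; linarith)
      refine h1.mul_continuousOn ?_ isClosed_Ici.isLocallyClosed
      fun_prop
    · have := hf.norm_left.mul (Asymptotics.isBigO_refl (fun t => rx (p/2 * t)) atTop)
      refine this.congr_right ?_
      intro t; rw [← Real.exp_add]; congr 1; ring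
    · refine ⟨Ioi 0, Ioi_mem_atTop 0, ?_⟩
      exact exp_neg_integrableOn_Ioi 0 (by positivity)
  set A := ∫ t in Ioi (0:ℝ), ‖P.f_modif t‖ * t^(P.k/2 - 1) with hA
  set B := ∫ t in Ici (1:ℝ), ‖P.f t - P.f₀‖ * rx (p/2 * t) with hB
  have hA0 : 0 ≤ A := setIntegral_nonneg measurableSet_Ioi (fun t ht => by
    have : (0:ℝ) < t := ht
    positivity)
  have hB0 : 0 ≤ B := setIntegral_nonneg measurableSet_Ici (fun t ht => by positivity)
  refine ⟨c + A + B, by positivity, ?_⟩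
  intro s hs
  have hσ : 0 ≤ s.re := by linarith [P.hk]
  have hint : Integrable ((Ici (1:ℝ)).indicator (fun t => ‖P.f t - P.f₀‖ * rx (p/2 * t))) :=
    hI1.integrable_indicator measurableSet_Ici
  have step : ‖P.Λ₀ s‖ ≤ A + rx (c * s.re^(3/2:ℝ)) * B := by
    have e : A + rx (c * s.re^(3/2:ℝ)) * B = ∫ t in Ioi (0:ℝ), (‖P.f_modif t‖ * t^(P.k/2 - 1) +
        rx (c * s.re^(3/2:ℝ)) * (Ici (1:ℝ)).indicator (fun t => ‖P.f t - P.f₀‖ * rx (p/2 * t)) t) := by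
      rw [integral_add hI0 (hint.integrableOn.const_mul _), integral_const_mul, setIntegral_indicator measurableSet_Ici,
        inter_eq_right.2]
      intro t ht; simp only [mem_Ici] at ht; simp only [mem_Ioi]; linarith
    rw [e]
    unfold WeakFEPair.Λ₀ mellin
    refine norm_integral_le_of_norm_le (hI0.add (hint.integrableOn.const_mul _)) ?_
    refine (ae_restrict_iff' measurableSet_Ioi).2 (Eventually.of_forall ?_)
    intro t ht
    have ht0 : (0:ℝ) < t := ht
    rw [norm_smul, Complex.norm_cpow_eq_rpow_re_of_pos ht]
    simp only [Complex.sub_re, Complex.one_re]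
    rcases lt_trichotomy t 1 with h | h | h
    · rw [indicator_of_notMem (by simp only [mem_Ici]; linarith), mul_zero, add_zero, mul_comm]
      gcongr ?_ * ?_
      exact Real.rpow_le_rpow_of_exponent_ge ht0 h.le (by linarith)
    · have : P.f_modif t = 0 := by simp [WeakFEPair.f_modif, h]
      rw [this]; simp only [norm_zero, mul_zero, zero_mul, zero_add]
      have := indicator_nonneg (s := Ici (1:ℝ)) (f := fun t => ‖P.f t - P.f₀‖ * rx (p/2 * t)) (fun t _ => by positivity) t
      positivity
    · have hm : P.f_modif t = P.f t - P.f₀ := by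
        simp only [WeakFEPair.f_modif, Pi.add_apply]
        rw [indicator_of_mem (by simpa using h), indicator_of_notMem (by simp only [mem_Ioo]; intro hh; linarith [hh.2]), add_zero]
      rw [indicator_of_mem (by simp only [mem_Ici]; linarith), hm]
      have h1 := hc s.re t hσ h.le
      have h2 : 0 ≤ ‖P.f t - P.f₀‖ * t^(P.k/2 - 1) := by positivity
      calc _ ≤ (rx (c * s.re^(3/2:ℝ)) * rx (p/2 * t)) * ‖P.f t - P.f₀‖ := by gcongr
        _ = rx (c * s.re^(3/2:ℝ)) * (‖P.f t - P.f₀‖ * rx (p/2 * t)) := by ring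
        _ ≤ _ := by linarith
  refine step.trans ?_
  set X := (1 + ‖s‖)^(3/2:ℝ) with hX
  have hX1 : 1 ≤ X := growth_one_le s
  have h3 : c * s.re^(3/2:ℝ) ≤ c * X := by
    refine mll (Real.rpow_le_rpow hσ ?_ (by norm_num)) hc0
    linarith [Complex.re_le_norm s]
  calc A + rx (c * s.re^(3/2:ℝ)) * B ≤ rx (c * X) * A + rx (c * X) * B := by
        have : 1 ≤ rx (c * X) := Real.one_le_exp (by positivity)
        gcongr
        nlinarith
    _ = rx (c * X) * (A + B) := by ring
    _ ≤ rx (c * X) * rx ((A + B) * X) := by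
        gcongr
        have := Real.add_one_le_exp ((A + B) * X)
        nlinarith
    _ = _ := by rw [← Real.exp_add]; congr 1; ring

theorem growth_FE (P : WeakFEPair ℂ) {p r : ℝ} (hp : 0 < p) (hr : 0 < r)
    (hf : (P.f · - P.f₀) =O[atTop] (fun t => rx (-p * t)))
    (hg : (P.g · - P.g₀) =O[atTop] (fun t => rx (-r * t))) : Growth P.Λ₀ := by
  obtain ⟨C, hC0, hC⟩ := growth_half P hp hf
  obtain ⟨D, hD0, hD⟩ := growth_half P.symm hr hg
  have hk := P.hk
  refine ⟨C + (D * (1 + P.k)^(3/2:ℝ) + ‖P.ε‖), fun s => ?_⟩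
  have hX := growth_one_le s
  by_cases h : P.k / 2 ≤ s.re
  · refine (hC s h).trans (Real.exp_le_exp.2 ?_)
    have : 0 ≤ D * (1 + P.k)^(3/2:ℝ) + ‖P.ε‖ := by positivity
    gcongr
    linarith
  · have h1 := P.functional_equation₀ (P.k - s)
    rw [sub_sub_cancel] at h1
    rw [h1, smul_eq_mul, norm_mul]
    have h2 := hD (P.k - s) (by simp only [WeakFEPair.symm, Complex.sub_re, Complex.ofReal_re]; linarith)
    have h3 : (1 + ‖(P.k:ℂ) - s‖)^(3/2:ℝ) ≤ (1 + P.k)^(3/2:ℝ) * (1 + ‖s‖)^(3/2:ℝ) := by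
      rw [← Real.mul_rpow (by positivity) (by positivity)]
      gcongr
      have := norm_sub_le (P.k:ℂ) s
      rw [Complex.norm_real, Real.norm_of_nonneg hk.le] at this
      nlinarith [norm_nonneg s]
    have h4 : ‖P.ε‖ ≤ rx (‖P.ε‖ * (1 + ‖s‖)^(3/2:ℝ)) := by
      have := Real.add_one_le_exp (‖P.ε‖ * (1 + ‖s‖)^(3/2:ℝ))
      nlinarith [norm_nonneg P.ε]
    calc _ ≤ rx (‖P.ε‖ * (1 + ‖s‖)^(3/2:ℝ)) * rx (D * ((1 + P.k)^(3/2:ℝ) * (1 + ‖s‖)^(3/2:ℝ))) := by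
          gcongr
          refine h2.trans (Real.exp_le_exp.2 ?_); gcongr
      _ ≤ _ := by
          rw [← Real.exp_add]; apply Real.exp_le_exp.2
          have : 0 ≤ C * (1 + ‖s‖)^(3/2:ℝ) := by positivity
          nlinarith

open HurwitzZeta in
theorem growth_even (a : UnitAddCircle) : Growth (completedHurwitzZetaEven₀ a) := by
  have h : Growth (hurwitzEvenFEPair a).Λ₀ := by
    obtain ⟨p, hp, hp'⟩ := isBigO_atTop_evenKernel_sub a
    obtain ⟨r, hr, hr'⟩ := isBigO_atTop_cosKernel_sub a
    refine growth_FE _ hp hr ?_ ?_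
    · rw [← Asymptotics.isBigO_norm_left] at hp' ⊢
      refine hp'.congr_left ?_
      intro t
      simp only [hurwitzEvenFEPair, Function.comp]
      rw [← Complex.norm_real]; push_cast
      split_ifs <;> simp
    · rw [← Asymptotics.isBigO_norm_left] at hr' ⊢
      refine hr'.congr_left ?_
      intro t
      simp only [hurwitzEvenFEPair, Function.comp]
      rw [← Complex.norm_real]; push_cast
      rfl
  have h2 := (h.comp_lin (1/2) 0).mul (Growth.const (1/2))
  refine Eq.mp ?_ h2
  congr 1; ext s; unfold completedHurwitzZetaEven₀; congr 1 <;> ring_nf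

open HurwitzZeta in
theorem growth_odd (a : UnitAddCircle) : Growth (completedHurwitzZetaOdd a) := by
  have h : Growth (hurwitzOddFEPair a).Λ₀ := by
    obtain ⟨p, hp, hp'⟩ := isBigO_atTop_oddKernel a
    obtain ⟨r, hr, hr'⟩ := isBigO_atTop_sinKernel a
    refine growth_FE _ hp hr ?_ ?_
    · rw [← Asymptotics.isBigO_norm_left] at hp' ⊢
      refine hp'.congr_left ?_
      intro t
      simp [hurwitzOddFEPair, Function.comp]
    · rw [← Asymptotics.isBigO_norm_left] at hr' ⊢
      refine hr'.congr_left ?_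
      intro t
      simp [hurwitzOddFEPair, Function.comp]
  have h2 := (h.comp_lin (1/2) (1/2)).mul (Growth.const (1/2))
  refine Eq.mp ?_ h2
  congr 1; ext s; unfold completedHurwitzZetaOdd
  rw [WeakFEPair.Λ, (isStrong_hurwitzOddFEPair a).hf₀, (isStrong_hurwitzOddFEPair a).hg₀]
  simp only [smul_zero, sub_zero]
  ring_nf

end growth

section xisec
open Complex DirichletCharacter Filter Topology

theorem ld_mul (f g : ℂ → ℂ) (s : ℂ) (hf : f s ≠ 0) (hg : g s ≠ 0) (df : DifferentiableAt ℂ f s)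
    (dg : DifferentiableAt ℂ g s) : logDeriv (fun z => f z * g z) s = logDeriv f s + logDeriv g s :=
  logDeriv_mul s hf hg df dg

noncomputable def xi {q : ℕ} [NeZero q] (χ : DirichletCharacter ℂ q) (s : ℂ) : ℂ :=
  if q = 1 then s*(1-s)*completedRiemannZeta₀ s - 1 else χ.completedLFunction s

open scoped Classical in
noncomputable def par {q : ℕ} (χ : DirichletCharacter ℂ q) : ℕ := if χ.Even then 0 else 1

noncomputable def pf (q : ℕ) (s : ℂ) : ℂ := if q = 1 then s*(1-s) else 1

theorem gammaFactor_par {q : ℕ} [NeZero q] (χ : DirichletCharacter ℂ q) (s : ℂ) :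
    gammaFactor χ s = Gammaℝ (s + par χ) := by
  unfold gammaFactor par; split_ifs <;> simp

theorem par_le {q : ℕ} (χ : DirichletCharacter ℂ q) : par χ ≤ 1 := by
  unfold par; split_ifs <;> simp

theorem par_inv {q : ℕ} (χ : DirichletCharacter ℂ q) : par χ⁻¹ = par χ := by
  unfold par
  congr 1
  simp only [DirichletCharacter.Even, MulChar.inv_apply_eq_inv', inv_eq_one]

theorem prim_ne {q : ℕ} [NeZero q] {χ : DirichletCharacter ℂ q} (hχ : χ.IsPrimitive) :
    q = 1 ∨ χ ≠ 1 := by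
  by_cases h : χ = 1
  · left; rw [IsPrimitive, h, conductor_one] at hχ; exact hχ.symm
  · exact Or.inr h

theorem inv_ne {q : ℕ} {χ : DirichletCharacter ℂ q} (hq : q = 1 ∨ χ ≠ 1) : q = 1 ∨ χ⁻¹ ≠ 1 := by
  refine hq.imp_right (fun h => ?_); simpa using h

variable {q : ℕ} [NeZero q] {χ : DirichletCharacter ℂ q}

theorem xi_eq (hq : q = 1 ∨ χ ≠ 1) {s : ℂ} (h0 : s ≠ 0) (h1 : s ≠ 1) :
    xi χ s = pf q s * completedLFunction χ s := by
  by_cases h : q = 1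
  · subst h
    simp only [xi, pf, if_true]
    rw [completedLFunction_modOne_eq, completedRiemannZeta_eq]
    have : 1 - s ≠ 0 := sub_ne_zero.2 h1.symm
    field_simp
    ring
  · simp [xi, pf, h]

theorem xi_eqL (hq : q = 1 ∨ χ ≠ 1) {s : ℂ} (h0 : 0 < s.re) (h1 : s ≠ 1) :
    xi χ s = pf q s * (Gammaℝ (s + par χ) * LFunction χ s) := by
  have h0' : s ≠ 0 := by rintro rfl; simp at h0
  rw [xi_eq hq h0' h1, LFunction_eq_completed_div_gammaFactor χ s (Or.inl h0'), gammaFactor_par,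
    mul_div_cancel₀]
  exact Gammaℝ_ne_zero_of_re_pos (by simp; positivity)

theorem pf_ne {s : ℂ} (h0 : s ≠ 0) (h1 : s ≠ 1) : pf q s ≠ 0 := by
  unfold pf; split_ifs
  · exact mul_ne_zero h0 (sub_ne_zero.2 h1.symm)
  · exact one_ne_zero

theorem xi_zero_iff (hq : q = 1 ∨ χ ≠ 1) {s : ℂ} (h0 : 0 < s.re) (h1 : s ≠ 1) :
    xi χ s = 0 ↔ LFunction χ s = 0 := by
  have h0' : s ≠ 0 := by rintro rfl; simp at h0
  have : Gammaℝ (s + par χ) ≠ 0 := Gammaℝ_ne_zero_of_re_pos (by simp; positivity)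
  rw [xi_eqL hq h0 h1]
  simp [pf_ne h0' h1, this]

theorem xi_diff (hq : q = 1 ∨ χ ≠ 1) : Differentiable ℂ (xi χ) := by
  by_cases h : q = 1
  · have : xi χ = fun s => s*(1-s)*completedRiemannZeta₀ s - 1 := by ext s; simp [xi, h]
    rw [this]
    have := differentiable_completedZeta₀
    fun_prop
  · have : xi χ = completedLFunction χ := by ext s; simp [xi, h]
    rw [this]
    exact differentiable_completedLFunction (hq.resolve_left h)

theorem xi_growth (hq : q = 1 ∨ χ ≠ 1) : Growth (xi χ) := by
  by_cases h : q = 1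
  · have : xi χ = fun s => s*((-1)*s+1)*completedRiemannZeta₀ s + (-1) := by
      ext s; simp [xi, h]; ring
    rw [this]
    exact ((Growth.id.mul (Growth.id.comp_lin (-1) 1)).mul (growth_even 0)).add (Growth.const (-1))
  · have hχ := hq.resolve_left h
    have h0 : χ 0 = 0 := χ.map_zero' h
    have hs : ∑ j, χ j = 0 := χ.sum_eq_zero_of_ne_one hχ
    have : xi χ = fun s => cexp (-Complex.log q * s) *
        (∑ j, χ j * HurwitzZeta.completedHurwitzZetaEven₀ (ZMod.toAddCircle j) s)
        + cexp (-Complex.log q * s) *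
        (∑ j, χ j * HurwitzZeta.completedHurwitzZetaOdd (ZMod.toAddCircle j) s) := by
      ext s
      have hcq : (q:ℂ) ^ (-s) = cexp (-Complex.log q * s) := by
        rw [cpow_def_of_ne_zero (by exact_mod_cast NeZero.ne q)]; ring_nf
      simp only [xi, h, if_false, completedLFunction, ZMod.completedLFunction_eq, h0, hs,
        ZMod.completedLFunction₀, hcq]
      simp
    rw [this]
    refine ((Growth.exp_lin _).mul (Growth.sum _ fun j _ => (Growth.const _).mul (growth_even _))).add
      ((Growth.exp_lin _).mul (Growth.sum _ fun j _ => (Growth.const _).mul (growth_odd _)))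

theorem xi_ne_right (hq : q = 1 ∨ χ ≠ 1) {s : ℂ} (hs : 1 ≤ s.re) : xi χ s ≠ 0 := by
  by_cases h1 : s = 1
  · by_cases h : q = 1
    · subst h1; simp [xi, h]
    · subst h1
      have hχ := hq.resolve_left h
      have := LFunction_ne_zero_of_one_le_re χ (.inl hχ) hs
      intro h0
      rw [LFunction_eq_completed_div_gammaFactor χ 1 (by simp)] at this
      simp only [xi, h, if_false] at h0
      simp [h0] at this
  · rw [Ne, xi_zero_iff hq (by linarith) h1]
    exact LFunction_ne_zero_of_one_le_re χ (.inr h1) hs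

theorem xi_FE (hχ : χ.IsPrimitive) (s : ℂ) :
    xi χ (1 - s) = (q:ℂ) ^ (s - 1/2) * rootNumber χ * xi χ⁻¹ s := by
  by_cases h : q = 1
  · subst h
    simp only [xi, if_true, rootNumber_modOne, completedRiemannZeta₀_one_sub]
    simp only [Nat.cast_one, one_cpow, one_mul]; ring
  · simp only [xi, h, if_false]
    exact hχ.completedLFunction_one_sub s

theorem root_ne (hχ : χ.IsPrimitive) : rootNumber χ ≠ 0 := by
  intro h
  have h1 := xi_FE hχ (-1)
  rw [h] at h1
  simp only [mul_zero, zero_mul] at h1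
  exact xi_ne_right (prim_ne hχ) (by norm_num) h1

theorem xi_ne_left (hχ : χ.IsPrimitive) {s : ℂ} (hs : s.re ≤ 0) : xi χ s ≠ 0 := by
  have h1 := xi_FE hχ (1 - s)
  rw [sub_sub_cancel] at h1
  rw [h1]
  have hq0 : (q:ℂ) ≠ 0 := by exact_mod_cast NeZero.ne q
  refine mul_ne_zero (mul_ne_zero ?_ (root_ne hχ)) (xi_ne_right (inv_ne (prim_ne hχ)) (by simp; linarith))
  rw [cpow_def_of_ne_zero hq0]; exact Complex.exp_ne_zero _

theorem xi_logDeriv_left (hχ : χ.IsPrimitive) {s : ℂ} (hs : 1 ≤ s.re) :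
    logDeriv (xi χ) (1 - s) = - lg q - logDeriv (xi χ⁻¹) s := by
  have hq0 : (q:ℂ) ≠ 0 := by exact_mod_cast NeZero.ne q
  have e : (fun s => xi χ (1 - s)) = fun s => cexp (Complex.log q * (s - 1/2)) * (rootNumber χ * xi χ⁻¹ s) := by
    ext s; rw [xi_FE hχ, cpow_def_of_ne_zero hq0, mul_assoc]
  have d1 := xi_diff (prim_ne hχ)
  have d2 := xi_diff (inv_ne (prim_ne hχ))
  have l1 : logDeriv (fun s => xi χ (1 - s)) s = - logDeriv (xi χ) (1 - s) := by
    have : HasDerivAt (fun s => xi χ (1 - s)) (deriv (xi χ) (1-s) * (-1)) s :=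
      HasDerivAt.comp s (d1 (1-s)).hasDerivAt ((hasDerivAt_id s).const_sub 1)
    rw [logDeriv_apply, this.deriv, logDeriv_apply]; ring
  have l2 := congrArg (fun f => logDeriv f s) e
  simp only [l1] at l2
  rw [ld_mul (fun s => cexp (Complex.log q * (s - 1/2))) (fun s => rootNumber χ * xi χ⁻¹ s) s (Complex.exp_ne_zero _) (mul_ne_zero (root_ne hχ) (xi_ne_right (inv_ne (prim_ne hχ)) hs))
    (by fun_prop) (by fun_prop), logDeriv_const_mul _ _ (root_ne hχ)] at l2
  have l3 : logDeriv (fun s => cexp (Complex.log q * (s - 1/2))) s = Complex.log q := by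
    have : HasDerivAt (fun s => cexp (Complex.log q * (s - 1/2))) (cexp (Complex.log q * (s - 1/2)) * (Complex.log q * 1)) s :=
      (((hasDerivAt_id s).sub_const _).const_mul _).cexp
    rw [logDeriv_apply, this.deriv]; field_simp [Complex.exp_ne_zero]
  rw [l3] at l2
  rw [Complex.ofReal_log (by positivity), ofReal_natCast]
  linear_combination -l2

/-- archimedean + polar part -/
noncomputable def archA (χ : DirichletCharacter ℂ q) (s : ℂ) : ℂ :=
  -lg pp / 2 + digamma ((s + par χ)/2) / 2 + (if q = 1 then 1/s + 1/(s-1) else 0)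

theorem logDeriv_GammaR {s : ℂ} (hs : 0 < s.re) :
    logDeriv Gammaℝ s = -lg pp / 2 + digamma (s/2) / 2 := by
  have hG : DifferentiableAt ℂ Gamma (s/2) := by
    refine differentiableAt_Gamma _ fun m h => ?_
    have := congrArg re h
    simp at this
    have : (0:ℝ) ≤ m := by positivity
    linarith
  have hpi : (pp:ℂ) ≠ 0 := by exact_mod_cast Real.pi_ne_zero
  have e : Gammaℝ = fun s => cexp (Complex.log pp * (-s/2)) * Gamma (s/2) := by
    ext s; rw [Gammaℝ_def, cpow_def_of_ne_zero hpi]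
  have hd : HasDerivAt (fun s => Gamma (s/2)) (deriv Gamma (s/2) * (1/2)) s :=
    HasDerivAt.comp s hG.hasDerivAt ((hasDerivAt_id s).div_const 2)
  have hGn : Gamma (s/2) ≠ 0 := Gamma_ne_zero_of_re_pos (by simp; linarith)
  rw [e, ld_mul (fun s => cexp (Complex.log pp * (-s/2))) (fun s => Gamma (s/2)) s (Complex.exp_ne_zero _) hGn (by fun_prop) hd.differentiableAt]
  have l3 : logDeriv (fun s => cexp (Complex.log pp * (-s/2))) s = -Complex.log pp/2 := by
    have : HasDerivAt (fun s => cexp (Complex.log pp * (-s/2))) (cexp (Complex.log pp * (-s/2)) * (Complex.log pp * (-1/2))) s :=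
      (((hasDerivAt_id s).neg.div_const 2).const_mul _).cexp
    rw [logDeriv_apply, this.deriv]; field_simp [Complex.exp_ne_zero]
  rw [l3, logDeriv_apply, hd.deriv, Complex.ofReal_log Real.pi_pos.le, digamma_def, logDeriv_apply]
  ring

theorem xi_logDeriv_right (hq : q = 1 ∨ χ ≠ 1) {s : ℂ} (hs : 1 < s.re) :
    logDeriv (xi χ) s = archA χ s
      - LSeries ((fun n : ℕ => χ n) * (fun n : ℕ => (ArithmeticFunction.vonMangoldt n : ℂ))) s := by
  have h0 : s ≠ 0 := by rintro rfl; norm_num at hs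
  have h1 : s ≠ 1 := by rintro rfl; norm_num at hs
  have ev : xi χ =ᶠ[𝓝 s] fun s => pf q s * (Gammaℝ (s + par χ) * LSeries (fun n => χ n) s) := by
    filter_upwards [(continuous_re.isOpen_preimage _ isOpen_Ioi).mem_nhds (show s ∈ re ⁻¹' Ioi 1 from hs)] with z hz
    have hz : 1 < z.re := hz
    rw [xi_eqL hq (by linarith) (by rintro rfl; norm_num at hz), LFunction_eq_LSeries χ hz]
  have evd := ev.deriv_eq
  rw [logDeriv_apply, evd, ev.eq_of_nhds, ← logDeriv_apply]
  have hre : 0 < (s + par χ).re := by simp; positivity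
  have hG : DifferentiableAt ℂ Gammaℝ (s + par χ) := by
    have := (differentiable_Gammaℝ_inv (s + par χ)).inv (inv_ne_zero (Gammaℝ_ne_zero_of_re_pos hre))
    refine this.congr_of_eventuallyEq (Eventually.of_forall fun z => ?_)
    simp
  have hG2 : HasDerivAt (fun s => Gammaℝ (s + par χ)) (deriv Gammaℝ (s + par χ) * 1) s :=
    hG.hasDerivAt.comp_add_const s (par χ : ℂ) |>.congr_deriv (by ring)
  have hL : DifferentiableAt ℂ (fun s => LSeries (fun n => χ n) s) s := by
    have : LFunction χ =ᶠ[𝓝 s] LSeries (fun n => χ n) := by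
      filter_upwards [(continuous_re.isOpen_preimage _ isOpen_Ioi).mem_nhds (show s ∈ re ⁻¹' Ioi 1 from hs)] with z hz
      exact LFunction_eq_LSeries χ hz
    exact (differentiableAt_LFunction χ s (.inl h1)).congr_of_eventuallyEq this.symm
  have hLn : LSeries (fun n => χ n) s ≠ 0 := by
    rw [← LFunction_eq_LSeries χ hs]; exact LFunction_ne_zero_of_one_le_re χ (.inr h1) hs.le
  have hGn := Gammaℝ_ne_zero_of_re_pos hre
  have hpd : Differentiable ℂ (pf q) := by
    unfold pf; split_ifs <;> fun_prop
  rw [ld_mul (pf q) (fun s => Gammaℝ (s + par χ) * LSeries (fun n => χ n) s) s (pf_ne h0 h1) (mul_ne_zero hGn hLn) (hpd s) (hG2.differentiableAt.mul hL),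
    ld_mul (fun s => Gammaℝ (s + par χ)) (LSeries (fun n => χ n)) s hGn hLn hG2.differentiableAt hL, logDeriv_apply (fun s => Gammaℝ (s + par χ)),
    hG2.deriv, mul_one, ← logDeriv_apply, logDeriv_GammaR hre, archA]
  have : LSeries ((fun n : ℕ => χ n) * (fun n : ℕ => (ArithmeticFunction.vonMangoldt n : ℂ))) s
    = - logDeriv (LSeries (fun n => χ n)) s := by
    rw [logDeriv_apply, ← neg_div]; exact LSeries_twist_vonMangoldt_eq χ hs
  rw [this]
  have hp : logDeriv (pf q) s = if q = 1 then 1/s + 1/(s-1) else 0 := by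
    split_ifs with h
    · have : pf q = fun s => s * (1 - s) := by ext z; simp [pf, h]
      have hd : HasDerivAt (fun s : ℂ => s * (1 - s)) (1 * (1 - s) + s * (-1)) s :=
        (hasDerivAt_id s).mul ((hasDerivAt_id s).const_sub 1)
      rw [this, logDeriv_apply, hd.deriv]
      have h2 : 1 - s ≠ 0 := sub_ne_zero.2 h1.symm
      have h3 : s - 1 ≠ 0 := sub_ne_zero.2 h1
      field_simp; ring
    · have : pf q = fun s => 1 := by ext z; simp [pf, h]
      rw [this]; simp [logDeriv_apply]
  rw [hp]; ring

end xisec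

section dig
open Complex Filter Topology Metric

theorem deriv_tendsto_of_bdd {U : Set ℂ} (hU : IsOpen U) {z : ℂ} {r : ℝ} (hr : 0 < r)
    (hzU : closedBall z r ⊆ U) (F : ℕ → ℂ → ℂ) (f : ℂ → ℂ) (M : ℝ)
    (hF : ∀ᶠ n in atTop, DifferentiableOn ℂ (F n) U) (hf : DifferentiableOn ℂ f U)
    (hM : ∀ᶠ n in atTop, ∀ w ∈ sphere z r, ‖F n w‖ ≤ M)
    (hl : ∀ w ∈ sphere z r, Tendsto (fun n => F n w) atTop (𝓝 (f w))) :
    Tendsto (fun n => deriv (F n) z) atTop (𝓝 (deriv f z)) := by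
  rw [← two_pi_I_inv_smul_circleIntegral_sub_sq_inv_smul_of_differentiable hU hzU hf (mem_ball_self hr)]
  have : (fun n => (2 * pp * I : ℂ)⁻¹ • ∮ w in C(z, r), ((w - z) ^ 2)⁻¹ • F n w) =ᶠ[atTop] fun n => deriv (F n) z := by
    filter_upwards [hF] with n hn
    exact two_pi_I_inv_smul_circleIntegral_sub_sq_inv_smul_of_differentiable hU hzU hn (mem_ball_self hr)
  refine Tendsto.congr' this ?_
  refine Tendsto.const_smul ?_ _
  simp only [circleIntegral]
  refine intervalIntegral.tendsto_integral_filter_of_dominated_convergence (fun _ => r * ((r^2)⁻¹ * M)) ?_ ?_ (by simp) ?_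
  · filter_upwards [hF] with n hn
    refine Continuous.aestronglyMeasurable ?_
    simp only [deriv_circleMap]
    refine ((continuous_circleMap 0 r).mul continuous_const).smul (Continuous.smul (f := fun θ => ((circleMap z r θ - z)^2)⁻¹) (g := fun θ => F n (circleMap z r θ)) ?_ ?_)
    · refine Continuous.inv₀ (by fun_prop) fun θ => ?_
      simp [circleMap_eq_center_iff, sub_eq_zero, hr.ne']
    · exact hn.continuousOn.comp_continuous (continuous_circleMap z r)
        fun θ => hzU (sphere_subset_closedBall (circleMap_mem_sphere z hr.le θ))
  · filter_upwards [hM] with n hn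
    refine Eventually.of_forall fun θ _ => ?_
    simp only [deriv_circleMap, norm_smul, norm_mul, norm_inv, norm_pow]
    have h1 := hn _ (circleMap_mem_sphere z hr.le θ)
    have h2 : ‖circleMap z r θ - z‖ = r := by simpa [dist_eq_norm] using circleMap_mem_sphere z hr.le θ
    have h3 : ‖circleMap 0 r θ‖ = r := by simp [abs_of_pos hr]
    rw [h2, h3]; simp only [norm_I, mul_one]
    gcongr
  · refine Eventually.of_forall fun θ _ => ?_
    exact ((hl _ (circleMap_mem_sphere z hr.le θ)).const_smul _).const_smul _

theorem GammaSeq_bdd {a b : ℝ} (ha : 0 < a) {w : ℂ} (h1 : a ≤ w.re) (h2 : w.re ≤ b) {n : ℕ} (hn : n ≠ 0) :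
    ‖GammaSeq w n‖ ≤ Real.Gamma a + Real.Gamma b := by
  rw [GammaSeq_eq_approx_Gamma_integral (by linarith) hn]
  have hb : 0 < b := by linarith
  have ia := Real.GammaIntegral_convergent ha
  have ib := Real.GammaIntegral_convergent hb
  rw [Real.Gamma_eq_integral ha, Real.Gamma_eq_integral hb, ← integral_add ia ib,
    intervalIntegral.integral_of_le (by positivity)]
  calc _ ≤ ∫ x in Ioc (0:ℝ) n, (rx (-x) * x^(a-1) + rx (-x) * x^(b-1)) := by
        refine norm_integral_le_of_norm_le ((ia.add ib).mono_set Ioc_subset_Ioi_self) ?_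
        refine (ae_restrict_iff' measurableSet_Ioc).2 (Eventually.of_forall fun x hx => ?_)
        rw [norm_mul, norm_cpow_eq_rpow_re_of_pos hx.1]
        have hp : 0 ≤ 1 - x/n := by
          rw [sub_nonneg, div_le_one (by positivity)]; exact hx.2
        rw [Complex.norm_of_nonneg (by positivity), ← mul_add]
        have h0 := hx.1
        refine mul_le_mul (Real.one_sub_div_pow_le_exp_neg hx.2) ?_ (by positivity) (by positivity)
        simp only [sub_re, one_re]
        rcases le_total x 1 with h | h
        · have := Real.rpow_le_rpow_of_exponent_ge hx.1 h (show a - 1 ≤ w.re - 1 by linarith)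
          have : 0 ≤ x^(b-1) := by positivity
          linarith
        · have := Real.rpow_le_rpow_of_exponent_le h (show w.re - 1 ≤ b - 1 by linarith)
          have : 0 ≤ x^(a-1) := by positivity
          linarith
    _ ≤ _ := by
        refine setIntegral_mono_set (ia.add ib) ?_ Ioc_subset_Ioi_self.eventuallyLE
        refine (ae_restrict_iff' measurableSet_Ioi).2 (Eventually.of_forall fun x hx => ?_)
        have : 0 < x := hx
        simp only [Pi.zero_apply, Pi.add_apply]; positivity

theorem nz_add {z : ℂ} (hz : 0 < z.re) (k : ℕ) : z + k ≠ 0 := by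
  intro h; have := congrArg re h; simp at this
  have : (0:ℝ) ≤ k := by positivity
  linarith

theorem nz_neg {z : ℂ} (hz : 0 < z.re) (k : ℕ) : z ≠ -k := by
  intro h; exact nz_add hz k (by rw [h]; ring)

theorem digamma_tendsto {z : ℂ} (hz : 0 < z.re) :
    Tendsto (fun n : ℕ => (lg n : ℂ) - ∑ k ∈ Finset.range (n+1), 1/(z+k)) atTop (𝓝 (digamma z)) := by
  have hlog : ∀ n : ℕ, n ≠ 0 → ∀ w : ℂ, 0 < w.re → HasDerivAt (fun s => GammaSeq s n)
      (GammaSeq w n * ((lg n : ℂ) - ∑ k ∈ Finset.range (n+1), 1/(w+k))) w := by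
    intro n hn w hw
    have hnc : (n:ℂ) ≠ 0 := by exact_mod_cast hn
    have hP : ∀ m, HasDerivAt (fun s : ℂ => ∏ j ∈ Finset.range m, (s + j))
        ((∏ j ∈ Finset.range m, (w + j)) * ∑ k ∈ Finset.range m, 1/(w+k)) w := by
      intro m
      induction m with
      | zero => simpa using hasDerivAt_const w (1:ℂ)
      | succ m ih =>
        simp only [Finset.prod_range_succ, Finset.sum_range_succ]
        refine (ih.mul ((hasDerivAt_id w).add_const (m:ℂ))).congr_deriv ?_
        have := nz_add hw m
        simp only [id]
        field_simp
    have h1 : HasDerivAt (fun s : ℂ => (n:ℂ)^s * (n.factorial:ℂ)) ((n:ℂ)^w * Complex.log n * 1 * n.factorial) w :=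
      ((hasDerivAt_id w).const_cpow (Or.inl hnc)).mul_const _
    have hne : ∏ j ∈ Finset.range (n+1), (w + j) ≠ 0 := Finset.prod_ne_zero_iff.2 fun j _ => nz_add hw j
    refine (h1.div (hP (n+1)) hne).congr_deriv ?_
    rw [GammaSeq, Complex.ofReal_log (by positivity), ofReal_natCast]
    field_simp
  have hd := deriv_tendsto_of_bdd (U := re ⁻¹' Ioi 0) (continuous_re.isOpen_preimage _ isOpen_Ioi) (z := z)
    (r := z.re/2) (by linarith) ?_ (fun n s => GammaSeq s n) Gamma (Real.Gamma (z.re/2) + Real.Gamma (2*z.re)) ?_ ?_ ?_ ?_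
  · have h2 := hd.div (GammaSeq_tendsto_Gamma z) (Gamma_ne_zero_of_re_pos hz)
    rw [digamma_def, logDeriv_apply]
    refine h2.congr' ?_
    filter_upwards [eventually_ne_atTop 0] with n hn
    simp only [Pi.div_apply]
    rw [(hlog n hn z hz).deriv, mul_div_cancel_left₀]
    rw [GammaSeq]
    refine div_ne_zero (mul_ne_zero ?_ (by exact_mod_cast n.factorial_ne_zero)) (Finset.prod_ne_zero_iff.2 fun j _ => nz_add hz j)
    rw [cpow_def_of_ne_zero (by exact_mod_cast hn)]; exact Complex.exp_ne_zero _
  · intro w hw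
    have h := (abs_re_le_norm (w - z)).trans (mem_closedBall_iff_norm.1 hw)
    rw [sub_re, abs_le] at h
    show 0 < w.re; linarith
  · filter_upwards [eventually_ne_atTop 0] with n hn w hw
    exact (hlog n hn w hw).differentiableAt.differentiableWithinAt
  · intro w hw
    exact (differentiableAt_Gamma _ (nz_neg hw)).differentiableWithinAt
  · filter_upwards [eventually_ne_atTop 0] with n hn w hw
    have h := (abs_re_le_norm (w - z)).trans (mem_sphere_iff_norm.1 hw).le
    rw [sub_re, abs_le] at h
    exact GammaSeq_bdd (by linarith) (by linarith) (by linarith) hn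
  · intro w hw
    exact GammaSeq_tendsto_Gamma w

theorem digamma_add_nat {z : ℂ} (hz : 0 < z.re) (n : ℕ) :
    digamma (z + n) = digamma z + ∑ k ∈ Finset.range n, 1/(z+k) := by
  induction n with
  | zero => simp
  | succ n ih =>
    rw [Finset.sum_range_succ, ← add_assoc, ← ih]
    push_cast
    rw [← add_assoc, digamma_apply_add_one _ (nz_neg (by simp; positivity))]
    simp

theorem digamma_hasSum {z : ℂ} (hz : 0 < z.re) :
    HasSum (fun k : ℕ => 1/((k:ℂ)+1) - 1/(z+(k+1))) (digamma z + Real.eulerMascheroniConstant + 1/z) := by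
  have hsum : Summable (fun k : ℕ => 1/((k:ℂ)+1) - 1/(z+(k+1))) := by
    have hs : Summable (fun k : ℕ => ‖z‖ * (1 / ((k+1:ℕ):ℝ)^2)) :=
      ((summable_nat_add_iff 1).2 (Real.summable_one_div_nat_pow.2 one_lt_two)).mul_left _
    refine Summable.of_norm_bounded hs fun k => ?_
    have h1 : (k:ℂ)+1 ≠ 0 := by exact_mod_cast Nat.succ_ne_zero k
    have h2 : z + (k+1) ≠ 0 := by simpa using nz_add hz (k+1)
    have : 1/((k:ℂ)+1) - 1/(z+(k+1)) = z * (1/(((k:ℂ)+1)*(z+(k+1)))) := by field_simp; ring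
    rw [this, norm_mul, norm_div, norm_one, norm_mul]
    have e1 : ‖(k:ℂ)+1‖ = k+1 := by rw [← Nat.cast_succ, norm_natCast]; push_cast; ring
    have e2 : (k:ℝ)+1 ≤ ‖z + (k+1)‖ := by
      refine le_trans ?_ (abs_re_le_norm _)
      simp; refine le_trans ?_ (le_abs_self _); linarith
    rw [e1]; push_cast
    gcongr
    nlinarith
  have h1 := (continuous_ofReal.tendsto _).comp Real.tendsto_harmonic_sub_log
  have h2 := (digamma_tendsto hz).add (h1.add_const (1/z))
  refine (hsum.hasSum_iff_tendsto_nat).2 ?_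
  rw [← add_assoc] at h2
  refine h2.congr fun n => ?_
  simp only [Function.comp, Finset.sum_range_succ', Finset.sum_sub_distrib]
  rw [harmonic]
  push_cast
  simp only [one_div]
  simp only [add_zero]; ring

theorem digamma_re_mono {x y Y : ℝ} (hx : 0 < x) (h : |y| ≤ |Y|) :
    (digamma (x + y * I)).re ≤ (digamma (x + Y * I)).re := by
  have h1 := hasSum_re (digamma_hasSum (z := x + y * I) (by simpa using hx))
  have h2 := hasSum_re (digamma_hasSum (z := x + Y * I) (by simpa using hx))
  have key : ∀ t : ℝ, 0 < t → (1/((t:ℂ) + Y * I)).re ≤ (1/((t:ℂ) + y * I)).re := by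
    intro t ht
    simp only [one_div, inv_re, normSq_apply]
    simp
    have : y*y ≤ Y*Y := by rw [← abs_mul_abs_self y, ← abs_mul_abs_self Y]; gcongr
    have : 0 < t*t + y*y := by nlinarith [mul_pos ht ht, mul_self_nonneg y]
    gcongr
  have := hasSum_le (fun k => ?_) h1 h2
  · have k0 := key x hx
    simp only [add_re, ofReal_re] at this
    linarith
  · rw [sub_re, sub_re]
    have := key (x + (k+1)) (by positivity)
    push_cast at this
    have e : ∀ y : ℝ, (x:ℂ) + (k+1) + y * I = x + y * I + (k+1) := fun y => by ring
    rw [e, e] at this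
    linarith

theorem digamma_re_le {x Y : ℝ} (hx : 1 ≤ x) (hY : 0 < Y) :
    (digamma (x + Y * I)).re ≤ lg (x^2+Y^2) / 2 + 1/(x+Y-1) := by
  set z : ℂ := x + Y * I with hz
  have hzr : 0 < z.re := by simp [hz]; linarith
  let D : ℕ → ℝ := fun n => lg ((x+n)^2+Y^2)/2 + 1/(x+n+Y-1) - (digamma (z+n)).re
  have hanti : Antitone D := by
    refine antitone_nat_of_succ_le fun n => ?_
    simp only [D]
    rw [digamma_add_nat hzr (n+1), digamma_add_nat hzr n, Finset.sum_range_succ]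
    set u : ℝ := x + n with hu
    have hu1 : 1 ≤ u := by rw [hu]; linarith [Nat.cast_nonneg (α := ℝ) n]
    have e1 : (1/(z + n)).re = u/(u^2+Y^2) := by
      simp only [one_div, inv_re, normSq_apply, hz, hu]; simp; ring_nf
    simp only [add_re, e1]
    have e2 : x + ((n+1:ℕ):ℝ) = u + 1 := by rw [hu]; push_cast; ring
    rw [e2]
    have hp : 0 < u^2+Y^2 := by positivity
    have hl : lg ((u+1)^2+Y^2) ≤ lg (u^2+Y^2) + (2*u+1)/(u^2+Y^2) := by
      have : (u+1)^2+Y^2 = (u^2+Y^2) * (1 + (2*u+1)/(u^2+Y^2)) := by field_simp; ring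
      rw [this, Real.log_mul hp.ne' (by positivity)]
      have := Real.log_le_sub_one_of_pos (show 0 < 1 + (2*u+1)/(u^2+Y^2) by positivity)
      linarith
    have hs : (1/2)/(u^2+Y^2) ≤ 1/(u+Y-1) - 1/(u+1+Y-1) := by
      have a1 : 0 < u + Y - 1 := by linarith
      have a2 : 0 < u + 1 + Y - 1 := by linarith
      rw [div_sub_div _ _ a1.ne' a2.ne', div_le_div_iff₀ hp (by positivity)]
      nlinarith [sq_nonneg (u-Y)]
    have : (2*u+1)/(u^2+Y^2) = 2*(u/(u^2+Y^2)) + 2*((1/2)/(u^2+Y^2)) := by field_simp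
    linarith
  have hlim : Tendsto D atTop (𝓝 0) := by
    rw [← tendsto_add_atTop_iff_nat 1]
    have t1 : Tendsto (fun n : ℕ => (digamma (z + ((n+1:ℕ):ℂ))).re - lg n) atTop (𝓝 0) := by
      have := (continuous_re.tendsto _).comp ((digamma_tendsto hzr).sub_const (digamma z))
      simp only [sub_self, zero_re] at this
      have := this.neg
      simp only [neg_zero] at this
      refine this.congr fun n => ?_
      rw [digamma_add_nat hzr]
      simp only [Function.comp, sub_re, add_re, ofReal_re]; ring
    have hat : Tendsto (fun n : ℕ => (n:ℝ)) atTop atTop := tendsto_natCast_atTop_atTop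
    have t2 : Tendsto (fun n : ℕ => 1/(x+((n+1:ℕ):ℝ)+Y-1)) atTop (𝓝 0) := by
      refine Tendsto.const_div_atTop ?_ _
      refine tendsto_atTop_mono (fun n => ?_) hat
      push_cast; linarith
    have t3 : Tendsto (fun n : ℕ => lg ((x+((n+1:ℕ):ℝ))^2+Y^2)/2 - lg n) atTop (𝓝 0) := by
      have i1 : Tendsto (fun n : ℕ => (x+1)/(n:ℝ)) atTop (𝓝 0) := Tendsto.const_div_atTop hat _
      have i2 : Tendsto (fun n : ℕ => Y/(n:ℝ)) atTop (𝓝 0) := Tendsto.const_div_atTop hat _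
      have i3 : Tendsto (fun n : ℕ => lg ((1+(x+1)/(n:ℝ))^2 + (Y/n)^2)/2) atTop (𝓝 (lg ((1+0)^2+0^2)/2)) := by
        refine (Tendsto.log (((i1.const_add 1).pow 2).add (i2.pow 2)) (by norm_num)).div_const 2
      simp at i3
      refine i3.congr' ?_
      filter_upwards [eventually_ne_atTop 0] with n hn
      have hn0 : (0:ℝ) < n := by positivity
      have : (x+((n+1:ℕ):ℝ))^2+Y^2 = (n:ℝ)^2 * ((1+(x+1)/(n:ℝ))^2 + (Y/n)^2) := by
        push_cast; field_simp; ring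
      rw [this, Real.log_mul (by positivity) (by positivity), Real.log_pow]
      push_cast; ring
    have := (t3.add t2).sub t1
    simp only [add_zero, sub_zero] at this
    refine this.congr fun n => ?_
    simp only [D]; ring
  have := hanti.le_of_tendsto hlim 0
  simp only [D, Nat.cast_zero, add_zero] at this
  linarith

end dig

section dens
open Complex DirichletCharacter Filter Topology

noncomputable abbrev vM (n : ℕ) : ℝ := ArithmeticFunction.vonMangoldt n

theorem vM_sum : Summable (fun n : ℕ => vM n / (n:ℝ)^2) ∧ ∑' n : ℕ, vM n / (n:ℝ)^2 ≤ 1 := by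
  let φ : ℕ → ℝ := fun n => (lg n + 1) / n
  have key : ∀ n : ℕ, vM (n+4) / ((n+4:ℕ):ℝ)^2 ≤ φ (n+3) - φ (n+4) := by
    intro n
    have h1 : vM (n+4) ≤ lg ((n+4:ℕ):ℝ) := ArithmeticFunction.vonMangoldt_le_log
    refine (div_le_div_of_nonneg_right h1 (by positivity)).trans ?_
    simp only [φ]
    push_cast
    set u : ℝ := (n:ℝ) + 4 with hu
    have hu4 : 4 ≤ u := by rw [hu]; linarith [Nat.cast_nonneg (α := ℝ) n]
    have e3 : (n:ℝ) + 3 = u - 1 := by rw [hu]; ring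
    rw [e3]
    have hl : lg u - 1/(u-1) ≤ lg (u-1) := by
      have := Real.log_le_sub_one_of_pos (show 0 < u/(u-1) by apply div_pos <;> linarith)
      rw [Real.log_div (by linarith) (by linarith)] at this
      have e : u/(u-1) - 1 = 1/(u-1) := by field_simp [show u-1≠0 by linarith]; ring
      linarith
    have h4 : 4/3 ≤ lg u := by
      have : lg 4 ≤ lg u := Real.log_le_log (by norm_num) hu4
      have h2 : lg 4 = 2 * lg 2 := by rw [show (4:ℝ) = 2^2 by norm_num, Real.log_pow]; norm_num
      have := Real.log_two_gt_d9
      linarith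
    have hp : 0 < u - 1 := by linarith
    have hp2 : 0 < u := by linarith
    have h5 : u ≤ lg u * (u-1) := by nlinarith
    calc lg u / u^2 ≤ (lg u - 1/(u-1) + 1)/(u-1) - (lg u + 1)/u := by
          rw [← sub_nonneg]
          have : (lg u - 1/(u-1) + 1)/(u-1) - (lg u + 1)/u - lg u / u^2
            = (lg u * (u-1) - u) / (u^2 * (u-1)^2) := by field_simp; ring
          rw [this]; exact div_nonneg (by linarith) (by positivity)
      _ ≤ _ := by gcongr
  have hφ : Tendsto φ atTop (𝓝 0) := by
    have h1 : Tendsto (fun x : ℝ => lg x / x) atTop (𝓝 0) := by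
      simpa using Real.tendsto_pow_log_div_mul_add_atTop 1 0 1 one_ne_zero
    have h2 : Tendsto (fun x : ℝ => 1 / x) atTop (𝓝 0) := by simpa using tendsto_inv_atTop_zero (𝕜 := ℝ)
    have := (h1.add h2).comp (tendsto_natCast_atTop_atTop (R := ℝ))
    simp only [add_zero] at this
    refine this.congr fun n => ?_
    simp [φ]; ring
  have hps : ∀ N, ∑ n ∈ Finset.range N, (φ (n+3) - φ (n+4)) = φ 3 - φ (N+3) := by
    intro N
    induction N with
    | zero => simp
    | succ N ih => rw [Finset.sum_range_succ, ih]; ring_nf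
  have hφ0 : ∀ n, 1 ≤ n → 0 ≤ φ n := by
    intro n hn
    have : 0 ≤ lg n := Real.log_natCast_nonneg n
    simp only [φ]; positivity
  have bd : ∀ N, ∑ n ∈ Finset.range N, vM (n+4) / ((n+4:ℕ):ℝ)^2 ≤ φ 3 := by
    intro N
    refine (Finset.sum_le_sum fun n _ => key n).trans ?_
    rw [hps]; linarith [hφ0 (N+3) (by omega)]
  have nn : ∀ n, 0 ≤ vM n / (n:ℝ)^2 := fun n => div_nonneg ArithmeticFunction.vonMangoldt_nonneg (by positivity)
  have s4 : Summable (fun n : ℕ => vM (n+4) / ((n+4:ℕ):ℝ)^2) :=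
    summable_of_sum_range_le (fun n => nn _) bd
  have s0 := (summable_nat_add_iff (f := fun n : ℕ => vM n / (n:ℝ)^2) 4).1 s4
  refine ⟨s0, ?_⟩
  rw [← s0.sum_add_tsum_nat_add 4]
  have h4 := Real.tsum_le_of_sum_range_le (fun n => nn _) bd
  have v2 : vM 2 = lg 2 := by
    simpa using ArithmeticFunction.vonMangoldt_apply_prime Nat.prime_two
  have v3 : vM 3 = lg 3 := by
    simpa using ArithmeticFunction.vonMangoldt_apply_prime Nat.prime_three
  have v0 : vM 0 = 0 := by simp [vM]
  have v1 : vM 1 = 0 := by simp [vM]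
  have l3 : lg 3 ≤ 1.1 := by
    rw [Real.log_le_iff_le_exp (by norm_num)]
    have := Real.exp_one_gt_d9
    have h2 : rx 1.1 = rx 1 * rx 0.1 := by rw [← Real.exp_add]; norm_num
    have h3 := Real.quadratic_le_exp_of_nonneg (show (0:ℝ) ≤ 0.1 by norm_num)
    rw [h2]; nlinarith
  have l2 := Real.log_two_lt_d9
  simp only [Finset.sum_range_succ, Finset.sum_range_zero, v0, v1, v2, v3]
  have : φ 3 ≤ 0.7 := by simp only [φ]; push_cast; rw [div_le_iff₀ (by norm_num)]; linarith
  refine (add_le_add le_rfl (h4.trans this)).trans ?_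
  norm_num
  linarith

variable {q : ℕ} [NeZero q] {χ : DirichletCharacter ℂ q}

theorem LS_le {s : ℂ} (hs : s.re = 2) :
    ‖LSeries ((fun n : ℕ => χ n) * (fun n : ℕ => (vM n : ℂ))) s‖ ≤ 1 := by
  have h := vM_sum
  refine (tsum_of_norm_bounded h.1.hasSum fun n => ?_).trans h.2
  rcases eq_or_ne n 0 with rfl | hn
  · simp [LSeries.term_zero, vM]
  · rw [LSeries.term_of_ne_zero hn, norm_div, Complex.norm_natCast_cpow_of_pos (Nat.pos_of_ne_zero hn), hs]
    have h1 : ‖((fun n : ℕ => χ n) * (fun n : ℕ => (vM n : ℂ))) n‖ ≤ vM n := by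
      simp only [Pi.mul_apply, norm_mul, Complex.norm_real, Real.norm_eq_abs]
      rw [abs_of_nonneg (ArithmeticFunction.vonMangoldt_nonneg)]
      exact mul_le_of_le_one_left ArithmeticFunction.vonMangoldt_nonneg (χ.norm_le_one _)
    rw [show ((2:ℝ)) = ((2:ℕ):ℝ) by norm_num, Real.rpow_natCast]
    gcongr

noncomputable def Pk (ρ : ℂ) (t : ℝ) : ℝ :=
  (2-ρ.re)/((2-ρ.re)^2+(t-ρ.im)^2) + (1+ρ.re)/((1+ρ.re)^2+(t-ρ.im)^2)

noncomputable def polet (t : ℝ) : ℝ := 2/(4+t^2) + 1/(1+t^2)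

theorem archA_re_le {t Y : ℝ} (hY : 100 ≤ Y) (ht : |t| ≤ Y) :
    (archA χ (2 + t * I)).re ≤ (lg (Y/(2*pp)) + 0.025)/2 + polet t := by
  have hpar : (par χ:ℝ) ≤ 1 := by exact_mod_cast par_le χ
  set x : ℝ := (2 + par χ)/2 with hx
  have hx1 : 1 ≤ x := by rw [hx]; linarith [Nat.cast_nonneg (α := ℝ) (par χ)]
  have hx2 : x ≤ 3/2 := by rw [hx]; linarith
  have e1 : ((2:ℂ) + t * I + par χ)/2 = (x:ℂ) + ((t/2:ℝ):ℂ) * I := by rw [hx]; push_cast; ring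
  have d1 := digamma_re_mono (x := x) (y := t/2) (Y := Y/2) (by linarith)
    (by rw [abs_div, abs_div, abs_of_nonneg (show 0 ≤ Y by linarith)]; gcongr)
  have d2 := digamma_re_le (x := x) (Y := Y/2) hx1 (by linarith)
  have h3 : 1/(x+Y/2-1) ≤ 0.02 := by
    rw [div_le_iff₀ (by linarith)]; linarith
  have h4 : lg (x^2+(Y/2)^2)/2 ≤ lg (Y/2) + 0.0005 := by
    have : x^2 + (Y/2)^2 ≤ (Y/2)^2 * rx 0.001 := by
      have := Real.add_one_le_exp (0.001:ℝ)
      nlinarith [mll this (sq_nonneg (Y/2))]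
    have h5 := Real.log_le_log (by positivity) this
    rw [Real.log_mul (by positivity) (by positivity), Real.log_exp, Real.log_pow] at h5
    push_cast at h5; linarith
  have h6 : lg (Y/(2*pp)) = lg (Y/2) - lg pp := by
    rw [← Real.log_div (by positivity) (by positivity)]; congr 1; field_simp
  have e2 : (archA χ (2 + t * I)).re = -lg pp/2 + (digamma ((x:ℂ) + ((t/2:ℝ):ℂ) * I)).re/2
      + (if q = 1 then (1/((2:ℂ)+t*I) + 1/((2:ℂ)+t*I-1)) else 0).re := by
    rw [archA, e1]
    have a1 : (-(lg pp:ℂ)/2).re = -lg pp/2 := by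
      rw [show (-(lg pp:ℂ)/2) = ((-lg pp/2:ℝ):ℂ) by push_cast; ring, ofReal_re]
    have a2 : ∀ w : ℂ, (w/2).re = w.re/2 := fun w => by
      rw [show w/2 = w/((2:ℝ):ℂ) by norm_num, Complex.div_ofReal_re]
    rw [add_re, add_re, a1, a2]
  have h7 : (if q = 1 then (1/((2:ℂ)+t*I) + 1/((2:ℂ)+t*I-1)) else 0).re ≤ polet t := by
    split_ifs
    · refine le_of_eq ?_
      rw [show (2:ℂ)+t*I-1 = 1 + t*I by ring]
      simp only [add_re, one_div, inv_re, normSq_apply, polet]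
      simp; ring_nf
    · simp only [zero_re, polet]; positivity
  rw [e2, h6]
  linarith

theorem dens (hχ : χ.IsPrimitive) {t Y : ℝ} (hY : 100 ≤ Y) (ht : |t| ≤ Y) :
    Summable (fun ρ => (mlt (xi χ) ρ : ℝ) * Pk ρ t) ∧
    ∑' ρ, (mlt (xi χ) ρ : ℝ) * Pk ρ t ≤ lg (q * Y/(2*pp)) + 2.025 + 2 * polet t := by
  have hq := prim_ne hχ
  have hm := hasSum_re (had_main (xi_diff hq) (xi_growth hq) (-1 + t * I) (xi_ne_left hχ (by simp))
    (2 + t * I) (xi_ne_right hq (by simp)))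
  have e : (fun ρ => ((mlt (xi χ) ρ:ℂ)*(1/((2 + t * I)-ρ)-1/((-1 + t * I)-ρ))).re)
      = fun ρ => (mlt (xi χ) ρ : ℝ) * Pk ρ t := by
    ext ρ
    rw [← ofReal_natCast, re_ofReal_mul, sub_re]
    congr 1
    simp only [one_div, inv_re, normSq_apply, Pk, sub_re, add_re, sub_im, add_im]
    simp
    ring_nf
  rw [e] at hm
  refine ⟨hm.summable, ?_⟩
  rw [hm.tsum_eq]
  have l1 := xi_logDeriv_left hχ (s := 2 - t * I) (by simp)
  rw [show (1:ℂ) - (2 - t * I) = -1 + t * I by ring] at l1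
  rw [l1, xi_logDeriv_right hq (by simp), xi_logDeriv_right (inv_ne hq) (by simp)]
  have b1 := archA_re_le (χ := χ) hY ht
  have b2 := archA_re_le (χ := χ⁻¹) (t := -t) hY (by rwa [abs_neg])
  have b3 := (abs_re_le_norm _).trans (LS_le (χ := χ) (s := 2 + t * I) (by simp))
  have b4 := (abs_re_le_norm _).trans (LS_le (χ := χ⁻¹) (s := 2 - t * I) (by simp))
  rw [abs_le] at b3 b4
  have e2 : (2:ℂ) + ((-t:ℝ):ℂ) * I = 2 - t * I := by push_cast; ring
  rw [e2] at b2
  have e3 : polet (-t) = polet t := by simp [polet]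
  have hq0 : (0:ℝ) < q := by exact_mod_cast Nat.pos_of_ne_zero (NeZero.ne q)
  have e4 : lg (q * Y/(2*pp)) = lg q + lg (Y/(2*pp)) := by
    rw [← Real.log_mul (by positivity) (by positivity)]; congr 1; ring
  simp only [sub_re, neg_re, ofReal_re]
  rw [e3] at b2
  rw [e4]
  linarith [b3.1, b4.1]

theorem Pk_nonneg {ρ : ℂ} (h0 : 0 < ρ.re) (h1 : ρ.re < 1) (t : ℝ) : 0 ≤ Pk ρ t := by
  unfold Pk
  have : 0 ≤ 2 - ρ.re := by linarith
  positivity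

theorem mlt_strip (hχ : χ.IsPrimitive) {ρ : ℂ} (h : mlt (xi χ) ρ ≠ 0) :
    0 < ρ.re ∧ ρ.re < 1 ∧ LFunction χ ρ = 0 := by
  have hz : xi χ ρ = 0 := by by_contra h'; exact h (mlt_eq_zero h')
  have h0 : 0 < ρ.re := by by_contra h'; exact xi_ne_left hχ (not_lt.1 h') hz
  have h1 : ρ.re < 1 := by by_contra h'; exact xi_ne_right (prim_ne hχ) (not_lt.1 h') hz
  exact ⟨h0, h1, (xi_zero_iff (prim_ne hχ) h0 (by rintro rfl; norm_num at h1)).1 hz⟩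

end dens

section hfacts
open Filter Topology
open scoped FourierTransform

theorem integral_exp_sub {E : Type*} [NormedAddCommGroup E] [NormedSpace ℝ E] (g : ℝ → E) :
    ∫ y in Ioi (0:ℝ), g y = ∫ u, rx u • g (rx u) := by
  have h := integral_image_eq_integral_abs_deriv_smul
      (MeasurableSet.univ) (fun x _ ↦ (Real.hasDerivAt_exp x).hasDerivWithinAt)
      (fun x _ y _ hxy ↦ Real.exp_injective hxy) g
  rw [image_univ, Real.range_exp] at h
  simpa [abs_of_pos (Real.exp_pos _)] using h

theorem integrable_exp_sub {E : Type*} [NormedAddCommGroup E] [NormedSpace ℝ E] (g : ℝ → E) :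
    IntegrableOn g (Ioi (0:ℝ)) ↔ Integrable (fun u => rx u • g (rx u)) := by
  have h := integrableOn_image_iff_integrableOn_abs_deriv_smul
      (MeasurableSet.univ) (fun x _ ↦ (Real.hasDerivAt_exp x).hasDerivWithinAt)
      (fun x _ y _ hxy ↦ Real.exp_injective hxy) g
  rw [image_univ, Real.range_exp] at h
  simpa [abs_of_pos (Real.exp_pos _)] using h

noncomputable def phi (u : ℝ) : ℝ := hcut (rx u)
noncomputable def phid (u : ℝ) : ℝ := if u ≤ lg 2 then
  (rx u)^2 * (2 - rx u)^2 * (4 - 3 * rx u - (rx u)^2) * rx (rx u - 1/2) else 0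
noncomputable def phi0 (u : ℝ) : ℝ := (rx u)^2 * (2 - rx u)^3 * rx (rx u - 1/2)

theorem le_log2 (u : ℝ) : u ≤ lg 2 ↔ rx u ≤ 2 := by
  rw [Real.le_log_iff_exp_le (by norm_num)]

theorem phi_eq (u : ℝ) : phi u = if u ≤ lg 2 then phi0 u else 0 := by
  simp only [phi, hcut, le_log2, mem_Icc, (Real.exp_pos u).le, true_and, phi0]

theorem phi0_deriv (u : ℝ) : HasDerivAt phi0 ((rx u)^2 * (2 - rx u)^2 * (4 - 3 * rx u - (rx u)^2) * rx (rx u - 1/2)) u := by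
  have he := Real.hasDerivAt_exp u
  have h := ((he.pow 2).mul ((he.const_sub 2).pow 3)).mul ((he.sub_const (1/2)).exp)
  refine h.congr_deriv ?_
  simp only [Pi.mul_apply, Pi.pow_apply]
  push_cast
  ring

theorem phi_deriv (u : ℝ) : HasDerivAt phi (phid u) u := by
  have hz : phi0 (lg 2) = 0 := by simp [phi0, Real.exp_log]
  rcases lt_trichotomy u (lg 2) with h | h | h
  · have h1 := phi0_deriv u
    simp only [phid, if_pos h.le]
    refine h1.congr_of_eventuallyEq ?_
    filter_upwards [Iio_mem_nhds h] with v hv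
    rw [phi_eq, if_pos (le_of_lt hv)]
  · subst h
    have h1 := phi0_deriv (lg 2)
    have e0 : phid (lg 2) = 0 := by simp [phid, Real.exp_log]
    rw [e0]
    rw [Real.exp_log (by norm_num)] at h1
    have a : HasDerivWithinAt phi 0 (Iic (lg 2)) (lg 2) := by
      refine ((h1.congr_deriv (by norm_num)).hasDerivWithinAt).congr ?_ ?_
      · intro v hv; rw [phi_eq, if_pos (mem_Iic.1 hv)]
      · rw [phi_eq, if_pos le_rfl]
    have b : HasDerivWithinAt phi 0 (Ici (lg 2)) (lg 2) := by
      refine (hasDerivWithinAt_const _ _ (0:ℝ)).congr ?_ ?_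
      · intro v hv
        rw [phi_eq]; split_ifs with hh
        · rw [le_antisymm hh hv, hz]
        · rfl
      · rw [phi_eq, if_pos le_rfl, hz]
    have := a.union b
    rwa [Iic_union_Ici, hasDerivWithinAt_univ] at this
  · simp only [phid, if_neg (not_le.2 h)]
    refine (hasDerivAt_const u (0:ℝ)).congr_of_eventuallyEq ?_
    filter_upwards [Ioi_mem_nhds h] with v hv
    rw [phi_eq, if_neg (not_le.2 hv)]

theorem phi_cont : Continuous phi := continuous_iff_continuousAt.2 fun u => (phi_deriv u).continuousAt
theorem phi_deriv_eq : deriv phi = phid := funext fun u => (phi_deriv u).deriv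
theorem phid_meas : Measurable phid := phi_deriv_eq ▸ measurable_deriv phi

noncomputable def Dom (u : ℝ) : ℝ := (Iic (lg 2)).indicator (fun u => rx (2*u)) u

theorem Dom_int : Integrable Dom := by
  rw [show Dom = (Iic (lg 2)).indicator (fun u => rx (2*u)) from rfl, integrable_indicator_iff measurableSet_Iic]
  exact integrableOn_exp_mul_Iic (by norm_num) _

theorem exp_le_six : rx (3/2) ≤ 5 := by
  have h := Real.exp_one_lt_d9
  have : rx (3/2) ^ 2 = rx 1 ^ 3 := by
    rw [← Real.exp_nat_mul, ← Real.exp_nat_mul]; norm_num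
  have h3 : rx 1 ^ 3 ≤ 2.72^3 := by gcongr; linarith
  nlinarith [Real.exp_pos (3/2:ℝ)]

theorem phi_bd (u : ℝ) : |phi u| ≤ 100 * Dom u ∧ |phid u| ≤ 100 * Dom u ∧ Dom u ≤ 4 ∧ 0 ≤ Dom u := by
  by_cases h : u ≤ lg 2
  · have hd : Dom u = (rx u)^2 := by
      rw [Dom, indicator_of_mem (show u ∈ Iic _ from h), ← Real.exp_nat_mul]; norm_num
    rw [phi_eq, phid, if_pos h, if_pos h, hd, phi0]
    rw [le_log2] at h
    have hp := Real.exp_pos u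
    set t := rx u
    have h2 : rx (t - 1/2) ≤ 5 := (Real.exp_le_exp.2 (by linarith)).trans exp_le_six
    have h3 := Real.exp_pos (t - 1/2)
    refine ⟨?_, ?_, by nlinarith, by positivity⟩
    · rw [abs_mul, abs_mul, abs_of_pos h3, abs_of_nonneg (sq_nonneg t), abs_pow, abs_of_nonneg (show 0 ≤ 2 - t by linarith)]
      have : (2-t)^3 ≤ 2^3 := by gcongr <;> linarith
      calc t^2 * (2-t)^3 * rx (t-1/2) ≤ t^2 * 2^3 * 5 := by gcongr
        _ ≤ _ := by nlinarith [sq_nonneg t]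
    · rw [abs_mul, abs_mul, abs_mul, abs_of_pos h3, abs_of_nonneg (sq_nonneg t), abs_pow, abs_of_nonneg (show 0 ≤ 2 - t by linarith)]
      have a1 : (2-t)^2 * |4 - 3*t-t^2| ≤ 20 := by
        have : |4 - 3*t - t^2| ≤ 6 := by rw [abs_le]; constructor <;> nlinarith
        have h5 : (2-t)^2 ≤ 4 := by nlinarith
        rcases le_total t 1 with h6 | h6
        · have : |4 - 3*t - t^2| ≤ 4 := by rw [abs_le]; constructor <;> nlinarith
          nlinarith [abs_nonneg (4 - 3*t-t^2), sq_nonneg (2-t)]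
        · have : (2-t)^2 ≤ 1 := by nlinarith
          nlinarith [abs_nonneg (4 - 3*t-t^2), sq_nonneg (2-t)]
      calc t^2 * (2-t)^2 * |4 - 3*t-t^2| * rx (t-1/2) = t^2 * ((2-t)^2 * |4 - 3*t-t^2|) * rx (t-1/2) := by ring
        _ ≤ t^2 * 20 * 5 := by gcongr
        _ ≤ _ := by nlinarith [sq_nonneg t]
  · have hd : Dom u = 0 := by rw [Dom, indicator_of_notMem (show u ∉ Iic _ from h)]
    rw [phi_eq, phid, if_neg h, if_neg h, hd]; simp

theorem phi_int : Integrable phi :=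
  (Dom_int.const_mul 100).mono' phi_cont.aestronglyMeasurable (ae_of_all _ fun u => (phi_bd u).1)
theorem phid_int : Integrable phid :=
  (Dom_int.const_mul 100).mono' phid_meas.aestronglyMeasurable (ae_of_all _ fun u => (phi_bd u).2.1)
theorem sq_bd {a d : ℝ} (h : |a| ≤ 100 * d) (h4 : d ≤ 4) (h0 : 0 ≤ d) : a^2 ≤ 40000 * d := by
  rw [← sq_abs]
  nlinarith [abs_nonneg a]
theorem phi2_int : Integrable (fun u => phi u ^ 2) :=
  (Dom_int.const_mul 40000).mono' (phi_cont.pow 2).aestronglyMeasurable (ae_of_all _ fun u => by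
    rw [Real.norm_eq_abs, abs_of_nonneg (sq_nonneg _)]
    exact sq_bd (phi_bd u).1 (phi_bd u).2.2.1 (phi_bd u).2.2.2)
theorem phid2_int : Integrable (fun u => phid u ^ 2) :=
  (Dom_int.const_mul 40000).mono' (phid_meas.pow_const 2).aestronglyMeasurable (ae_of_all _ fun u => by
    rw [Real.norm_eq_abs, abs_of_nonneg (sq_nonneg _)]
    exact sq_bd (phi_bd u).2.1 (phi_bd u).2.2.1 (phi_bd u).2.2.2)

theorem int_aux (f F P : ℝ → ℝ) (hf : Integrable f) (hz : ∀ u, ¬ u ≤ lg 2 → f u = 0)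
    (hF : ∀ t, HasDerivAt F (P t) t) (h : ∀ u, u ≤ lg 2 → f u = P (rx u) * rx u) :
    ∫ u, f u = F 2 - F 0 := by
  have e : ∫ u, f u = ∫ u in Iic (lg 2), f u := by
    rw [setIntegral_eq_integral_of_forall_compl_eq_zero]
    intro u hu; exact hz u hu
  rw [e, setIntegral_congr_fun measurableSet_Iic (fun u hu => h u hu)]
  have := integral_Iic_of_hasDerivAt_of_tendsto' (f := fun u => F (rx u)) (a := lg 2) (m := F 0)
    (f' := fun u => P (rx u) * rx u)
    (fun u _ => (hF _).comp u (Real.hasDerivAt_exp u)) ?_ ?_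
  · rw [this, Real.exp_log (by norm_num)]
  · exact (hf.integrableOn).congr_fun (fun u hu => h u hu) measurableSet_Iic
  · exact ((hF 0).continuousAt.tendsto).comp Real.tendsto_exp_atBot

theorem e_bounds : 20.0855369 ≤ rx 3 ∧ rx 3 ≤ 20.0855370 ∧ 0.36787944 ≤ rx (-1) ∧ rx (-1) ≤ 0.367879442 := by
  have h1 := Real.exp_one_gt_d9
  have h2 := Real.exp_one_lt_d9
  have e3 : rx 3 = rx 1 ^ 3 := by rw [← Real.exp_nat_mul]; norm_num
  refine ⟨?_, ?_, ?_, ?_⟩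
  · rw [e3]; refine le_trans ?_ (pow_le_pow_left₀ (by norm_num) h1.le 3); norm_num
  · rw [e3]; refine (pow_le_pow_left₀ (Real.exp_pos _).le h2.le 3).trans ?_; norm_num
  · rw [Real.exp_neg, le_inv_comm₀ (by norm_num) (Real.exp_pos _)]; refine h2.le.trans ?_; norm_num
  · rw [Real.exp_neg, inv_le_comm₀ (Real.exp_pos _) (by norm_num)]; refine le_trans ?_ h1.le; norm_num

theorem phi2_val : ∫ u, phi u ^ 2 ≤ 2.2575 := by
  let Q : ℝ → ℝ := fun t => -31989/8 + 31989/4*t - 31989/4*t^2 + 10663/2*t^3 - 10599/4*t^4 + 2043/2*t^5 - 601/2*t^6 + 63*t^7 - 33/4*t^8 + 1/2*t^9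
  have hQ : ∀ t, HasDerivAt Q (31989/4 - 31989/4*(2*t) + 10663/2*(3*t^2) - 10599/4*(4*t^3) + 2043/2*(5*t^4) - 601/2*(6*t^5) + 63*(7*t^6) - 33/4*(8*t^7) + 1/2*(9*t^8)) t := by
    intro t
    have p : ∀ (c : ℝ) (n : ℕ), HasDerivAt (fun t : ℝ => c * t^n) (c * (n * t^(n-1))) t := fun c n => (hasDerivAt_pow n t).const_mul c
    have := (((((((((p (31989/4) 1).const_add (-31989/8)).sub (p (31989/4) 2)).add (p (10663/2) 3)).sub (p (10599/4) 4)).add (p (2043/2) 5)).sub (p (601/2) 6)).add (p 63 7)).sub (p (33/4) 8)).add (p (1/2) 9)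
    refine (this.congr_deriv ?_).congr_of_eventuallyEq (Eventually.of_forall fun t => ?_)
    · push_cast; norm_num
    · simp [Q]
  have h := int_aux (fun u => phi u ^2) (fun t => Q t * rx (2*t-1)) (fun t => t^3*(2-t)^6*rx (2*t-1)) phi2_int
    (fun u hu => by rw [phi_eq, if_neg hu]; simp)
    (fun t => by
      have he : HasDerivAt (fun t : ℝ => rx (2*t-1)) (rx (2*t-1) * 2) t := by
        simpa using (((hasDerivAt_id t).const_mul 2).sub_const 1).exp
      refine ((hQ t).mul he).congr_deriv ?_
      simp only [Q]; ring)
    (fun u hu => by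
      rw [phi_eq, if_pos hu, phi0, mul_pow, show 2 * rx u - 1 = ((2:ℕ):ℝ) * (rx u - 1/2) by push_cast; ring, Real.exp_nat_mul]
      ring)
  rw [h]
  simp only [Q]
  have := e_bounds
  norm_num
  linarith

theorem phid2_val : ∫ u, phid u ^ 2 ≤ 6.924 := by
  let Q : ℝ → ℝ := fun t => -103983/16 + 103983/8*t - 103983/8*t^2 + 34661/4*t^3 - 34149/8*t^4 + 6113/4*t^5 - 1259/4*t^6 - 3/2*t^7 + 59/8*t^8 + 29/4*t^9 - 15/4*t^10 + 1/2*t^11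
  have hQ : ∀ t, HasDerivAt Q (103983/8 - 103983/8*(2*t) + 34661/4*(3*t^2) - 34149/8*(4*t^3) + 6113/4*(5*t^4) - 1259/4*(6*t^5) - 3/2*(7*t^6) + 59/8*(8*t^7) + 29/4*(9*t^8) - 15/4*(10*t^9) + 1/2*(11*t^10)) t := by
    intro t
    have p : ∀ (c : ℝ) (n : ℕ), HasDerivAt (fun t : ℝ => c * t^n) (c * (n * t^(n-1))) t := fun c n => (hasDerivAt_pow n t).const_mul c
    have := (((((((((((p (103983/8) 1).const_add (-103983/16)).sub (p (103983/8) 2)).add (p (34661/4) 3)).sub (p (34149/8) 4)).add (p (6113/4) 5)).sub (p (1259/4) 6)).sub (p (3/2) 7)).add (p (59/8) 8)).add (p (29/4) 9)).sub (p (15/4) 10)).add (p (1/2) 11)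
    refine (this.congr_deriv ?_).congr_of_eventuallyEq (Eventually.of_forall fun t => ?_)
    · push_cast; norm_num
    · simp [Q]
  have h := int_aux (fun u => phid u ^2) (fun t => Q t * rx (2*t-1)) (fun t => t^3*(2-t)^4*(4-3*t-t^2)^2*rx (2*t-1)) phid2_int
    (fun u hu => by rw [phid, if_neg hu]; simp)
    (fun t => by
      have he : HasDerivAt (fun t : ℝ => rx (2*t-1)) (rx (2*t-1) * 2) t := by
        simpa using (((hasDerivAt_id t).const_mul 2).sub_const 1).exp
      refine ((hQ t).mul he).congr_deriv ?_
      simp only [Q]; ring)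
    (fun u hu => by
      rw [phid, if_pos hu, mul_pow, show 2 * rx u - 1 = ((2:ℕ):ℝ) * (rx u - 1/2) by push_cast; ring, Real.exp_nat_mul]
      ring)
  rw [h]
  simp only [Q]
  have := e_bounds
  norm_num
  linarith
end hfacts

section hfacts2
open Filter Topology
open scoped FourierTransform

noncomputable def phiC (u : ℝ) : ℂ := (phi u : ℂ)
noncomputable def Pr (r : ℝ) : ℂ := (1/(2*pp) : ℝ) * 𝓕 phiC (r/(2*pp))

theorem phiC_int : Integrable phiC := phi_int.ofReal

theorem fou_eq (f : ℝ → ℂ) (r : ℝ) : 𝓕 f (r/(2*pp)) = ∫ u : ℝ, Complex.exp (-(r*u*Complex.I)) * f u := by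
  rw [Real.fourier_real_eq_integral_exp_smul]
  congr 1; ext u
  rw [smul_eq_mul]; congr 2
  push_cast; field_simp [Real.pi_ne_zero]

theorem Pr_cont : Continuous Pr := by
  unfold Pr
  have : Continuous (𝓕 phiC) := VectorFourier.fourierIntegral_continuous Real.continuous_fourierChar (by fun_prop) phiC_int
  fun_prop

theorem scale_int (g : ℝ → ℝ) (hg : Integrable g) : Integrable (fun r => g (r/(2*pp))) ∧
    ∫ r, g (r/(2*pp)) = 2*pp * ∫ w, g w := by
  refine ⟨hg.comp_div (by positivity), ?_⟩
  rw [Measure.integral_comp_div, abs_of_pos (by positivity), smul_eq_mul]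

theorem Pr_sq : Integrable (fun r => ‖Pr r‖^2) ∧ ∫ r, ‖Pr r‖^2 = (1/(2*pp)) * ∫ u, phi u^2 := by
  have h := plancherel phiC phiC_int (by simpa [phiC] using phi2_int)
  have h2 := scale_int _ h.1
  have e : (fun r => ‖Pr r‖^2) = fun r => (1/(2*pp))^2 * ‖𝓕 phiC (r/(2*pp))‖^2 := by
    ext r; rw [Pr, norm_mul, mul_pow, Complex.norm_real, Real.norm_eq_abs, sq_abs]
  rw [e]
  refine ⟨h2.1.const_mul _, ?_⟩
  rw [integral_const_mul, h2.2, h.2]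
  simp only [phiC, Complex.norm_real, Real.norm_eq_abs, sq_abs]
  field_simp

theorem Pr_sq' : Integrable (fun r => r^2*‖Pr r‖^2) ∧ ∫ r, r^2*‖Pr r‖^2 = (1/(2*pp)) * ∫ u, phid u^2 := by
  have hd : deriv phiC = fun u => (phid u : ℂ) := funext fun u => (phi_deriv u).ofReal_comp.deriv
  have hf := Real.fourier_deriv (f := phiC) phiC_int (fun u => (phi_deriv u).ofReal_comp.differentiableAt)
    (by rw [hd]; exact phid_int.ofReal)
  have h := plancherel (deriv phiC) (by rw [hd]; exact phid_int.ofReal) (by rw [hd]; simpa using phid2_int)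
  have h2 := scale_int _ h.1
  have e : (fun r => r^2*‖Pr r‖^2) = fun r => (1/(2*pp))^2 * ‖𝓕 (deriv phiC) (r/(2*pp))‖^2 := by
    ext r
    rw [hf]
    simp only [Pr, norm_mul, mul_pow, Complex.norm_real, Real.norm_eq_abs, sq_abs, norm_smul, Complex.norm_I]
    have : (2*pp)^2 ≠ 0 := by positivity
    simp only [Complex.norm_ofNat, div_pow]
    field_simp
  rw [e]
  refine ⟨h2.1.const_mul _, ?_⟩
  rw [integral_const_mul, h2.2, h.2, hd]
  simp only [Complex.norm_real, Real.norm_eq_abs, sq_abs]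
  field_simp

theorem pi_b : 3.141592 < pp ∧ pp < 3.141593 := ⟨by linarith [Real.pi_gt_d6], by linarith [Real.pi_lt_d6]⟩

theorem inv3_int : Integrable (fun r : ℝ => 1/(3+r^2)) ∧ ∫ r : ℝ, 1/(3+r^2) ≤ 1.8139 := by
  have s3 : Real.sqrt 3 ^ 2 = 3 := Real.sq_sqrt (by norm_num)
  have hs : 0 < Real.sqrt 3 := by positivity
  have e : (fun r : ℝ => 1/(3+r^2)) = fun r => (1/3) * (1 + (r/Real.sqrt 3)^2)⁻¹ := by
    ext r; rw [div_pow, s3]; field_simp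
  rw [e]
  refine ⟨(integrable_inv_one_add_sq.comp_div hs.ne').const_mul _, ?_⟩
  rw [integral_const_mul, Measure.integral_comp_div (fun x => (1+x^2)⁻¹), integral_univ_inv_one_add_sq, abs_of_pos hs, smul_eq_mul]
  have : Real.sqrt 3 ≤ 1.73206 := by rw [Real.sqrt_le_left (by norm_num)]; norm_num
  nlinarith [pi_b.1, pi_b.2]

theorem Pr_int : Integrable Pr ∧ ∫ r, ‖Pr r‖ ≤ 2 := by
  have hb : ∀ r, ‖Pr r‖ ≤ (0.456*3) * ‖Pr r‖^2 + 0.456 * (r^2 * ‖Pr r‖^2) + (1/1.824) * (1/(3+r^2)) := by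
    intro r
    set a := ‖Pr r‖
    have hp : 0 < 3 + r^2 := by positivity
    have := sq_nonneg (0.912 * (3+r^2) * a - 1)
    have e : (0.456*3) * a^2 + 0.456 * (r^2 * a^2) + (1/1.824) * (1/(3+r^2)) - a = (0.912 * (3+r^2) * a - 1)^2 / (1.824*(3+r^2)) := by
      field_simp; ring
    have : 0 ≤ (0.912 * (3+r^2) * a - 1)^2 / (1.824*(3+r^2)) := by positivity
    linarith
  have hi : Integrable (fun r => (0.456*3) * ‖Pr r‖^2 + 0.456 * (r^2 * ‖Pr r‖^2) + (1/1.824) * (1/(3+r^2))) :=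
    ((Pr_sq.1.const_mul _).add (Pr_sq'.1.const_mul _)).add (inv3_int.1.const_mul _)
  have hP : Integrable Pr := hi.mono' Pr_cont.aestronglyMeasurable (ae_of_all _ hb)
  refine ⟨hP, (integral_mono hP.norm hi hb).trans ?_⟩
  have A : Integrable (fun r => (0.456*3) * ‖Pr r‖^2 + 0.456 * (r^2 * ‖Pr r‖^2)) := (Pr_sq.1.const_mul _).add (Pr_sq'.1.const_mul _)
  rw [integral_add A (inv3_int.1.const_mul _),
    integral_add (Pr_sq.1.const_mul _) (Pr_sq'.1.const_mul _), integral_const_mul, integral_const_mul, integral_const_mul,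
    Pr_sq.2, Pr_sq'.2]
  have p1 : 1/(2*pp) ≤ 0.15916 := by rw [div_le_iff₀ (by positivity)]; nlinarith [pi_b.1]
  have h1 : 1/(2*pp) * ∫ u, phi u^2 ≤ 0.15916 * 2.2575 := by gcongr; exact phi2_val
  have h2 : 1/(2*pp) * ∫ u, phid u^2 ≤ 0.15916 * 6.924 := by gcongr; exact phid2_val
  have h3 := inv3_int.2
  norm_num at *; linarith

theorem Pr_tail {R : ℝ} (hR : 25 ≤ R) : ∫ r in Ioi R, ‖Pr r‖ ≤ 0.211 ∧ ∫ r in Iic (-R), ‖Pr r‖ ≤ 0.211 := by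
  have hb : ∀ r, 25 ≤ |r| → ‖Pr r‖ ≤ (0.095) * (r^2*‖Pr r‖^2) + (1/0.38) * (r^2)⁻¹ := by
    intro r hr
    set a := ‖Pr r‖
    have hp : 0 < r^2 := by have : r ≠ 0 := by rintro rfl; norm_num at hr
                            positivity
    have e : 0.095 * (r^2 * a^2) + (1/0.38) * (r^2)⁻¹ - a = (0.19 * r^2 * a - 1)^2 / (0.38*r^2) := by
      have h1 : r^2 * (r^2)⁻¹ = 1 := mul_inv_cancel₀ hp.ne'
      rw [eq_div_iff (by positivity)]
      linear_combination h1
    have : 0 ≤ (0.19 * r^2 * a - 1)^2 / (0.38*r^2) := by positivity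
    linarith
  have p1 : 1/(2*pp) ≤ 0.15916 := by rw [div_le_iff₀ (by positivity)]; nlinarith [pi_b.1]
  have h2 : 1/(2*pp) * ∫ u, phid u^2 ≤ 0.15916 * 6.924 := by gcongr; exact phid2_val
  have hI : IntegrableOn (fun r : ℝ => (r^2)⁻¹) (Ioi R) := by
    have := integrableOn_Ioi_rpow_of_lt (a := -2) (c := R) (by norm_num) (by linarith)
    refine this.congr_fun (fun r hr => ?_) measurableSet_Ioi
    have : 0 < r := by linarith [mem_Ioi.1 hr]
    simp only []; rw [Real.rpow_neg this.le]; norm_num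
  have hv : ∫ r in Ioi R, (r^2)⁻¹ ≤ 0.04 := by
    have := integral_Ioi_rpow_of_lt (a := -2) (c := R) (by norm_num) (by linarith)
    rw [setIntegral_congr_fun (g := fun r : ℝ => (r^2)⁻¹) measurableSet_Ioi (fun r hr => by
      have : 0 < r := by linarith [mem_Ioi.1 hr]
      simp only []; rw [Real.rpow_neg this.le]; norm_num)] at this
    rw [this]
    norm_num
    rw [Real.rpow_neg (by linarith), Real.rpow_one, inv_le_comm₀ (by linarith) (by norm_num)]; norm_num; linarith
  have key : ∀ S : Set ℝ, MeasurableSet S → (∀ r ∈ S, 25 ≤ |r|) → IntegrableOn (fun r : ℝ => (r^2)⁻¹) S → ∫ r in S, (r^2)⁻¹ ≤ 0.04 →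
      ∫ r in S, ‖Pr r‖ ≤ 0.211 := by
    intro S hS h25 hi hv
    refine (setIntegral_mono_on Pr_int.1.norm.integrableOn ((Pr_sq'.1.integrableOn.const_mul _).add (hi.const_mul _)) hS (fun r hr => hb r (h25 r hr))).trans ?_
    show ∫ r in S, ((0.095) * (r^2*‖Pr r‖^2) + (1/0.38) * (r^2)⁻¹) ≤ _
    rw [integral_add (Pr_sq'.1.integrableOn.const_mul _) (hi.const_mul _), integral_const_mul, integral_const_mul]
    have h3 : ∫ r in S, r^2*‖Pr r‖^2 ≤ ∫ r, r^2*‖Pr r‖^2 := setIntegral_le_integral Pr_sq'.1 (ae_of_all _ fun r => by positivity)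
    rw [Pr_sq'.2] at h3
    norm_num at *; linarith
  refine ⟨key _ measurableSet_Ioi (fun r hr => ?_) hI hv, key _ measurableSet_Iic (fun r hr => ?_) ?_ ?_⟩
  · rw [abs_of_pos] <;> linarith [mem_Ioi.1 hr]
  · have := mem_Iic.1 hr
    rw [abs_of_neg] <;> linarith
  · have := (integrableOn_Ici_iff_integrableOn_Ioi (f := fun r : ℝ => (r^2)⁻¹) (μ := volume) (b := R)).2 hI
    have h := this.comp_neg
    simp only [neg_sq] at h
    rw [show Iic (-R) = -Ici R by ext y; simp]; exact h
  · have h := integral_comp_neg_Ioi R (fun r : ℝ => (r^2)⁻¹)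
    simp only [neg_sq] at h
    rw [← h]; exact hv
end hfacts2

section hfacts3
open Filter Topology
open scoped FourierTransform

noncomputable def PH (H r : ℝ) : ℂ := (Icc (-H) H).indicator Pr r

theorem PH_le (H r : ℝ) : ‖PH H r‖ ≤ ‖Pr r‖ := norm_indicator_le_norm_self _ _
theorem PH_int (H : ℝ) : Integrable (PH H) := Pr_int.1.indicator measurableSet_Icc
theorem PH_norm (H : ℝ) : ∫ r, ‖PH H r‖ ≤ 2 :=
  (integral_mono (PH_int H).norm Pr_int.1.norm (PH_le H)).trans Pr_int.2
theorem PH_zero {H r : ℝ} (h : ¬ |r| ≤ H) : PH H r = 0 := by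
  rw [PH, indicator_of_notMem]; rwa [mem_Icc, ← abs_le]

theorem nexp (a : ℝ) : ‖Complex.exp (a * Complex.I)‖ = 1 := Complex.norm_exp_ofReal_mul_I a

theorem sinc_int {H v : ℝ} (hv : v ≠ 0) : ((sn (H * v) / (pp * v) : ℝ) : ℂ) =
    (1/(2*pp) : ℝ) * ∫ r in (-H)..H, Complex.exp (r * v * Complex.I) := by
  have h := integral_exp_mul_complex (a := -H) (b := H) (c := v * Complex.I) (by simp [hv])
  have e : ∀ r : ℝ, Complex.exp (r * v * Complex.I) = Complex.exp (v * Complex.I * r) := fun r => by congr 1; ring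
  simp_rw [e]
  rw [h]
  have h2 : Complex.exp (v * Complex.I * (H:ℝ)) - Complex.exp (v * Complex.I * ((-H : ℝ):ℂ)) = 2 * Complex.I * sn (H*v) := by
    rw [show (v:ℂ) * Complex.I * (H:ℝ) = ((H*v:ℝ):ℂ) * Complex.I by push_cast; ring,
      show (v:ℂ) * Complex.I * ((-H:ℝ):ℂ) = -((H*v:ℝ):ℂ) * Complex.I by push_cast; ring, Complex.ofReal_sin, Complex.sin]
    linear_combination (Complex.exp (((H*v:ℝ):ℂ) * Complex.I) - Complex.exp (-((H*v:ℝ):ℂ) * Complex.I)) * Complex.I_mul_I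
  rw [h2]
  have hv' : (v:ℂ) ≠ 0 := by exact_mod_cast hv
  have hp : (pp:ℂ) ≠ 0 := by exact_mod_cast Real.pi_ne_zero
  push_cast
  field_simp [Complex.I_ne_zero]

theorem hH_rep {H : ℝ} (hH0 : 0 < H) (L : ℝ) :
    (hH H (rx L) : ℂ) = ∫ r, PH H r * Complex.exp (r * L * Complex.I) := by
  have e1 : hH H (rx L) = ∫ v, phi (L - v) * (sn (H * v) / (pp * v)) := by
    rw [hH, integral_exp_sub]
    congr 1; ext v
    rw [phi, Real.exp_sub, FH, Real.log_exp, smul_eq_mul]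
    field_simp
  rw [e1, ← integral_complex_ofReal]
  have e2 : ∫ v, ((phi (L - v) * (sn (H * v) / (pp * v)) : ℝ) : ℂ) =
      ∫ v : ℝ, ∫ r in Ioc (-H) H, (1/(2*pp) : ℝ) * (phiC (L-v) * Complex.exp (r * v * Complex.I)) := by
    apply integral_congr_ae
    have : ∀ᵐ v : ℝ, v ≠ 0 := by simp [ae_iff, measure_singleton]
    filter_upwards [this] with v hv
    rw [integral_const_mul, integral_const_mul, Complex.ofReal_mul, sinc_int hv, intervalIntegral.integral_of_le (by linarith)]
    simp only [phiC]; ring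
  rw [e2, integral_integral_swap]
  · have : (fun r => PH H r * Complex.exp (r * L * Complex.I)) = (Icc (-H) H).indicator (fun r => Pr r * Complex.exp (r * L * Complex.I)) := by
      ext r; simp only [PH, indicator]; split_ifs <;> simp
    rw [this, integral_indicator measurableSet_Icc, ← integral_Icc_eq_integral_Ioc]
    apply setIntegral_congr_fun measurableSet_Icc
    intro r _
    simp only []
    rw [integral_const_mul, Pr, fou_eq, mul_assoc]
    congr 1
    rw [← integral_sub_left_eq_self (fun v : ℝ => phiC (L - v) * Complex.exp (r*v*Complex.I)) _ L, ← integral_mul_const]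
    congr 1; ext v
    rw [sub_sub_cancel, mul_right_comm _ (phiC v), ← Complex.exp_add, mul_comm]
    congr 2; push_cast; ring
  · have hc : Integrable (fun v => phiC (L - v)) := phiC_int.comp_sub_left L
    have hone : Integrable (fun r : ℝ => (1/(2*pp) : ℂ)) (volume.restrict (Ioc (-H) H)) := by
      exact integrable_const _
    have := hc.mul_prod hone
    refine (this.mul_bdd (c := 1) (g := fun p : ℝ × ℝ => Complex.exp (p.2 * p.1 * Complex.I)) (Continuous.aestronglyMeasurable (by fun_prop)) (ae_of_all _ fun p => ?_)).congr (ae_of_all _ fun p => ?_)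
    · rw [← Complex.ofReal_mul, nexp]
    · simp only [Function.uncurry]; push_cast; ring

theorem hH_bd {H : ℝ} (hH0 : 0 < H) (L : ℝ) : |hH H (rx L)| ≤ 2 := by
  have := hH_rep hH0 L
  rw [← Real.norm_eq_abs, ← Complex.norm_real, this]
  refine (norm_integral_le_integral_norm _).trans (le_trans (le_of_eq ?_) (PH_norm H))
  congr 1; ext r; rw [norm_mul, ← Complex.ofReal_mul, nexp, mul_one]

theorem PHexp_int (H L : ℝ) : Integrable (fun r : ℝ => PH H r * Complex.exp (r * L * Complex.I)) :=
  (PH_int H).mul_bdd (c := 1) (Continuous.aestronglyMeasurable (by fun_prop)) (ae_of_all _ fun r => by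
    rw [← Complex.ofReal_mul, nexp])

theorem exp_lip (a b : ℝ) : ‖Complex.exp (a * Complex.I) - Complex.exp (b * Complex.I)‖ ≤ |a - b| := by
  have : Complex.exp (a * Complex.I) - Complex.exp (b * Complex.I) = Complex.exp (b * Complex.I) * (Complex.exp (Complex.I * ((a - b : ℝ))) - 1) := by
    rw [mul_sub, ← Complex.exp_add]; congr 2
    · push_cast; ring
    · ring
  rw [this, norm_mul, nexp, one_mul]
  exact Real.norm_exp_I_mul_ofReal_sub_one_le

theorem hH_lip {H : ℝ} (hH0 : 0 < H) (L M : ℝ) : |hH H (rx L) - hH H (rx M)| ≤ 2 * H * |L - M| := by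
  rw [← Real.norm_eq_abs, ← Complex.norm_real, Complex.ofReal_sub, hH_rep hH0 L, hH_rep hH0 M, ← integral_sub (PHexp_int H L) (PHexp_int H M)]
  have hb : ∀ r, ‖PH H r * Complex.exp (r * L * Complex.I) - PH H r * Complex.exp (r * M * Complex.I)‖ ≤ ‖PH H r‖ * (H * |L - M|) := by
    intro r
    by_cases h : |r| ≤ H
    · rw [← mul_sub, norm_mul]
      gcongr
      have := exp_lip (r*L) (r*M)
      push_cast at this
      refine this.trans ?_
      rw [← mul_sub, abs_mul]; gcongr
    · simp [PH_zero h]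
  refine (norm_integral_le_of_norm_le ((PH_int H).norm.mul_const _) (ae_of_all _ hb)).trans ?_
  rw [integral_mul_const]
  nlinarith [PH_norm H, mul_nonneg hH0.le (abs_nonneg (L-M))]

theorem hHexp_cont {H : ℝ} (hH0 : 0 < H) : Continuous (fun L => hH H (rx L)) := by
  refine (LipschitzWith.of_dist_le_mul (K := ⟨2*H, by positivity⟩) fun L M => ?_).continuous
  rw [Real.dist_eq, Real.dist_eq]; exact hH_lip hH0 L M

theorem hH_l2 {H : ℝ} (hH0 : 0 < H) : Integrable (fun L => hH H (rx L)^2) ∧ ∫ L, hH H (rx L)^2 ≤ 2.2575 := by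
  have hsq : Integrable (fun r => ‖PH H r‖^2) := by
    refine Pr_sq.1.mono' ((PH_int H).norm.aestronglyMeasurable.pow 2) (ae_of_all _ fun r => ?_)
    rw [Real.norm_eq_abs, abs_of_nonneg (by positivity)]
    gcongr; exact PH_le H r
  have h := plancherel (PH H) (PH_int H) hsq
  have h2 := scale_int _ h.1
  have e : ∀ L, hH H (rx L)^2 = ‖𝓕 (PH H) (-L/(2*pp))‖^2 := by
    intro L
    have := hH_rep hH0 L
    rw [fou_eq, ← sq_abs, ← Real.norm_eq_abs, ← Complex.norm_real, this]
    congr 3; ext r; rw [mul_comm]; congr 2; push_cast; ring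
  have e' : (fun L => hH H (rx L)^2) = fun L => (fun r => ‖𝓕 (PH H) (r/(2*pp))‖^2) (-L) := funext e
  rw [e']
  refine ⟨h2.1.comp_neg, ?_⟩
  rw [integral_neg_eq_self (fun r => ‖𝓕 (PH H) (r/(2*pp))‖^2), h2.2, h.2]
  have h3 : ∫ r, ‖PH H r‖^2 ≤ ∫ r, ‖Pr r‖^2 := integral_mono hsq Pr_sq.1 fun r => by
    have := PH_le H r
    simp only []; gcongr
  rw [Pr_sq.2] at h3
  calc 2*pp * ∫ r, ‖PH H r‖^2 ≤ 2*pp * (1/(2*pp) * ∫ u, phi u^2) := by gcongr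
    _ = ∫ u, phi u^2 := by field_simp
    _ ≤ _ := phi2_val

end hfacts3

section rotation
open Filter Topology Complex

theorem expabs_int {a : ℝ} (ha : 0 < a) : Integrable (fun u : ℝ => rx (-a * |u|)) := by
  rw [← integrableOn_univ, ← Iic_union_Ioi (a := (0:ℝ))]
  refine IntegrableOn.union ?_ ?_
  · refine (integrableOn_exp_mul_Iic ha 0).congr_fun (fun u hu => ?_) measurableSet_Iic
    simp only []; rw [abs_of_nonpos (mem_Iic.1 hu)]; congr 1; ring
  · refine (integrableOn_exp_mul_Ioi (a := -a) (by linarith) 0).congr_fun (fun u hu => ?_) measurableSet_Ioi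
    simp only []; rw [abs_of_pos (mem_Ioi.1 hu)]

theorem M_bd {c b σ : ℝ} (hc : 0 < c) (hσ : 0 < σ) : ∃ K, ∀ u : ℝ,
    σ * u - c * rx (2*u) / 2 + b * rx u ≤ K + -(min σ 1) * |u| := by
  refine ⟨b^2/c + (σ+1)^2/(2*c), fun u => ?_⟩
  have e2 : rx (2*u) = rx u ^2 := by rw [← Real.exp_nat_mul]; norm_num
  set E := rx u with hE
  have h1 : b * E ≤ c * E^2/4 + b^2/c := by
    have : c * E^2/4 + b^2/c - b*E = (c*E/2 - b)^2/c := by field_simp; ring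
    have h2 : 0 ≤ (c*E/2 - b)^2/c := by positivity
    linarith
  have h5 : 0 ≤ (σ+1)^2/(2*c) := by positivity
  rcases le_total u 0 with hu | hu
  · rw [abs_of_nonpos hu, e2]
    have : min σ 1 ≤ σ := min_le_left _ _
    nlinarith [sq_nonneg E]
  · rw [abs_of_nonneg hu, e2]
    have h3 : 2*u^2 ≤ E^2 := by
      have := Real.quadratic_le_exp_of_nonneg (show 0 ≤ 2*u by linarith)
      rw [← e2]; nlinarith
    have h4 : (σ+1)*u - c*u^2/2 ≤ (σ+1)^2/(2*c) := by
      have : (σ+1)^2/(2*c) - ((σ+1)*u - c*u^2/2) = (c*u - (σ+1))^2/(2*c) := by field_simp; ring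
      have h2 : 0 ≤ (c*u - (σ+1))^2/(2*c) := by positivity
      linarith
    have : min σ 1 ≤ 1 := min_le_right _ _
    nlinarith

noncomputable def BBi (l σ θ u : ℝ) : ℝ := rx (σ * u - cs (2*θ) * rx (2*u) / 2 + (-(l * sn θ)) * rx u)
noncomputable def BB (l σ θ : ℝ) : ℝ := ∫ u, BBi l σ θ u

theorem cos_pos4 {θ : ℝ} (h : |θ| < pp/4) : 0 < cs (2*θ) := by
  apply Real.cos_pos_of_mem_Ioo; rw [abs_lt] at h; constructor <;> linarith

theorem BBi_cont (l σ θ : ℝ) : Continuous (BBi l σ θ) := by unfold BBi; fun_prop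

theorem BB_int {l σ θ : ℝ} (hσ : 0 < σ) (h : |θ| < pp/4) : Integrable (BBi l σ θ) := by
  obtain ⟨K, hK⟩ := M_bd (b := -(l * sn θ)) (cos_pos4 h) hσ
  refine ((expabs_int (lt_min hσ one_pos)).const_mul (rx K)).mono' (BBi_cont l σ θ).aestronglyMeasurable (ae_of_all _ fun u => ?_)
  rw [BBi, Real.norm_eq_abs, Real.abs_exp, ← Real.exp_add]
  exact Real.exp_le_exp.2 (hK u)

noncomputable def Psi (l : ℝ) (s w : ℂ) : ℂ := cexp (s * w - cexp (2*w)/2 + I * l * cexp w)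

theorem Psi_norm (l : ℝ) (s : ℂ) (u v : ℝ) : ‖Psi l s (u + v * I)‖ = rx (- (v * s.im)) * BBi l s.re v u := by
  rw [Psi, BBi, norm_exp, ← Real.exp_add]
  congr 1
  have e1 : cexp (2*(u + v * I)) = rx (2*u) * (cs (2*v) + sn (2*v) * I) := by
    rw [mul_add, Complex.exp_add, show (2:ℂ) * (v * I) = ((2*v:ℝ):ℂ) * I by push_cast; ring, exp_mul_I]
    push_cast; ring
  have e2 : cexp (u + v * I) = rx u * (cs v + sn v * I) := by
    rw [Complex.exp_add, exp_mul_I]; push_cast; ring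
  rw [e1, e2]
  simp only [add_re, sub_re, mul_re, mul_im, add_im, ofReal_re, ofReal_im, I_re, I_im, div_ofNat_re]
  ring

theorem Psi_diff (l : ℝ) (s : ℂ) : Differentiable ℂ (Psi l s) := by unfold Psi; fun_prop

theorem Psi_int {l θ : ℝ} {s : ℂ} (hs : 0 < s.re) (h : |θ| < pp/4) : Integrable (fun u : ℝ => Psi l s (u + θ * I)) := by
  refine ((BB_int (l := l) hs h).const_mul (rx (-(θ * s.im)))).mono' ?_ (ae_of_all _ fun u => (Psi_norm l s u θ).le)
  exact ((Psi_diff l s).continuous.comp (by fun_prop)).aestronglyMeasurable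

noncomputable def FF (l : ℝ) (s : ℂ) : ℂ := ∫ u : ℝ, Psi l s u

theorem rot {l θ : ℝ} {s : ℂ} (hs : 0 < s.re) (h : |θ| < pp/4) : FF l s = ∫ u : ℝ, Psi l s (u + θ * I) := by
  have hrect : ∀ T : ℝ, (∫ x in (-T)..T, Psi l s x) - (∫ x in (-T)..T, Psi l s (x + θ * I)) =
      - (I • (∫ y in (0:ℝ)..θ, Psi l s (T + y * I))) + I • (∫ y in (0:ℝ)..θ, Psi l s ((-T:ℝ) + y * I)) := by
    intro T
    have := integral_boundary_rect_eq_zero_of_differentiableOn (Psi l s) ((-T:ℝ):ℂ) (T + θ * I) (Psi_diff l s).differentiableOn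
    simp only [add_re, add_im, ofReal_re, ofReal_im, mul_re, mul_im, I_re, I_im, mul_zero, mul_one, sub_zero, add_zero, zero_add, ofReal_zero, zero_mul] at this
    linear_combination this
  obtain ⟨K, hK⟩ := M_bd (b := |l|) (cos_pos4 h) hs
  have hv : ∀ T : ℝ, ‖∫ y in (0:ℝ)..θ, Psi l s (T + y * I)‖ ≤ (rx (|θ| * |s.im|) * rx (K + -(min s.re 1) * |T|)) * |θ - 0| := by
    intro T
    refine intervalIntegral.norm_integral_le_of_norm_le_const fun y hy => ?_
    have hy' : |y| ≤ |θ| := by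
      have hy2 : y ∈ uIcc 0 θ := uIoc_subset_uIcc hy
      have := abs_sub_left_of_mem_uIcc hy2
      simpa using this
    rw [Psi_norm, BBi]
    refine mul_le_mul (Real.exp_le_exp.2 ?_) (Real.exp_le_exp.2 ?_) (Real.exp_pos _).le (Real.exp_pos _).le
    · exact (neg_le_abs _).trans (by rw [abs_mul]; gcongr)
    · refine le_trans ?_ (hK T)
      have hc : cs (2*θ) ≤ cs (2*y) := by
        rw [← Real.cos_abs (2*θ), ← Real.cos_abs (2*y), abs_mul, abs_mul, abs_two]
        apply Real.cos_le_cos_of_nonneg_of_le_pi (by positivity) _ (by linarith)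
        have := Real.pi_pos; linarith
      have hsn : -(l * sn y) ≤ |l| := by
        refine (neg_le_abs _).trans ?_
        rw [abs_mul]; exact mul_le_of_le_one_right (abs_nonneg _) (Real.abs_sin_le_one _)
      have := Real.exp_pos (2*T)
      have := Real.exp_pos T
      nlinarith
  have lim0 : ∀ (f : ℝ → ℝ), (∀ T, |f T| = |T|) → Tendsto (fun T => I • ∫ y in (0:ℝ)..θ, Psi l s (f T + y * I)) atTop (𝓝 0) := by
    intro f hf
    suffices hh : Tendsto (fun T => ∫ y in (0:ℝ)..θ, Psi l s (f T + y * I)) atTop (𝓝 0) by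
      simpa using hh.const_smul I
    refine squeeze_zero_norm (fun T => hv (f T)) ?_
    simp_rw [hf, Real.exp_add]
    have h1 : Tendsto (fun T : ℝ => rx (-(min s.re 1) * |T|)) atTop (𝓝 0) := by
      refine Real.tendsto_exp_atBot.comp ?_
      exact tendsto_abs_atTop_atTop.const_mul_atTop_of_neg (by have := lt_min hs one_pos; linarith)
    have := ((h1.const_mul (rx K)).const_mul (rx (|θ| * |s.im|))).mul_const (|θ - 0|)
    simpa using this
  have l1 := (lim0 id (fun T => rfl)).neg.add (lim0 (fun T => -T) (fun T => abs_neg T))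
  have i0 : Integrable (fun u : ℝ => Psi l s u) := by simpa using Psi_int (l := l) (θ := 0) hs (by simp; positivity)
  have l2 := (intervalIntegral_tendsto_integral i0 tendsto_neg_atTop_atBot tendsto_id).sub
    (intervalIntegral_tendsto_integral (Psi_int (l := l) hs h) tendsto_neg_atTop_atBot tendsto_id)
  have l3 := tendsto_nhds_unique l2 (l1.congr fun T => (hrect T).symm)
  rw [neg_zero, add_zero] at l3
  exact sub_eq_zero.1 l3

theorem FF_bd {l θ : ℝ} {s : ℂ} (hs : 0 < s.re) (h : |θ| < pp/4) :
    ‖FF l s‖ ≤ rx (-(θ * s.im)) * BB l s.re θ := by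
  rw [rot hs h, BB, ← integral_const_mul]
  exact norm_integral_le_of_norm_le ((BB_int (l := l) hs h).const_mul _) (ae_of_all _ fun u => (Psi_norm l s u θ).le)

end rotation

section EF
open Filter Topology Complex
open scoped FourierTransform

noncomputable def KK (ψ : ℝ → ℂ) (s : ℂ) : ℂ := ∫ u : ℝ, ψ u * cexp (s * u)
noncomputable def ln (τ : ℝ) : ℂ := 3/2 + τ * I
noncomputable def JJ (ψ : ℝ → ℂ) (Φ : ℂ → ℂ) : ℂ := (1/(2*pp) : ℝ) * ∫ τ : ℝ, Φ (ln τ) * KK ψ (ln τ)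

theorem ln_re (τ : ℝ) : (ln τ).re = 3/2 := by simp [ln]
theorem ln_im (τ : ℝ) : (ln τ).im = τ := by simp [ln]
theorem ln_cont : Continuous ln := by unfold ln; fun_prop

structure NiceR (ψ : ℝ → ℂ) : Prop where
  cont : Continuous ψ
  int : Integrable (fun u : ℝ => ψ u * cexp ((3/2) * u))
  dec : ∃ C : ℝ, 0 ≤ C ∧ ∀ τ : ℝ, ‖KK ψ (ln τ)‖ ≤ C * rx (-(1/2) * |τ|)

variable {ψ : ℝ → ℂ}

theorem KK_fou (ψ : ℝ → ℂ) (τ : ℝ) : KK ψ (ln τ) = 𝓕 (fun u : ℝ => ψ u * cexp ((3/2) * u)) ((-τ)/(2*pp)) := by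
  rw [fou_eq, KK]; congr 1; ext u
  rw [mul_comm (cexp _), mul_assoc, ← Complex.exp_add]; congr 2; simp [ln]; ring

theorem KK_cont (h : NiceR ψ) : Continuous (fun τ => KK ψ (ln τ)) := by
  simp_rw [KK_fou]
  have : Continuous (𝓕 (fun u : ℝ => ψ u * cexp ((3/2) * u))) := VectorFourier.fourierIntegral_continuous Real.continuous_fourierChar (by fun_prop) h.int
  exact this.comp (by fun_prop)

theorem poly_exp (τ : ℝ) : (1+|τ|)^2 * rx (-(1/2) * |τ|) ≤ 64 * rx (-(1/4)*|τ|) := by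
  have h1 := Real.add_one_le_exp (|τ|/8)
  have h2 : rx (-(1/2) * |τ|) = rx (-(1/4)*|τ|) * (rx (-(|τ|/8)))^2 := by
    rw [← Real.exp_nat_mul, ← Real.exp_add]; congr 1; push_cast; ring
  have h3 : (1+|τ|) * rx (-(|τ|/8)) ≤ 8 := by
    rw [Real.exp_neg, ← div_eq_mul_inv, div_le_iff₀ (Real.exp_pos _)]; linarith [abs_nonneg τ]
  rw [h2]
  calc (1+|τ|)^2 * (rx (-(1/4)*|τ|) * (rx (-(|τ|/8)))^2) = ((1+|τ|) * rx (-(|τ|/8)))^2 * rx (-(1/4)*|τ|) := by ring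
    _ ≤ 8^2 * rx (-(1/4)*|τ|) := by gcongr
    _ = _ := by norm_num

theorem wK (h : NiceR ψ) : ∃ C : ℝ, 0 ≤ C ∧ ∀ τ, (1+|τ|)^2 * ‖KK ψ (ln τ)‖ ≤ C * rx (-(1/4)*|τ|) := by
  obtain ⟨C, h0, hC⟩ := h.dec
  refine ⟨C * 64, by positivity, fun τ => ?_⟩
  calc (1+|τ|)^2 * ‖KK ψ (ln τ)‖ ≤ (1+|τ|)^2 * (C * rx (-(1/2) * |τ|)) := by gcongr; exact hC τ
    _ = C * ((1+|τ|)^2 * rx (-(1/2) * |τ|)) := by ring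
    _ ≤ C * (64 * rx (-(1/4)*|τ|)) := mll (poly_exp τ) h0
    _ = _ := by ring

theorem wK_int (h : NiceR ψ) : Integrable (fun τ => (1+|τ|)^2 * ‖KK ψ (ln τ)‖) := by
  obtain ⟨C, h0, hC⟩ := wK h
  refine ((expabs_int (a := 1/4) (by norm_num)).const_mul C).mono' ?_ (ae_of_all _ fun τ => ?_)
  · exact (Continuous.mul (by fun_prop) (KK_cont h).norm).aestronglyMeasurable
  · rw [Real.norm_of_nonneg (by positivity)]; exact hC τ

theorem one_le_w (τ : ℝ) : 1 ≤ (1+|τ|)^2 := by nlinarith [abs_nonneg τ]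

theorem JJ_int (h : NiceR ψ) {Φ : ℂ → ℂ} {a : ℝ} (hc : Continuous (fun τ => Φ (ln τ))) (hb : ∀ τ, ‖Φ (ln τ)‖ ≤ a * (1+|τ|)^2) :
    Integrable (fun τ => Φ (ln τ) * KK ψ (ln τ)) := by
  refine ((wK_int h).const_mul a).mono' (hc.mul (KK_cont h)).aestronglyMeasurable (ae_of_all _ fun τ => ?_)
  rw [norm_mul, ← mul_assoc]; gcongr; exact hb τ

theorem K_int (h : NiceR ψ) : Integrable (fun τ => KK ψ (ln τ)) := by
  simpa using JJ_int h (Φ := fun _ => 1) (a := 1) (by fun_prop) (fun τ => by simpa using one_le_w τ)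

theorem JJ_exp (h : NiceR ψ) (v : ℝ) : JJ ψ (fun s => cexp (-(s * v))) = ψ v := by
  set a : ℝ → ℂ := fun u : ℝ => ψ u * cexp ((3/2) * u) with ha
  have hp := Real.pi_pos
  have hac : Continuous a := h.cont.mul (by fun_prop)
  have hFi : Integrable (𝓕 a) := by
    have := K_int h
    simp_rw [KK_fou] at this
    have h2 := (this.comp_mul_left' (show (-(2*pp)) ≠ 0 by linarith [Real.pi_pos]))
    refine h2.congr (ae_of_all _ fun w => ?_)
    simp only [ha]; congr 1; field_simp
  have hinv := h.int.fourierInv_fourier_eq hFi (v := v) hac.continuousAt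
  rw [Real.fourierInv_eq_fourier_neg, show -v = (-(2*pp*v))/(2*pp) by field_simp, fou_eq] at hinv
  have hs := Measure.integral_comp_mul_left (fun w : ℝ => cexp (-(((-(2*pp*v):ℝ):ℂ) * w * I)) * 𝓕 a w) (-1/(2*pp))
  rw [hinv] at hs
  have e1 : |(-1/(2*pp))⁻¹| = 2*pp := by rw [inv_div, abs_div, abs_of_pos (by positivity)]; simp
  rw [e1] at hs
  rw [JJ]
  have e2 : ∀ τ : ℝ, cexp (-(ln τ * v)) * KK ψ (ln τ) = cexp (-((3/2) * v)) * (cexp (-(((-(2*pp*v):ℝ):ℂ) * ((-1/(2*pp)*τ : ℝ):ℂ) * I)) * 𝓕 a (-1/(2*pp)*τ)) := by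
    intro τ
    rw [KK_fou, ← mul_assoc, ← Complex.exp_add]
    congr 2
    · rw [ln]; push_cast; field_simp [Complex.ofReal_ne_zero.2 hp.ne']; ring
    · show 𝓕 a _ = 𝓕 a _
      congr 1; field_simp
  simp_rw [e2]
  rw [integral_const_mul, hs]
  rw [Complex.real_smul]
  push_cast
  have : cexp (-((3/2) * (v:ℂ))) * cexp ((3/2)*v) = 1 := by rw [← Complex.exp_add]; simp
  have hpc : (pp:ℂ) ≠ 0 := Complex.ofReal_ne_zero.2 hp.ne'
  calc _ = (1/(2*(pp:ℂ)) * (2*pp)) * ψ v * (cexp (-((3/2) * (v:ℂ))) * cexp ((3/2)*v)) := by ring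
    _ = _ := by rw [this]; field_simp

theorem JJ_one (h : NiceR ψ) : JJ ψ (fun s => 1) = ψ 0 := by simpa using JJ_exp h 0

theorem JJ_const_mul (c : ℂ) (Φ : ℂ → ℂ) : JJ ψ (fun s => c * Φ s) = c * JJ ψ Φ := by
  simp only [JJ, mul_assoc, integral_const_mul]; ring

theorem JJ_add {Φ Φ' : ℂ → ℂ} (h1 : Integrable (fun τ => Φ (ln τ) * KK ψ (ln τ))) (h2 : Integrable (fun τ => Φ' (ln τ) * KK ψ (ln τ))) :
    JJ ψ (fun s => Φ s + Φ' s) = JJ ψ Φ + JJ ψ Φ' := by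
  simp only [JJ, add_mul, integral_add h1 h2]; ring

theorem JJ_sum (h : NiceR ψ) {ι : Type*} {F : ι → ℂ → ℂ} {Φ : ℂ → ℂ} {a : ι → ℝ} (ha : Summable a)
    (hc : ∀ i, Continuous (fun τ => F i (ln τ))) (hb : ∀ i τ, ‖F i (ln τ)‖ ≤ a i * (1+|τ|)^2)
    (hs : ∀ τ, HasSum (fun i => F i (ln τ)) (Φ (ln τ))) : HasSum (fun i => JJ ψ (F i)) (JJ ψ Φ) := by
  have hz : ∀ i τ, a i = 0 → F i (ln τ) = 0 := fun i τ hi => by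
    have := hb i τ; rw [hi, zero_mul] at this; exact norm_le_zero_iff.1 this
  have ha0 : ∀ i, 0 ≤ a i := fun i => by
    have := (norm_nonneg _).trans (hb i 0); simpa using this
  have : Countable (Function.support a) := ha.countable_support.to_subtype
  have key := hasSum_integral_of_summable_integral_norm (μ := volume) (F := fun (i : Function.support a) τ => F i (ln τ) * KK ψ (ln τ))
    (fun i => JJ_int h (hc i) (hb i)) (by
      refine Summable.of_nonneg_of_le (fun i => integral_nonneg fun τ => norm_nonneg _) (fun i => ?_)
        ((ha.subtype (Function.support a)).mul_right (∫ τ, (1+|τ|)^2 * ‖KK ψ (ln τ)‖))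
      simp only [Function.comp]
      rw [← integral_const_mul]
      refine integral_mono (JJ_int h (hc i) (hb i)).norm ((wK_int h).const_mul _) fun τ => ?_
      simp only []
      rw [norm_mul, ← mul_assoc]; gcongr; exact hb i τ)
  have e : ∀ τ, ∑' i : Function.support a, F i (ln τ) * KK ψ (ln τ) = Φ (ln τ) * KK ψ (ln τ) := by
    intro τ
    have h1 := (hs τ).mul_right (KK ψ (ln τ))
    rw [← hasSum_subtype_iff_of_support_subset (s := Function.support a)] at h1
    · exact h1.tsum_eq
    · intro i hi hia
      simp only [Function.mem_support, not_not] at hi hia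
      exact hi (by rw [hz i τ hia, zero_mul])
  simp_rw [e] at key
  have k2 := key.mul_left (((1/(2*pp) : ℝ)) : ℂ)
  rw [← hasSum_subtype_iff_of_support_subset (s := Function.support a)]
  · exact k2
  · intro i hi hia
    simp only [Function.mem_support, not_not] at hi hia
    exact hi (by simp [JJ, hz i _ hia])

theorem inv_cont {ρ : ℂ} (hρ : ρ.re < 3/2) : Continuous (fun τ => 1/(ln τ - ρ)) := by
  refine continuous_const.div (ln_cont.sub continuous_const) fun τ h0 => ?_
  have := congrArg re h0
  rw [sub_re, ln_re, zero_re] at this; linarith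

theorem inv_bd {ρ : ℂ} (hρ : ρ.re < 3/2) (τ : ℝ) : ‖1/(ln τ - ρ)‖ ≤ (1/(3/2-ρ.re)) * (1+|τ|)^2 := by
  rw [norm_div, norm_one]
  have h1 : 3/2 - ρ.re ≤ ‖ln τ - ρ‖ := by
    have := re_le_norm (ln τ - ρ); rwa [sub_re, ln_re] at this
  have h2 : 0 < 3/2 - ρ.re := by linarith
  calc 1/‖ln τ - ρ‖ ≤ 1/(3/2-ρ.re) := one_div_le_one_div_of_le h2 h1
    _ = 1/(3/2-ρ.re) * 1 := by ring
    _ ≤ _ := by gcongr; exact one_le_w τ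

theorem JJ_inv (h : NiceR ψ) {ρ : ℂ} (hρ : ρ.re < 3/2) :
    JJ ψ (fun s => 1/(s-ρ)) = ∫ v in Ioi (0:ℝ), ψ v * cexp (ρ * v) := by
  have e : ∀ v : ℝ, ψ v * cexp (ρ * v) = (1/(2*pp) : ℝ) * ∫ τ : ℝ, cexp (-((ln τ - ρ) * v)) * KK ψ (ln τ) := by
    intro v
    rw [← JJ_exp h v, JJ, mul_assoc, ← integral_mul_const]
    congr 2; ext τ
    rw [mul_right_comm, ← Complex.exp_add]; congr 2; ring
  simp_rw [e]
  rw [integral_const_mul, JJ, integral_integral_swap]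
  · congr 2; ext τ
    rw [integral_mul_const]
    congr 1
    have := integral_exp_mul_complex_Ioi (a := -(ln τ - ρ)) (by rw [neg_re, sub_re, ln_re]; linarith) 0
    simp_rw [neg_mul] at this
    rw [this]; simp only [ofReal_zero, mul_zero, neg_zero, Complex.exp_zero]; rw [neg_div_neg_eq]
  · have hi : IntegrableOn (fun v : ℝ => rx (-(3/2-ρ.re) * v)) (Ioi 0) := integrableOn_exp_mul_Ioi (by linarith) 0
    have hp := Integrable.mul_prod (μ := volume.restrict (Ioi (0:ℝ))) (ν := volume) hi (K_int h).norm
    refine hp.mono' ?_ (ae_of_all _ fun p => ?_)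
    · refine Continuous.aestronglyMeasurable ?_
      have h2 := (KK_cont h).comp (continuous_snd (X := ℝ) (Y := ℝ))
      have h3 : Continuous (fun p : ℝ × ℝ => ln p.2) := ln_cont.comp continuous_snd
      show Continuous (fun p : ℝ×ℝ => cexp (-((ln p.2 - ρ) * p.1)) * KK ψ (ln p.2))
      refine Continuous.mul (by fun_prop) h2
    · simp only [Function.uncurry, norm_mul]
      gcongr
      rw [norm_exp, Real.exp_le_exp]
      simp [ln_re]
      exact le_of_eq (by ring)

end EF

section EFb
open Filter Topology Complex

variable {ψ : ℝ → ℂ}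

def Adm (Φ : ℂ → ℂ) : Prop := Continuous (fun τ => Φ (ln τ)) ∧ ∃ a : ℝ, ∀ τ, ‖Φ (ln τ)‖ ≤ a * (1+|τ|)^2

theorem Adm.int {Φ : ℂ → ℂ} (A : Adm Φ) (h : NiceR ψ) : Integrable (fun τ => Φ (ln τ) * KK ψ (ln τ)) := by
  obtain ⟨hc, a, hb⟩ := A; exact JJ_int h hc hb

theorem Adm.add {Φ Ψ : ℂ → ℂ} (A : Adm Φ) (B : Adm Ψ) : Adm (fun s => Φ s + Ψ s) := by
  obtain ⟨hc, a, hb⟩ := A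
  obtain ⟨hc', a', hb'⟩ := B
  refine ⟨hc.add hc', a + a', fun τ => (norm_add_le _ _).trans ?_⟩
  rw [add_mul]; exact add_le_add (hb τ) (hb' τ)

theorem Adm.cmul {Φ : ℂ → ℂ} (A : Adm Φ) (c : ℂ) : Adm (fun s => c * Φ s) := by
  obtain ⟨hc, a, hb⟩ := A
  refine ⟨continuous_const.mul hc, ‖c‖ * a, fun τ => ?_⟩
  rw [norm_mul, mul_assoc]; exact mll (hb τ) (norm_nonneg _)

theorem Adm.const (c : ℂ) : Adm (fun _ => c) := by
  refine ⟨continuous_const, ‖c‖, fun τ => ?_⟩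
  simpa using mll (one_le_w τ) (norm_nonneg c)

theorem Adm.inv {ρ : ℂ} (hρ : ρ.re < 3/2) : Adm (fun s => 1/(s-ρ)) := ⟨inv_cont hρ, _, inv_bd hρ⟩

theorem Adm.congr {Φ Ψ : ℂ → ℂ} (A : Adm Φ) (h : ∀ τ, Φ (ln τ) = Ψ (ln τ)) : Adm Ψ := by
  obtain ⟨hc, a, hb⟩ := A
  simp_rw [h] at hc hb
  exact ⟨hc, a, hb⟩

theorem Adm.jadd {Φ Ψ : ℂ → ℂ} (A : Adm Φ) (B : Adm Ψ) (h : NiceR ψ) : JJ ψ (fun s => Φ s + Ψ s) = JJ ψ Φ + JJ ψ Ψ :=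
  JJ_add (A.int h) (B.int h)

theorem JJ_congr {Φ Ψ : ℂ → ℂ} (h : ∀ τ, Φ (ln τ) = Ψ (ln τ)) : JJ ψ Φ = JJ ψ Ψ := by
  simp only [JJ, h]

theorem JJ_const (h : NiceR ψ) (c : ℂ) : JJ ψ (fun _ => c) = c * ψ 0 := by
  rw [← JJ_one h, ← JJ_const_mul]; simp

theorem sum_bd {ι : Type*} {F : ι → ℂ → ℂ} {Φ : ℂ → ℂ} {a : ι → ℝ} (ha : Summable a)
    (hb : ∀ i τ, ‖F i (ln τ)‖ ≤ a i * (1+|τ|)^2)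
    (hs : ∀ τ, HasSum (fun i => F i (ln τ)) (Φ (ln τ))) (τ : ℝ) : ‖Φ (ln τ)‖ ≤ (∑' i, a i) * (1+|τ|)^2 := by
  rw [← (hs τ).tsum_eq, ← tsum_mul_right]
  exact tsum_of_norm_bounded (ha.mul_right _).hasSum (fun i => hb i τ)

/-- reflection -/
noncomputable def refl' (ψ : ℝ → ℂ) (u : ℝ) : ℂ := ψ (-u) * cexp (-u)

theorem refl_zero (ψ : ℝ → ℂ) : refl' ψ 0 = ψ 0 := by simp [refl']

theorem hterm {ρ s : ℂ} {t : ℝ} (h0 : 0 < ρ.re) (h1 : ρ.re < 1) (hs : 1/2 ≤ ‖s-ρ‖) (ht : 0 ≤ t) (hd : ‖2-s‖ ≤ 5/2*(1+t)) :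
    ‖1/(s-ρ)-1/(2-ρ)‖ ≤ 30*(1/(1+‖ρ-2‖^2))*(1+t)^2 := by
  have n1 : s - ρ ≠ 0 := by intro h; rw [h, norm_zero] at hs; linarith
  have hc : 1 ≤ ‖2-ρ‖ := by
    have := re_le_norm (2-ρ); simp at this; linarith
  have n2 : 2 - ρ ≠ 0 := by intro h; rw [h, norm_zero] at hc; linarith
  have e : 1/(s-ρ)-1/(2-ρ) = (2-s)/((s-ρ)*(2-ρ)) := by field_simp; ring
  rw [e, norm_div, norm_mul, norm_sub_rev ρ 2]
  have tri : ‖2-ρ‖ ≤ ‖s-ρ‖ + ‖2-s‖ := by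
    have := norm_add_le (s-ρ) (2-s); rwa [show s-ρ+(2-s) = 2-ρ by ring] at this
  set A := ‖s-ρ‖
  set B := ‖2-ρ‖
  set D := ‖2-s‖
  have hD : 0 ≤ D := norm_nonneg _
  have k1 : B ≤ A * (6*(1+t)) := by nlinarith
  have k2 : 1 + B^2 ≤ 2*B^2 := by nlinarith
  have hB : 0 < B := by linarith
  have hA : 0 < A := by linarith
  rw [div_le_iff₀ (by positivity), mul_one_div, div_mul_eq_mul_div, div_mul_eq_mul_div, le_div_iff₀ (by positivity)]
  calc D * (1+B^2) ≤ (5/2*(1+t)) * (2*B^2) := by gcongr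
    _ = 5*(1+t)*B*B := by ring
    _ ≤ 5*(1+t)*(A * (6*(1+t)))*B := by gcongr
    _ = _ := by ring

variable {q : ℕ} [NeZero q] {χ : DirichletCharacter ℂ q}

theorem KK_int (h : NiceR ψ) (h' : NiceR (refl' ψ)) {ρ : ℂ} (h0 : -1/2 ≤ ρ.re) (h1 : ρ.re ≤ 3/2) :
    Integrable (fun u : ℝ => ψ u * cexp (ρ * u)) := by
  have i1 := h.int.norm
  have i2 := h'.int.norm.comp_neg
  refine (i1.add i2).mono' ((h.cont.mul (by fun_prop)).aestronglyMeasurable) (ae_of_all _ fun u => ?_)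
  simp only [refl', norm_mul, norm_exp, Pi.add_apply, neg_neg]
  have e1 : (ρ * (u:ℂ)).re = ρ.re * u := by simp
  have e2 : ((3/2:ℂ) * (u:ℂ)).re = 3/2 * u := by simp
  have e3 : (-((-u:ℝ):ℂ)).re = u := by simp
  have e4 : ((3/2:ℂ) * ((-u:ℝ):ℂ)).re = -(3/2*u) := by simp
  rw [e1, e2, e3, e4, mul_assoc, ← mul_add, ← Real.exp_add]
  gcongr
  rcases le_total 0 u with hu | hu
  · have : rx (ρ.re*u) ≤ rx (3/2*u) := Real.exp_le_exp.2 (by nlinarith)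
    linarith [Real.exp_pos (u + -(3/2*u))]
  · have : rx (ρ.re*u) ≤ rx (u + -(3/2*u)) := Real.exp_le_exp.2 (by nlinarith)
    linarith [Real.exp_pos (3/2*u)]

theorem KK_split (h : NiceR ψ) (h' : NiceR (refl' ψ)) {ρ : ℂ} (h0 : -1/2 ≤ ρ.re) (h1 : ρ.re ≤ 3/2) :
    KK ψ ρ = (∫ v in Ioi (0:ℝ), ψ v * cexp (ρ * v)) + ∫ v in Ioi (0:ℝ), refl' ψ v * cexp ((1-ρ) * v) := by
  have hi := KK_int h h' h0 h1
  rw [KK, ← integral_add_compl (measurableSet_Ioi (a := (0:ℝ))) hi]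
  congr 1
  rw [compl_Ioi]
  have := integral_comp_neg_Ioi (0:ℝ) (fun u : ℝ => ψ u * cexp (ρ * u))
  rw [neg_zero] at this
  rw [← this]
  congr 1; ext v
  simp only [refl']
  rw [mul_assoc, ← Complex.exp_add]; congr 2; push_cast; ring

theorem Z_sum (hχ : χ.IsPrimitive) {s : ℂ} (hs : 1 ≤ s.re ∨ s.re ≤ 0) :
    HasSum (fun ρ => (mlt (xi χ) ρ:ℂ)*(1/(s-ρ)-1/(2-ρ))) (logDeriv (xi χ) s - logDeriv (xi χ) 2) := by
  have hq := prim_ne hχ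
  refine had_main (xi_diff hq) (xi_growth hq) 2 (xi_ne_right hq (by simp)) s ?_
  rcases hs with h | h
  · exact xi_ne_right hq h
  · exact xi_ne_left hχ h

theorem Z_bd (hχ : χ.IsPrimitive) (ρ s : ℂ) (t : ℝ) (hs : s.re = 3/2 ∨ s.re = -1/2) (ht : 0 ≤ t) (hd : ‖2-s‖ ≤ 5/2*(1+t)) :
    ‖(mlt (xi χ) ρ:ℂ)*(1/(s-ρ)-1/(2-ρ))‖ ≤ 30 * (mlt (xi χ) ρ * (1/(1+‖ρ-2‖^2))) * (1+t)^2 := by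
  by_cases hm : mlt (xi χ) ρ = 0
  · simp [hm]
  obtain ⟨h0, h1, -⟩ := mlt_strip hχ hm
  have : 1/2 ≤ ‖s-ρ‖ := by
    have := abs_re_le_norm (s-ρ)
    refine le_trans ?_ this
    rw [sub_re]
    rcases hs with h | h <;> rw [h]
    · rw [abs_of_nonneg] <;> linarith
    · rw [abs_of_nonpos] <;> linarith
  have := hterm h0 h1 this ht hd
  rw [norm_mul, Complex.norm_natCast]
  calc _ ≤ (mlt (xi χ) ρ:ℝ) * (30*(1/(1+‖ρ-2‖^2))*(1+t)^2) := by gcongr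
    _ = _ := by ring

theorem Z_summ (hχ : χ.IsPrimitive) : Summable (fun ρ => 30 * ((mlt (xi χ) ρ:ℝ) * (1/(1+‖ρ-2‖^2)))) :=
  (had_summable (xi_diff (prim_ne hχ)) (xi_growth (prim_ne hχ)) 2 (xi_ne_right (prim_ne hχ) (by simp))).mul_left 30

theorem ln_n1 (τ : ℝ) : ‖2 - ln τ‖ ≤ 5/2*(1+|τ|) := by
  rw [ln, show (2:ℂ) - (3/2 + τ*I) = (1/2:ℝ) + (-τ:ℝ) * I by push_cast; ring]
  refine (norm_add_le _ _).trans ?_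
  rw [norm_mul, Complex.norm_real, Complex.norm_real, norm_I, Real.norm_eq_abs, Real.norm_eq_abs, abs_neg, abs_of_pos (by norm_num : (0:ℝ)<1/2)]
  linarith [abs_nonneg τ]

theorem ln_n2 (τ : ℝ) : ‖2 - (1 - ln τ)‖ ≤ 5/2*(1+|τ|) := by
  rw [ln, show (2:ℂ) - (1 - (3/2 + τ*I)) = (5/2:ℝ) + (τ:ℝ) * I by push_cast; ring]
  refine (norm_add_le _ _).trans ?_
  rw [norm_mul, Complex.norm_real, Complex.norm_real, norm_I, Real.norm_eq_abs, Real.norm_eq_abs, abs_of_pos (by norm_num : (0:ℝ)<5/2)]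
  linarith [abs_nonneg τ]

theorem ln_r2 (τ : ℝ) : (1 - ln τ).re = -1/2 := by rw [sub_re, ln_re]; norm_num

theorem inv2_cont {ρ : ℂ} (h0 : 0 < ρ.re) : Continuous (fun τ => 1/(1 - ln τ - ρ)) := by
  refine continuous_const.div ((continuous_const.sub ln_cont).sub continuous_const) fun τ h => ?_
  have := congrArg re h
  rw [sub_re, ln_r2, zero_re] at this; linarith

theorem Z_adm (hχ : χ.IsPrimitive) : Adm (logDeriv (xi χ)) := by
  have hq := prim_ne hχ
  have hd := xi_diff hq
  have A : Adm (fun s => logDeriv (xi χ) s - logDeriv (xi χ) 2) := by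
    refine ⟨?_, _, sum_bd (F := fun ρ s => (mlt (xi χ) ρ:ℂ)*(1/(s-ρ)-1/(2-ρ))) (Φ := fun s => logDeriv (xi χ) s - logDeriv (xi χ) 2) (Z_summ hχ)
      (fun ρ τ => Z_bd hχ ρ (ln τ) |τ| (Or.inl (ln_re τ)) (abs_nonneg _) (ln_n1 τ))
      (fun τ => Z_sum hχ (Or.inl (by rw [ln_re]; norm_num)))⟩
    refine Continuous.sub ?_ continuous_const
    have hd' : Differentiable ℂ (deriv (xi χ)) := fun z =>
      ((hd.analyticAt z).deriv).differentiableAt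
    simp only [logDeriv, Pi.div_apply]
    exact (hd'.continuous.comp ln_cont).div (hd.continuous.comp ln_cont) fun τ => xi_ne_right hq (by rw [ln_re]; norm_num)
  exact (A.add (Adm.const (logDeriv (xi χ) 2))).congr fun τ => by ring

theorem prim_inv (hχ : χ.IsPrimitive) : (χ⁻¹).IsPrimitive := by
  rw [DirichletCharacter.isPrimitive_def, DirichletCharacter.conductor_inv]; exact hχ

theorem zeros_side (hχ : χ.IsPrimitive) (h : NiceR ψ) (h' : NiceR (refl' ψ)) :
    HasSum (fun ρ => (mlt (xi χ) ρ : ℂ) * KK ψ ρ)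
      (JJ ψ (logDeriv (xi χ)) + JJ (refl' ψ) (logDeriv (xi χ⁻¹)) + lg q * ψ 0) := by
  have s1 := JJ_sum h (Φ := fun s => logDeriv (xi χ) s - logDeriv (xi χ) 2) (F := fun ρ s => (mlt (xi χ) ρ:ℂ)*(1/(s-ρ)-1/(2-ρ))) (Z_summ hχ)
      (fun ρ => by
        by_cases hm : mlt (xi χ) ρ = 0
        · simp only [hm, Nat.cast_zero, zero_mul]; exact continuous_const
        obtain ⟨h0, h1, -⟩ := mlt_strip hχ hm
        exact continuous_const.mul ((inv_cont (by linarith)).sub continuous_const))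
      (fun ρ τ => Z_bd hχ ρ (ln τ) |τ| (Or.inl (ln_re τ)) (abs_nonneg _) (ln_n1 τ))
      (fun τ => Z_sum hχ (Or.inl (by rw [ln_re]; norm_num)))
  have s2 := JJ_sum h' (Φ := fun s => logDeriv (xi χ) (1-s) - logDeriv (xi χ) 2) (F := fun ρ s => (mlt (xi χ) ρ:ℂ)*(1/((1-s)-ρ)-1/(2-ρ))) (Z_summ hχ)
      (fun ρ => by
        by_cases hm : mlt (xi χ) ρ = 0
        · simp only [hm, Nat.cast_zero, zero_mul]; exact continuous_const
        obtain ⟨h0, h1, -⟩ := mlt_strip hχ hm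
        exact continuous_const.mul ((inv2_cont h0).sub continuous_const))
      (fun ρ τ => Z_bd hχ ρ (1 - ln τ) |τ| (Or.inr (ln_r2 τ)) (abs_nonneg _) (ln_n2 τ))
      (fun τ => Z_sum hχ (Or.inr (by rw [ln_r2]; norm_num)))
  have s3 := s1.sub s2
  have e1 : JJ ψ (fun s => logDeriv (xi χ) s - logDeriv (xi χ) 2) = JJ ψ (logDeriv (xi χ)) + -logDeriv (xi χ) 2 * ψ 0 := by
    rw [← JJ_const h, ← (Z_adm hχ).jadd (Adm.const _) h]; simp only [sub_eq_add_neg]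
  have e2 : JJ (refl' ψ) (fun s => logDeriv (xi χ) (1-s) - logDeriv (xi χ) 2) = -1 * JJ (refl' ψ) (logDeriv (xi χ⁻¹)) + (-(lg q:ℂ) -logDeriv (xi χ) 2) * ψ 0 := by
    rw [← refl_zero ψ, ← JJ_const h', ← JJ_const_mul, ← ((Z_adm (prim_inv hχ)).cmul _).jadd (Adm.const _) h']
    refine JJ_congr fun τ => ?_
    rw [xi_logDeriv_left hχ (by rw [ln_re]; norm_num)]; ring
  rw [e1, e2] at s3
  have e3 : ∀ {f g : ℂ → ℂ} {a b : ℂ}, HasSum f a → (∀ ρ, g ρ = f ρ) → b = a → HasSum g b := by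
    intro f g a b hf h1 h2; rw [h2, funext h1]; exact hf
  refine e3 s3 (fun ρ => ?_) ?_
  · show (mlt (xi χ) ρ : ℂ) * KK ψ ρ = _
    by_cases hm : mlt (xi χ) ρ = 0
    · simp [hm, JJ]
    obtain ⟨h0, h1, -⟩ := mlt_strip hχ hm
    rw [JJ_const_mul, JJ_const_mul, ← mul_sub]
    congr 1
    have a1 : JJ ψ (fun s => 1/(s-ρ) - 1/(2-ρ)) = (∫ v in Ioi (0:ℝ), ψ v * cexp (ρ * v)) + -(1/(2-ρ)) * ψ 0 := by
      rw [← JJ_inv h (by linarith), ← JJ_const h, ← (Adm.inv (by linarith)).jadd (Adm.const _) h]; simp only [sub_eq_add_neg]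
    have a2 : JJ (refl' ψ) (fun s => 1/((1-s)-ρ) - 1/(2-ρ)) = -1 * (∫ v in Ioi (0:ℝ), refl' ψ v * cexp ((1-ρ) * v)) + -(1/(2-ρ)) * ψ 0 := by
      have hr : (1-ρ).re < 3/2 := by simp; linarith
      rw [← JJ_inv h' hr, ← refl_zero ψ, ← JJ_const h', ← JJ_const_mul, ← ((Adm.inv hr).cmul _).jadd (Adm.const _) h']
      refine JJ_congr fun τ => ?_
      rw [show (1:ℂ) - ln τ - ρ = -(ln τ - (1-ρ)) by ring, one_div_neg_eq_neg_one_div]; ring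
    rw [a1, a2, KK_split h h' (by linarith) (by linarith)]; ring
  · ring

end EFb

section EFc
open Filter Topology Complex

variable {ψ : ℝ → ℂ} {q : ℕ} [NeZero q] {χ : DirichletCharacter ℂ q}

noncomputable def tw (χ : DirichletCharacter ℂ q) : ℕ → ℂ := (fun n:ℕ => χ n) * (fun n:ℕ => (ArithmeticFunction.vonMangoldt n:ℂ))

theorem tw_apply (n : ℕ) : tw χ n = χ n * (ArithmeticFunction.vonMangoldt n:ℂ) := rfl

theorem tw_term (n : ℕ) {s : ℂ} : LSeries.term (tw χ) s n = tw χ n * cexp (-(s * (lg n : ℝ))) := by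
  by_cases hn : n = 0
  · simp [hn, tw_apply]
  rw [LSeries.term_of_ne_zero hn, div_eq_mul_inv, Complex.cpow_def_of_ne_zero (by exact_mod_cast hn), ← Complex.exp_neg, Complex.natCast_log]
  rw [mul_comm s]

theorem tw_summ {s : ℂ} (hs : 1 < s.re) : Summable (fun n => LSeries.term (tw χ) s n) :=
  DirichletCharacter.LSeriesSummable_twist_vonMangoldt χ hs

theorem tw_bd (n : ℕ) (τ : ℝ) : ‖tw χ n * cexp (-(ln τ * (lg n : ℝ)))‖ ≤ ‖LSeries.term (tw χ) (3/2) n‖ * (1+|τ|)^2 := by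
  rw [tw_term, norm_mul, norm_mul, norm_exp, norm_exp]
  have : (-(ln τ * (lg n : ℝ))).re = (-((3/2:ℂ) * (lg n : ℝ))).re := by
    rw [neg_re, neg_re, re_mul_ofReal, re_mul_ofReal, ln_re]; norm_num
  rw [this]
  exact le_mul_of_one_le_right (by positivity) (one_le_w τ)

theorem tw_hs (τ : ℝ) : HasSum (fun n : ℕ => tw χ n * cexp (-(ln τ * (lg n : ℝ)))) (LSeries (tw χ) (ln τ)) := by
  simp_rw [← tw_term]
  exact (tw_summ (by rw [ln_re]; norm_num)).hasSum

theorem LS_side (h : NiceR ψ) : HasSum (fun n : ℕ => tw χ n * ψ (lg n)) (JJ ψ (LSeries (tw χ))) := by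
  have := JJ_sum h (F := fun n s => tw χ n * cexp (-(s * (lg n : ℝ)))) (tw_summ (χ := χ) (s := 3/2) (by norm_num)).norm
    (fun n => by have := ln_cont; fun_prop) (fun n τ => tw_bd n τ) (fun τ => tw_hs τ)
  simpa only [JJ_const_mul, JJ_exp h] using this

theorem LS_adm : Adm (LSeries (tw χ)) := by
  refine ⟨?_, _, sum_bd (F := fun n s => tw χ n * cexp (-(s * (lg n : ℝ)))) (tw_summ (χ := χ) (s := 3/2) (by norm_num)).norm (fun n τ => tw_bd n τ) (fun τ => tw_hs τ)⟩
  have e : (fun τ => LSeries (tw χ) (ln τ)) = fun τ => ∑' n : ℕ, tw χ n * cexp (-(ln τ * (lg n : ℝ))) := by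
    ext τ; exact (tw_hs τ).tsum_eq.symm
  rw [e]
  refine continuous_tsum (fun n => by have := ln_cont; fun_prop) (tw_summ (χ := χ) (s := 3/2) (by norm_num)).norm fun n τ => ?_
  rw [tw_term, norm_mul, norm_mul, norm_exp, norm_exp]
  have : (-(ln τ * (lg n : ℝ))).re = (-((3/2:ℂ) * (lg n : ℝ))).re := by
    rw [neg_re, neg_re, re_mul_ofReal, re_mul_ofReal, ln_re]; norm_num
  rw [this]

theorem arch_adm (hχ : χ.IsPrimitive) : Adm (archA χ) := by
  refine ((Z_adm hχ).add (LS_adm (χ := χ))).congr fun τ => ?_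
  rw [xi_logDeriv_right (prim_ne hχ) (by rw [ln_re]; norm_num)]
  simp only [tw]; ring

theorem prime_side (hχ : χ.IsPrimitive) (h : NiceR ψ) : JJ ψ (logDeriv (xi χ)) = JJ ψ (archA χ) - JJ ψ (LSeries (tw χ)) := by
  have := (arch_adm hχ).jadd ((LS_adm (χ := χ)).cmul (-1)) h
  rw [JJ_const_mul] at this
  rw [sub_eq_add_neg, ← neg_one_mul, ← this]
  refine JJ_congr fun τ => ?_
  rw [xi_logDeriv_right (prim_ne hχ) (by rw [ln_re]; norm_num)]
  simp only [tw]; ring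

/-- digamma summand -/
noncomputable def dg (a : ℕ) (k : ℕ) (s : ℂ) : ℂ := 1/(2*((k:ℂ)+1)) + (-1) * (1/(s - (-((a:ℂ)+2*((k:ℂ)+1)))))

theorem dg_re (a k : ℕ) : (-((a:ℂ)+2*((k:ℂ)+1))).re < 3/2 := by
  simp only [neg_re, add_re, natCast_re, mul_re, re_ofNat, im_ofNat, one_re]
  have : (0:ℝ) ≤ a := Nat.cast_nonneg _
  have : (0:ℝ) ≤ k := Nat.cast_nonneg _
  simp; linarith

theorem dg_bd (a k : ℕ) (ha : a ≤ 1) (τ : ℝ) : ‖dg a k (ln τ)‖ ≤ (5/8)*(1/((k:ℝ)+1)^2) * (1+|τ|)^2 := by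
  have hk : (0:ℝ) ≤ k := Nat.cast_nonneg _
  have ha0 : (0:ℝ) ≤ a := Nat.cast_nonneg _
  have ha1 : (a:ℝ) ≤ 1 := by exact_mod_cast ha
  have n1 : 2*((k:ℝ)+1) ≤ ‖ln τ + a + 2*((k:ℂ)+1)‖ := by
    refine le_trans ?_ (re_le_norm _)
    simp only [add_re, ln_re, natCast_re, mul_re, re_ofNat, im_ofNat, one_re]; simp; linarith
  have z1 : ln τ + a + 2*((k:ℂ)+1) ≠ 0 := by intro h; rw [h, norm_zero] at n1; linarith
  have z2 : 2*((k:ℂ)+1) ≠ 0 := by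
    have : (2*((k:ℂ)+1)) = ((2*((k:ℝ)+1):ℝ):ℂ) := by push_cast; ring
    rw [this, Complex.ofReal_ne_zero]; positivity
  have e : dg a k (ln τ) = (ln τ + a)/((2*((k:ℂ)+1)) * (ln τ + a + 2*((k:ℂ)+1))) := by
    rw [dg, sub_neg_eq_add, ← add_assoc]; field_simp; ring
  have n2 : ‖2*((k:ℂ)+1)‖ = 2*((k:ℝ)+1) := by
    have : (2*((k:ℂ)+1)) = ((2*((k:ℝ)+1):ℝ):ℂ) := by push_cast; ring
    rw [this, Complex.norm_real, Real.norm_of_nonneg (by positivity)]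
  have n3 : ‖ln τ + a‖ ≤ 5/2*(1+|τ|)^2 := by
    rw [ln, show (3/2 + τ*I + a : ℂ) = ((3/2+a:ℝ):ℂ) + (τ:ℝ) * I by push_cast; ring]
    refine (norm_add_le _ _).trans ?_
    rw [norm_mul, Complex.norm_real, Complex.norm_real, norm_I, Real.norm_eq_abs, Real.norm_eq_abs, abs_of_pos (by linarith : (0:ℝ)<3/2+a)]
    nlinarith [abs_nonneg τ]
  rw [e, norm_div, norm_mul, n2]
  calc _ ≤ (5/2*(1+|τ|)^2)/((2*((k:ℝ)+1))*(2*((k:ℝ)+1))) := by gcongr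
    _ = _ := by field_simp; norm_num

theorem dg_hs (a : ℕ) (τ : ℝ) : HasSum (fun k => dg a k (ln τ)) (Complex.digamma ((ln τ + a)/2)/2 + (Real.eulerMascheroniConstant:ℂ)/2 + 1/(ln τ - (-(a:ℂ)))) := by
  have ha0 : (0:ℝ) ≤ a := Nat.cast_nonneg _
  have hr : (ln τ + a).re = 3/2 + a := by rw [add_re, ln_re, natCast_re]
  have hz : 0 < ((ln τ + a)/2).re := by
    rw [show (ln τ + a)/2 = ((1/2:ℝ):ℂ) * (ln τ + a) by push_cast; ring, re_ofReal_mul, hr]; linarith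
  have := (digamma_hasSum hz).div_const 2
  have z : ln τ + a ≠ 0 := by intro h; rw [h, zero_re] at hr; linarith
  have e3 : ∀ {f g : ℕ → ℂ} {a b : ℂ}, HasSum f a → (∀ ρ, g ρ = f ρ) → b = a → HasSum g b := by
    intro f g a b hf h1 h2; rw [h2, funext h1]; exact hf
  refine e3 this (fun k => ?_) ?_
  · have hk : (0:ℝ) ≤ k := Nat.cast_nonneg _
    have z1 : ln τ + a + 2*((k:ℂ)+1) ≠ 0 := by
      intro h
      have := congrArg re h
      rw [add_re, hr] at this
      simp at this; linarith
    have z2 : ((k:ℂ)+1) ≠ 0 := by exact_mod_cast Nat.succ_ne_zero k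
    have z3 : (ln τ + a)/2+(k+1) ≠ 0 := by
      intro h; apply z1; rw [show ln τ + a + 2*((k:ℂ)+1) = 2*((ln τ + a)/2+(k+1)) by ring, h, mul_zero]
    rw [dg, sub_neg_eq_add, ← add_assoc, show ln τ + a + 2*((k:ℂ)+1) = 2*((ln τ + a)/2+(k+1)) by ring]
    generalize (ln τ + a)/2+((k:ℂ)+1) = w at z3 ⊢
    field_simp; ring
  · rw [sub_neg_eq_add]; field_simp

theorem c_sum : Summable (fun k : ℕ => 1/(((k:ℝ)+1)*√((k:ℝ)+1))) ∧ ∑' k : ℕ, 1/(((k:ℝ)+1)*√((k:ℝ)+1)) ≤ 3 := by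
  have key : ∀ n : ℕ, ∑ k ∈ Finset.range (n+1), 1/(((k:ℝ)+1)*√((k:ℝ)+1)) ≤ 3 - 2/√((n:ℝ)+1) := by
    intro n
    induction n with
    | zero => simp; norm_num
    | succ n ih =>
      rw [Finset.sum_range_succ]
      push_cast
      have h1 : (0:ℝ) < (n:ℝ)+1 := by positivity
      have hA := Real.sq_sqrt h1.le
      have hB := Real.sq_sqrt (show (0:ℝ) ≤ (n:ℝ)+1+1 by positivity)
      have hA0 := Real.sqrt_pos.2 h1
      have hB0 := Real.sqrt_pos.2 (show (0:ℝ) < (n:ℝ)+1+1 by positivity)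
      set A := √((n:ℝ)+1)
      set B := √((n:ℝ)+1+1)
      have hAB : A ≤ B := by nlinarith
      rw [← hB]
      have : 1/(B^2*B) ≤ 2/A - 2/B := by
        rw [div_sub_div _ _ hA0.ne' hB0.ne', div_le_div_iff₀ (by positivity) (by positivity)]
        have h5 : (B - A)*(B+A) = 1 := by nlinarith
        have h6 : A*(A+B) ≤ 2*B^2 := by nlinarith
        have h7 : 0 ≤ (B-A)*(2*B^2 - A*(A+B)) := mul_nonneg (by linarith) (by linarith)
        have h8 : A ≤ 2*B^2*(B-A) := by nlinarith
        nlinarith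
      linarith
  have key2 : ∀ n : ℕ, ∑ k ∈ Finset.range n, 1/(((k:ℝ)+1)*√((k:ℝ)+1)) ≤ 3 := by
    intro n
    rcases n with _ | n
    · simp
    · have := key n
      have h2 : 0 ≤ 2/√((n:ℝ)+1) := by positivity
      linarith
  have hs := summable_of_sum_range_le (fun k => by positivity) key2
  exact ⟨hs, Real.tsum_le_of_sum_range_le (fun k => by positivity) key2⟩

theorem dg_J (h : NiceR ψ) (a k : ℕ) {S M : ℝ} (hS : ∀ v : ℝ, 0 ≤ v → ‖ψ v‖ ≤ S) (hM : ∀ v : ℝ, 0 ≤ v → ‖ψ 0 - cexp (-(a*v)) * ψ v‖ ≤ M * v) :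
    ‖JJ ψ (dg a k)‖ ≤ √(S*M/4) * (1/(((k:ℝ)+1)*√((k:ℝ)+1))) := by
  have hk : (0:ℝ) < (k:ℝ)+1 := by positivity
  have ha0 : (0:ℝ) ≤ a := Nat.cast_nonneg _
  have hS0 : 0 ≤ S := (norm_nonneg _).trans (hS 0 le_rfl)
  have hM0 : 0 ≤ M := by have := (norm_nonneg _).trans (hM 1 zero_le_one); linarith
  have e1 : JJ ψ (dg a k) = 1/(2*((k:ℂ)+1)) * ψ 0 + (-1) * ∫ v in Ioi (0:ℝ), ψ v * cexp ((-((a:ℂ)+2*((k:ℂ)+1))) * v) := by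
    rw [← JJ_inv h (dg_re a k), ← JJ_const h, ← JJ_const_mul, ← (Adm.const _).jadd ((Adm.inv (dg_re a k)).cmul _) h]; rfl
  have i0 : IntegrableOn (fun v : ℝ => rx (-(2*((k:ℝ)+1)) * v)) (Ioi 0) := integrableOn_exp_mul_Ioi (by linarith) 0
  have v0 : ∫ v in Ioi (0:ℝ), rx (-(2*((k:ℝ)+1)) * v) = 1/(2*((k:ℝ)+1)) := by
    rw [integral_exp_mul_Ioi (by linarith)]; simp
  have v1 : ∫ v in Ioi (0:ℝ), v * rx (-(2*((k:ℝ)+1)) * v) = 1/(2*((k:ℝ)+1))^2 := by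
    have := Real.integral_rpow_mul_exp_neg_mul_Ioi (a := 2) (r := 2*((k:ℝ)+1)) (by norm_num) (by linarith)
    norm_num [Real.Gamma_two] at this
    simp only [neg_mul]
    rw [this]; field_simp
  have i1 : IntegrableOn (fun v : ℝ => v * rx (-(2*((k:ℝ)+1)) * v)) (Ioi 0) := by
    by_contra hc
    have := integral_undef hc
    rw [v1] at this
    have : 0 < 1/(2*((k:ℝ)+1))^2 := by positivity
    linarith
  have e2 : JJ ψ (dg a k) = ∫ v in Ioi (0:ℝ), cexp (-(2*((k:ℂ)+1)) * v) * (ψ 0 - cexp (-(a*v)) * ψ v) := by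
    have c0 : (-(2*((k:ℂ)+1))).re = -(2*((k:ℝ)+1)) := by simp
    have c1 : ∫ v : ℝ in Ioi (0:ℝ), cexp (-(2*((k:ℂ)+1)) * v) = 1/(2*((k:ℂ)+1)) := by
      rw [integral_exp_mul_complex_Ioi (by rw [c0]; linarith)]
      simp only [ofReal_zero, mul_zero, Complex.exp_zero]; rw [neg_div_neg_eq]
    have c2 : IntegrableOn (fun v : ℝ => cexp (-(2*((k:ℂ)+1)) * v) * ψ 0) (Ioi 0) :=
      (integrableOn_exp_mul_complex_Ioi (by rw [c0]; linarith) 0).mul_const _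
    have c3 : IntegrableOn (fun v : ℝ => ψ v * cexp ((-((a:ℂ)+2*((k:ℂ)+1))) * v)) (Ioi 0) := by
      refine (i0.const_mul S).mono' ((h.cont.mul (by fun_prop)).aestronglyMeasurable) ?_
      refine (ae_restrict_iff' measurableSet_Ioi).2 (ae_of_all _ fun v hv => ?_)
      have hv : 0 < v := hv
      rw [norm_mul, norm_exp]
      gcongr
      · exact hS v hv.le
      · simp; nlinarith
    rw [e1, ← c1, ← integral_mul_const, ← integral_const_mul, ← integral_add c2 (c3.const_mul _)]
    congr 1; ext v
    rw [show -((a:ℂ)+2*((k:ℂ)+1)) * v = -(2*((k:ℂ)+1)) * v + -(a*v) by ring, Complex.exp_add]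
    ring
  have nb : ∀ v : ℝ, ‖cexp (-(2*((k:ℂ)+1)) * v) * (ψ 0 - cexp (-(a*v)) * ψ v)‖ = rx (-(2*((k:ℝ)+1)) * v) * ‖ψ 0 - cexp (-(a*v)) * ψ v‖ := by
    intro v; rw [norm_mul, norm_exp]; congr 2; simp
  have hS2 : ∀ v : ℝ, 0 ≤ v → ‖ψ 0 - cexp (-(a*v)) * ψ v‖ ≤ 2*S := by
    intro v hv
    refine (norm_sub_le _ _).trans ?_
    have : ‖cexp (-(a*v)) * ψ v‖ ≤ 1 * S := by
      rw [norm_mul]; gcongr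
      · rw [norm_exp, Real.exp_le_one_iff]; simp; positivity
      · exact hS v hv
    linarith [hS 0 le_rfl]
  have b1 : ‖JJ ψ (dg a k)‖ ≤ S/((k:ℝ)+1) := by
    rw [e2]
    refine (norm_integral_le_of_norm_le (i0.mul_const (2*S)) ?_).trans ?_
    · refine (ae_restrict_iff' measurableSet_Ioi).2 (ae_of_all _ fun v hv => ?_)
      rw [nb]; gcongr; exact hS2 v (le_of_lt hv)
    · rw [integral_mul_const, v0]; apply le_of_eq; field_simp
  have b2 : ‖JJ ψ (dg a k)‖ ≤ M/(4*((k:ℝ)+1)^2) := by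
    rw [e2]
    refine (norm_integral_le_of_norm_le (i1.mul_const M) ?_).trans ?_
    · refine (ae_restrict_iff' measurableSet_Ioi).2 (ae_of_all _ fun v hv => ?_)
      rw [nb, show v * rx (-(2*((k:ℝ)+1)) * v) * M = rx (-(2*((k:ℝ)+1)) * v) * (M * v) by ring]
      gcongr; exact hM v (le_of_lt hv)
    · rw [integral_mul_const, v1]; apply le_of_eq; field_simp
      norm_num [mul_comm]
  have : ‖JJ ψ (dg a k)‖^2 ≤ (√(S*M/4) * (1/(((k:ℝ)+1)*√((k:ℝ)+1))))^2 := by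
    rw [mul_pow, div_pow, mul_pow, Real.sq_sqrt (by positivity), Real.sq_sqrt hk.le, sq]
    calc _ ≤ (S/((k:ℝ)+1)) * (M/(4*((k:ℝ)+1)^2)) := by gcongr
      _ = _ := by field_simp
  exact le_of_sq_le_sq this (by positivity)

theorem arch_side (hχ : χ.IsPrimitive) (h : NiceR ψ) {S M D : ℝ} (hS : ∀ v : ℝ, 0 ≤ v → ‖ψ v‖ ≤ S)
    (hM : ∀ v : ℝ, 0 ≤ v → ‖ψ 0 - cexp (-((par χ : ℂ)*v)) * ψ v‖ ≤ M * v) (hDi : IntegrableOn (fun v => ‖ψ v‖) (Ioi 0)) (hD : ∫ v in Ioi (0:ℝ), ‖ψ v‖ ≤ D) :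
    ‖JJ ψ (archA χ) - (if q = 1 then (∫ v in Ioi (0:ℝ), ψ v * cexp (0 * v)) + ∫ v in Ioi (0:ℝ), ψ v * cexp (1 * v) else 0)‖
      ≤ ‖ψ 0‖ + D + 3 * √(S*M/4) := by
  set a := par χ with ha
  have ha1 : a ≤ 1 := par_le χ
  have hra : (-(a:ℂ)).re < 3/2 := by
    simp; have : (0:ℝ) ≤ a := Nat.cast_nonneg _
    linarith
  have hsk : Summable (fun k : ℕ => (5/8)*(1/((k:ℝ)+1)^2)) := by
    have := ((summable_nat_add_iff 1).2 (Real.summable_one_div_nat_pow.2 one_lt_two)).mul_left (5/8:ℝ)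
    simpa using this
  set Φ : ℂ → ℂ := fun s => Complex.digamma ((s + a)/2)/2 + (Real.eulerMascheroniConstant:ℂ)/2 + 1/(s - (-(a:ℂ))) with hΦ
  have hJ : HasSum (fun k => JJ ψ (dg a k)) (JJ ψ Φ) := by
    refine JJ_sum h hsk (fun k => ?_) (fun k τ => dg_bd a k ha1 τ) (fun τ => dg_hs a τ)
    exact ((Adm.const _).add ((Adm.inv (dg_re a k)).cmul (-1))).1
  have hJb : ‖JJ ψ Φ‖ ≤ 3 * √(S*M/4) := by
    have := tsum_of_norm_bounded (c_sum.1.mul_left (√(S*M/4))).hasSum (fun k => dg_J h a k hS hM)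
    rw [hJ.tsum_eq, tsum_mul_left] at this
    nlinarith [c_sum.2, Real.sqrt_nonneg (S*M/4)]
  set P : ℂ → ℂ := fun s => if q = 1 then 1/(s-0) + 1/(s-1) else 0 with hP
  have hPA : Adm P := by
    rw [hP]; split_ifs
    · exact (Adm.inv (by simp)).add (Adm.inv (by simp; norm_num))
    · exact Adm.const 0
  have hPJ : JJ ψ P = (if q = 1 then (∫ v in Ioi (0:ℝ), ψ v * cexp (0 * v)) + ∫ v in Ioi (0:ℝ), ψ v * cexp (1 * v) else 0) := by
    rw [hP]; split_ifs
    · rw [(Adm.inv (ρ := 0) (by simp)).jadd (Adm.inv (ρ := 1) (by simp; norm_num)) h, JJ_inv h (by simp), JJ_inv h (by simp; norm_num)]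
    · rw [JJ_const h, zero_mul]
  set c : ℂ := -lg pp / 2 - (Real.eulerMascheroniConstant:ℂ)/2 with hc
  have eA : JJ ψ (archA χ) = JJ ψ Φ + (c * ψ 0 + (-1 * (∫ v in Ioi (0:ℝ), ψ v * cexp (-(a:ℂ) * v)) + JJ ψ P)) := by
    have A3 := ((Adm.inv hra).cmul (-1)).add hPA
    have A2 := (Adm.const c).add A3
    have AΦ : Adm Φ := ((arch_adm hχ).add (A2.cmul (-1))).congr fun τ => by
      simp only [hΦ, hP, archA, hc, ← ha, sub_zero]; ring
    rw [← JJ_inv h hra, ← JJ_const_mul, ← ((Adm.inv hra).cmul (-1)).jadd hPA h, ← JJ_const h, ← (Adm.const c).jadd A3 h, ← AΦ.jadd A2 h]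
    refine JJ_congr fun τ => ?_
    simp only [hΦ, hP, archA, hc, ← ha, sub_zero]; ring
  rw [eA, hPJ]
  have hcn : ‖c‖ ≤ 1 := by
    have e : c = ((-(lg pp / 2 + Real.eulerMascheroniConstant/2):ℝ):ℂ) := by rw [hc]; push_cast; ring
    have l1 : 0 ≤ lg pp := Real.log_nonneg (by linarith [pi_b.1])
    have l2 : lg pp ≤ 1.2 := by
      rw [Real.log_le_iff_le_exp Real.pi_pos]
      have := Real.quadratic_le_exp_of_nonneg (x := 0.6) (by norm_num)
      have e2 : rx 1.2 = (rx 0.6)^2 := by rw [← Real.exp_nat_mul]; norm_num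
      rw [e2]; nlinarith [pi_b.2]
    have g1 := Real.one_half_lt_eulerMascheroniConstant
    have g2 := Real.eulerMascheroniConstant_lt_two_thirds
    rw [e, Complex.norm_real, norm_neg, Real.norm_of_nonneg (by linarith)]; linarith
  have hI : ‖∫ v in Ioi (0:ℝ), ψ v * cexp (-(a:ℂ) * v)‖ ≤ D := by
    refine (norm_integral_le_of_norm_le hDi ?_).trans hD
    refine (ae_restrict_iff' measurableSet_Ioi).2 (ae_of_all _ fun v hv => ?_)
    have hv : 0 < v := hv
    rw [norm_mul, norm_exp]
    refine mul_le_of_le_one_right (norm_nonneg _) ?_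
    rw [Real.exp_le_one_iff]; simp; positivity
  have hc2 : ‖c * ψ 0‖ ≤ ‖ψ 0‖ := by
    rw [norm_mul]; exact mul_le_of_le_one_left (norm_nonneg _) hcn
  generalize (∫ v in Ioi (0:ℝ), ψ v * cexp (-(a:ℂ) * v)) = I0 at hI ⊢
  generalize (if q = 1 then (∫ v in Ioi (0:ℝ), ψ v * cexp (0 * v)) + ∫ v in Ioi (0:ℝ), ψ v * cexp (1 * v) else 0) = Q
  rw [show JJ ψ Φ + (c * ψ 0 + (-1 * I0 + Q)) - Q = JJ ψ Φ + c * ψ 0 + -I0 by ring]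
  refine (norm_add_le _ _).trans ?_
  rw [norm_neg]
  linarith [norm_add_le (JJ ψ Φ) (c * ψ 0)]

end EFc

section EFd
open Filter Topology Complex

variable {ψ : ℝ → ℂ} {q : ℕ} [NeZero q] {χ : DirichletCharacter ℂ q}

theorem EFmain (hχ : χ.IsPrimitive) (h : NiceR ψ) (h' : NiceR (refl' ψ)) {S M D B : ℝ}
    (hS : ∀ v : ℝ, 0 ≤ v → ‖ψ v‖ ≤ S) (hS' : ∀ v : ℝ, 0 ≤ v → ‖refl' ψ v‖ ≤ S)
    (hM : ∀ v : ℝ, 0 ≤ v → ‖ψ 0 - cexp (-((par χ : ℂ)*v)) * ψ v‖ ≤ M * v)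
    (hM' : ∀ v : ℝ, 0 ≤ v → ‖ψ 0 - cexp (-((par χ : ℂ)*v)) * refl' ψ v‖ ≤ M * v)
    (hDi : IntegrableOn (fun v => ‖ψ v‖) (Ioi 0)) (hD : ∫ v in Ioi (0:ℝ), ‖ψ v‖ ≤ D)
    (hDi' : IntegrableOn (fun v => ‖refl' ψ v‖) (Ioi 0)) (hD' : ∫ v in Ioi (0:ℝ), ‖refl' ψ v‖ ≤ D)
    (hB : ∀ n : ℕ, 1 ≤ n → ‖refl' ψ (lg n)‖ ≤ B / n^2) :
    ∃ R : ℂ, ∃ Zs : ℂ, HasSum (fun ρ => (mlt (xi χ) ρ : ℂ) * KK ψ ρ) Zs ∧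
      ∑' n : ℕ, tw χ n * ψ (lg n) = (if q = 1 then KK ψ 0 + KK ψ 1 else 0) - Zs + R ∧
      ‖R‖ ≤ (2 + lg q) * ‖ψ 0‖ + 2 * D + 6 * √(S*M/4) + B := by
  have z := zeros_side hχ h h'
  rw [prime_side hχ h, prime_side (prim_inv hχ) h'] at z
  have l1 := LS_side (χ := χ) h
  have l2 := LS_side (χ := χ⁻¹) h'
  have a1 := arch_side hχ h hS hM hDi hD
  have a2 := arch_side (prim_inv hχ) h' hS' (by rw [par_inv, refl_zero]; exact hM') hDi' hD'
  have hl2 : ‖JJ (refl' ψ) (LSeries (tw χ⁻¹))‖ ≤ B := by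
    have := tsum_of_norm_bounded (vM_sum.1.mul_left B).hasSum (f := fun n : ℕ => tw χ⁻¹ n * refl' ψ (lg n)) (fun n => by
      rcases Nat.eq_zero_or_pos n with rfl | hn
      · simp [tw_apply]
      rw [norm_mul, tw_apply, norm_mul, Complex.norm_real, Real.norm_of_nonneg ArithmeticFunction.vonMangoldt_nonneg]
      have c1 := DirichletCharacter.norm_le_one χ⁻¹ (n : ZMod q)
      have hv := ArithmeticFunction.vonMangoldt_nonneg (n := n)
      calc ‖χ⁻¹ (n : ZMod q)‖ * vM n * ‖refl' ψ (lg n)‖ ≤ 1 * vM n * (B/n^2) := by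
            gcongr; exact hB n hn
        _ = _ := by ring)
    rw [l2.tsum_eq, tsum_mul_left] at this
    have hB0 : 0 ≤ B := by
      have := (norm_nonneg _).trans (hB 1 le_rfl); simpa using this
    nlinarith [vM_sum.2]
  refine ⟨(JJ ψ (archA χ) - (if q = 1 then (∫ v in Ioi (0:ℝ), ψ v * cexp (0 * v)) + ∫ v in Ioi (0:ℝ), ψ v * cexp (1 * v) else 0))
    + (JJ (refl' ψ) (archA χ⁻¹) - (if q = 1 then (∫ v in Ioi (0:ℝ), refl' ψ v * cexp (0 * v)) + ∫ v in Ioi (0:ℝ), refl' ψ v * cexp (1 * v) else 0))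
    + lg q * ψ 0 + -JJ (refl' ψ) (LSeries (tw χ⁻¹)), _, z, ?_, ?_⟩
  · rw [l1.tsum_eq, KK_split h h' (ρ := 0) (by norm_num) (by norm_num), KK_split h h' (ρ := 1) (by norm_num) (by norm_num)]
    simp only [sub_zero, sub_self]
    split_ifs <;> ring
  · refine (norm_add_le _ _).trans ?_
    refine (add_le_add_left (norm_add_le _ _) _).trans ?_
    refine (add_le_add_left (add_le_add_left (norm_add_le _ _) _) _).trans ?_
    have hl : 0 ≤ lg q := Real.log_natCast_nonneg q
    rw [norm_mul, Complex.norm_real, Real.norm_of_nonneg hl, norm_neg]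
    rw [refl_zero] at a2
    linarith

end EFd

section PS
open Filter Topology Complex

noncomputable def p0 (H l u : ℝ) : ℂ := (hH H (rx u) : ℂ) * Psi l 1 u
noncomputable def px (H l x u : ℝ) : ℂ := p0 H l (u - lg x)

theorem p0_eta (H δ : ℝ) (u : ℝ) : e2pi (δ * rx u) * (etaPlus H (rx u) : ℂ) = p0 H (2*pp*δ) u := by
  rw [p0, etaPlus, e2pi, Psi]
  push_cast
  rw [← Complex.exp_add, mul_left_comm, ← Complex.exp_add]
  congr 2
  rw [show (2:ℂ) * (u:ℂ) = u + u by ring, Complex.exp_add]; ring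

theorem px_eta {x : ℝ} (hx : 0 < x) (H δ : ℝ) {y : ℝ} (hy : 0 < y) :
    e2pi (δ * y / x) * (etaPlus H (y / x) : ℂ) = px H (2*pp*δ) x (lg y) := by
  rw [px, ← p0_eta, ← Real.log_div hy.ne' hx.ne', Real.exp_log (div_pos hy hx), mul_div_assoc]

theorem Psi_add (l : ℝ) (s t w : ℂ) : Psi l (s + t) w = Psi l s w * cexp (t * w) := by
  rw [Psi, Psi, ← Complex.exp_add]; congr 1; ring

theorem Psi_n0 (l : ℝ) (s : ℂ) (u : ℝ) : ‖Psi l s u‖ = BBi 0 s.re 0 u := by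
  have := Psi_norm l s u 0
  simp only [ofReal_zero, zero_mul, add_zero, neg_zero, Real.exp_zero, one_mul] at this
  rw [this, BBi, BBi]; simp

theorem Psi_int0 {l : ℝ} {s : ℂ} (hs : 0 < s.re) : Integrable (fun u : ℝ => Psi l s u) := by
  have := Psi_int (l := l) (θ := 0) hs (by simp; positivity)
  simpa using this

variable {H l x : ℝ}

theorem p0_cont (hH0 : 0 < H) : Continuous (p0 H l) := by
  unfold p0
  have h1 := hHexp_cont hH0
  have h2 := (Psi_diff l 1).continuous
  fun_prop

theorem p0_int (hH0 : 0 < H) {s : ℂ} (hs : -1 < s.re) : Integrable (fun u : ℝ => p0 H l u * cexp (s * u)) := by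
  have hi := (Psi_int0 (l := l) (s := 1 + s) (by simp; linarith)).norm.const_mul 2
  refine hi.mono' (((p0_cont hH0).mul (by fun_prop)).aestronglyMeasurable) (ae_of_all _ fun u => ?_)
  rw [p0, mul_assoc, ← Psi_add, norm_mul, Complex.norm_real]
  gcongr; exact hH_bd hH0 u

theorem KK_p0 (hH0 : 0 < H) {s : ℂ} (hs : -1 < s.re) : KK (p0 H l) s = ∫ r : ℝ, PH H r * FF l (1 + s + r * I) := by
  have e : ∀ u : ℝ, p0 H l u * cexp (s * u) = ∫ r : ℝ, PH H r * Psi l (1 + s + r * I) u := by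
    intro u
    rw [p0, mul_assoc, ← Psi_add, hH_rep hH0, ← integral_mul_const]
    congr 1; ext r
    rw [Psi_add l (1+s) (r*I), mul_assoc, mul_comm (cexp _)]
    congr 3; ring
  rw [KK]
  simp_rw [e]
  have hi := (Psi_int0 (l := l) (s := 1 + s) (by simp; linarith)).norm
  rw [integral_integral_swap]
  · simp_rw [integral_const_mul]; rfl
  · refine (hi.mul_prod (PH_int H).norm).mono' ?_ (ae_of_all _ fun p => ?_)
    · refine AEStronglyMeasurable.mul (f := fun p : ℝ × ℝ => PH H p.2) ?_ ?_
      · exact (PH_int H).1.comp_snd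
      · refine Continuous.aestronglyMeasurable ?_
        unfold Psi; fun_prop
    · simp only [Function.uncurry, norm_mul]
      rw [Psi_n0, Psi_n0, show (1 + s + p.2 * I).re = (1+s).re by simp]
      exact le_of_eq (mul_comm _ _)

theorem PHw_int (H θ : ℝ) (t : ℝ) : Integrable (fun r => ‖PH H r‖ * rx (-(θ * (t + r)))) := by
  refine ((PH_int H).norm.mul_const (rx (|θ| * (|t| + H)))).mono' ?_ (ae_of_all _ fun r => ?_)
  · exact (PH_int H).norm.1.mul (Continuous.aestronglyMeasurable (by fun_prop))
  · rw [Real.norm_of_nonneg (by positivity)]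
    by_cases hr : |r| ≤ H
    · gcongr
      calc -(θ*(t+r)) ≤ |θ * (t+r)| := neg_le_abs _
        _ = |θ| * |t+r| := abs_mul _ _
        _ ≤ _ := by gcongr; exact (abs_add_le _ _).trans (by linarith)
    · rw [PH_zero hr]; simp

theorem BB_nonneg (l σ θ : ℝ) : 0 ≤ BB l σ θ := integral_nonneg fun u => (Real.exp_pos _).le

theorem G_bd (hH0 : 0 < H) {s : ℂ} (hs : -1 < s.re) {θ : ℝ} (hθ : |θ| < pp/4) :
    ‖KK (p0 H l) s‖ ≤ (∫ r : ℝ, ‖PH H r‖ * rx (-(θ * (s.im + r)))) * BB l (1 + s.re) θ := by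
  rw [KK_p0 hH0 hs, ← integral_mul_const]
  refine norm_integral_le_of_norm_le ((PHw_int H θ s.im).mul_const _) (ae_of_all _ fun r => ?_)
  rw [norm_mul, mul_assoc]
  have e1 : (1 + s + r * I).re = 1 + s.re := by simp
  have e2 : (1 + s + r * I).im = s.im + r := by simp
  have := FF_bd (l := l) (s := 1 + s + r * I) (by rw [e1]; linarith) hθ
  rw [e1, e2] at this
  gcongr

theorem G_dec (hH0 : 0 < H) {σ : ℝ} (hs : -1 < σ) : ∃ C : ℝ, 0 ≤ C ∧ ∀ s : ℂ, s.re = σ → ‖KK (p0 H l) s‖ ≤ C * rx (-(1/2)*|s.im|) := by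
  have hp := pi_b.1
  set W : ℝ → ℝ := fun θ => (∫ r : ℝ, ‖PH H r‖ * rx (-(θ * (0 + r)))) * BB l (1+σ) θ with hW
  have hW0 : ∀ θ, 0 ≤ W θ := fun θ => mul_nonneg (integral_nonneg fun r => by positivity) (BB_nonneg _ _ _)
  have key : ∀ θ : ℝ, |θ| < pp/4 → ∀ s : ℂ, s.re = σ → ‖KK (p0 H l) s‖ ≤ W θ * rx (-(θ * s.im)) := by
    intro θ hθ s h
    have := G_bd (l := l) hH0 (s := s) (by rw [h]; exact hs) hθ
    rw [h] at this
    refine this.trans (le_of_eq ?_)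
    rw [hW, mul_right_comm]; congr 1
    rw [← integral_mul_const]; congr 1; ext r
    rw [mul_assoc, ← Real.exp_add]; congr 2; ring
  refine ⟨W (1/2) + W (-(1/2)), add_nonneg (hW0 _) (hW0 _), fun s h => ?_⟩
  rcases le_total 0 s.im with hi | hi
  · have := key (1/2) (by rw [abs_of_pos] <;> linarith) s h
    rw [abs_of_nonneg hi, add_mul, neg_mul]
    have h2 := mul_nonneg (hW0 (-(1/2))) (Real.exp_pos (-(1/2*s.im))).le
    linarith
  · have := key (-(1/2)) (by rw [abs_neg, abs_of_pos] <;> linarith) s h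
    rw [abs_of_nonpos hi, add_mul, neg_mul_neg]
    rw [neg_mul, neg_neg] at this
    have h2 := mul_nonneg (hW0 (1/2)) (Real.exp_pos (1/2*s.im)).le
    linarith

theorem px_e (s : ℂ) (u : ℝ) : px H l x u * cexp (s * u) = cexp (s * (lg x:ℝ)) * (p0 H l (u - lg x) * cexp (s * ((u - lg x : ℝ):ℂ))) := by
  rw [px, mul_left_comm, ← Complex.exp_add]; congr 2; push_cast; ring

theorem KK_px (s : ℂ) : KK (px H l x) s = cexp (s * (lg x:ℝ)) * KK (p0 H l) s := by
  rw [KK, KK]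
  simp_rw [px_e]
  rw [integral_const_mul, integral_sub_right_eq_self (fun u : ℝ => p0 H l u * cexp (s * u))]

theorem px_int (hH0 : 0 < H) {s : ℂ} (hs : -1 < s.re) : Integrable (fun u : ℝ => px H l x u * cexp (s * u)) := by
  simp_rw [px_e]
  exact ((p0_int hH0 hs).comp_sub_right (lg x)).const_mul _

theorem px_cont (hH0 : 0 < H) : Continuous (px H l x) := (p0_cont hH0).comp (by fun_prop)

theorem KK_refl (ψ : ℝ → ℂ) (s : ℂ) : KK (refl' ψ) s = KK ψ (1-s) := by
  rw [KK, KK, ← integral_neg_eq_self]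
  congr 1; ext u
  simp only [refl']
  rw [neg_neg, mul_assoc, ← Complex.exp_add]; congr 2; push_cast; ring

theorem px_nice (hH0 : 0 < H) : NiceR (px H l x) := by
  refine ⟨px_cont hH0, px_int hH0 (by norm_num), ?_⟩
  obtain ⟨C, h0, hC⟩ := G_dec (l := l) hH0 (σ := 3/2) (by norm_num)
  refine ⟨rx (3/2 * lg x) * C, by positivity, fun τ => ?_⟩
  rw [KK_px, norm_mul, norm_exp, mul_assoc]
  have := hC (ln τ) (ln_re τ)
  rw [ln_im] at this
  rw [re_mul_ofReal, ln_re]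
  gcongr

theorem px_nice' (hH0 : 0 < H) : NiceR (refl' (px H l x)) := by
  refine ⟨?_, ?_, ?_⟩
  · have := px_cont (l := l) (x := x) hH0
    unfold refl'; fun_prop
  · have := (px_int (l := l) (x := x) hH0 (s := -(1/2)) (by norm_num)).comp_neg
    refine this.congr (ae_of_all _ fun u => ?_)
    simp only [refl']
    rw [mul_assoc, ← Complex.exp_add]; congr 2; push_cast; ring
  obtain ⟨C, h0, hC⟩ := G_dec (l := l) hH0 (σ := -1/2) (by norm_num)
  refine ⟨rx (-1/2 * lg x) * C, by positivity, fun τ => ?_⟩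
  rw [KK_refl, KK_px, norm_mul, norm_exp, mul_assoc]
  have := hC (1 - ln τ) (ln_r2 τ)
  rw [sub_im, ln_im, one_im, zero_sub, abs_neg] at this
  rw [re_mul_ofReal, ln_r2]
  gcongr

-- elementary bounds
theorem yexp1 {y : ℝ} (hy : 0 ≤ y) : y * rx (-(y^2)/2) ≤ 1 ∧ y^2 * rx (-(y^2)/2) ≤ 1 ∧ y^3 * rx (-(y^2)/2) ≤ 2 := by
  have h := Real.quadratic_le_exp_of_nonneg (x := y^2/4) (by positivity)
  have e : rx (-(y^2)/2) = 1/(rx (y^2/4))^2 := by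
    rw [← Real.exp_nat_mul, one_div, ← Real.exp_neg]; congr 1; push_cast; ring
  have hp := Real.exp_pos (y^2/4)
  rw [e, mul_one_div, mul_one_div, mul_one_div, div_le_one (by positivity), div_le_one (by positivity), div_le_iff₀ (by positivity)]
  have h2 : (1 + y^2/4 + (y^2/4)^2/2)^2 ≤ (rx (y^2/4))^2 := by gcongr
  have h3 : y^2 ≤ (1 + y^2/4 + (y^2/4)^2/2)^2 := by
    have : y ≤ 1 + y^2/4 := by nlinarith [sq_nonneg (y-2)]
    gcongr
    nlinarith [sq_nonneg (y^2/4)]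
  have h5 : y ≤ (1 + y^2/4 + (y^2/4)^2/2)^2 := by
    have : y ≤ 1 + y^2/4 := by nlinarith [sq_nonneg (y-2)]
    nlinarith [sq_nonneg (y^2/4), sq_nonneg y]
  have h4 : y^4 ≤ 3 * (1 + y^2/4 + (y^2/4)^2/2)^2 := by
    have : y^2 ≤ (1.732) * (1 + y^2/4 + (y^2/4)^2/2) := by nlinarith [sq_nonneg (y^2 - 5)]
    calc y^4 = (y^2)^2 := by ring
      _ ≤ ((1.732) * (1 + y^2/4 + (y^2/4)^2/2))^2 := by gcongr
      _ ≤ _ := by rw [mul_pow]; gcongr; norm_num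
  refine ⟨by linarith, by linarith, ?_⟩
  nlinarith [sq_nonneg (y-1), mul_nonneg hy (sq_nonneg (y-1)), sq_nonneg (y^2-y)]

theorem BBi1 (u : ℝ) : BBi 0 1 0 u = rx u * rx (-((rx u)^2)/2) := by
  rw [BBi, ← Real.exp_add]; congr 1
  rw [show 2*u = u+u by ring, Real.exp_add]; simp; ring

theorem p0_norm (hH0 : 0 < H) (u : ℝ) : ‖p0 H l u‖ ≤ 2 * (rx u * rx (-((rx u)^2)/2)) := by
  rw [p0, norm_mul, Complex.norm_real, Psi_n0, one_re, BBi1]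
  gcongr; exact hH_bd hH0 u

theorem p0_S (hH0 : 0 < H) (u : ℝ) : ‖p0 H l u‖ ≤ 2 := by
  have := p0_norm (l := l) hH0 u
  have h2 := (yexp1 (Real.exp_pos u).le).1
  linarith

theorem p0_e (hH0 : 0 < H) (u : ℝ) : ‖p0 H l u‖ ≤ 2 * rx u := by
  refine (p0_norm (l := l) hH0 u).trans ?_
  have : rx (-((rx u)^2)/2) ≤ 1 := Real.exp_le_one_iff.2 (by have := sq_nonneg (rx u); linarith)
  have h2 := Real.exp_pos u
  nlinarith

theorem Psi_lip (l u v : ℝ) : ‖Psi l 1 u - Psi l 1 v‖ ≤ (3 + |l|) * |u - v| := by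
  have hd : ∀ w : ℝ, HasDerivAt (fun w : ℝ => Psi l 1 w) (Psi l 1 w * (1 - cexp (2*w) + I * l * cexp w)) w := by
    intro w
    have h1 : HasDerivAt (Psi l 1) (Psi l 1 w * (1 - cexp (2*w) + I * l * cexp w)) (w:ℂ) := by
      have a1 : HasDerivAt (fun w : ℂ => cexp (2*w)) (cexp (2*(w:ℂ)) * (2*1)) (w:ℂ) := ((hasDerivAt_id (w:ℂ)).const_mul 2).cexp
      have a2 := (((hasDerivAt_id (w:ℂ)).const_mul 1).sub (a1.div_const 2)).add ((Complex.hasDerivAt_exp (w:ℂ)).const_mul (I*l))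
      refine (a2.cexp).congr_deriv ?_
      simp only [Psi, id, Pi.add_apply, Pi.sub_apply]; ring
    exact h1.comp_ofReal
  have hb : ∀ w : ℝ, ‖Psi l 1 w * (1 - cexp (2*w) + I * l * cexp w)‖ ≤ 3 + |l| := by
    intro w
    rw [norm_mul, Psi_n0, one_re, BBi1]
    have n : ‖1 - cexp (2*w) + I * l * cexp w‖ ≤ 1 + (rx w)^2 + |l| * rx w := by
      refine (norm_add_le _ _).trans (add_le_add ((norm_sub_le _ _).trans (le_of_eq ?_)) (le_of_eq ?_))
      · rw [norm_one, norm_exp, ← Real.exp_nat_mul]; simp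
      · rw [norm_mul, norm_mul, norm_I, one_mul, Complex.norm_real, norm_exp]; simp
    obtain ⟨b1, b2, b3⟩ := yexp1 (Real.exp_pos w).le
    have hp := Real.exp_pos w
    set y := rx w
    set E := rx (-(y^2)/2)
    have hE : 0 < E := Real.exp_pos _
    calc y * E * ‖1 - cexp (2*w) + I * l * cexp w‖ ≤ y * E * (1 + y^2 + |l| * y) := by gcongr
      _ = y*E + y^3*E + |l| * (y^2*E) := by ring
      _ ≤ 1 + 2 + |l| * 1 := by gcongr
      _ = _ := by ring
  have := Convex.norm_image_sub_le_of_norm_hasDerivWithin_le (s := univ) (f := fun w : ℝ => Psi l 1 w) (fun w _ => (hd w).hasDerivWithinAt) (fun w _ => hb w) convex_univ (mem_univ v) (mem_univ u)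
  simpa using this

theorem p0_lip (hH0 : 0 < H) (u v : ℝ) : ‖p0 H l u - p0 H l v‖ ≤ (2*H + 6 + 2*|l|) * |u - v| := by
  have e : p0 H l u - p0 H l v = ((hH H (rx u) - hH H (rx v) : ℝ):ℂ) * Psi l 1 u + (hH H (rx v) : ℂ) * (Psi l 1 u - Psi l 1 v) := by
    rw [p0, p0]; push_cast; ring
  rw [e]
  refine (norm_add_le _ _).trans ?_
  rw [norm_mul, norm_mul, Complex.norm_real, Complex.norm_real, Psi_n0, one_re, BBi1]
  have b1 := (yexp1 (Real.exp_pos u).le).1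
  calc _ ≤ (2*H*|u-v|) * 1 + 2 * ((3+|l|) * |u-v|) := by
        gcongr
        · exact hH_lip hH0 u v
        · exact hH_bd hH0 v
        · exact Psi_lip l u v
    _ = _ := by ring

theorem gauss_int : Integrable (fun u : ℝ => BBi 0 1 0 u) ∧ ∫ u : ℝ, BBi 0 1 0 u ≤ 1.26 := by
  have h1 : Integrable (fun u : ℝ => BBi 0 1 0 u) := BB_int (by norm_num) (by simp; positivity)
  refine ⟨h1, ?_⟩
  simp_rw [BBi1]
  have := integral_exp_sub (fun y : ℝ => rx (-(y^2)/2))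
  simp only [smul_eq_mul] at this
  rw [← this]
  have g := integral_gaussian_Ioi (1/2)
  rw [show (fun y : ℝ => rx (-(y^2)/2)) = fun y => rx (-(1/2) * y^2) by ext y; congr 1; ring, g]
  have : √(pp/(1/2)) ≤ 2.52 := by
    rw [Real.sqrt_le_left (by norm_num)]; nlinarith [pi_b.2]
  linarith

theorem px_D (hH0 : 0 < H) : Integrable (fun u => ‖px H l x u‖) ∧ ∫ u, ‖px H l x u‖ ≤ 3 := by
  have hb : ∀ u, ‖px H l x u‖ ≤ 2 * BBi 0 1 0 (u - lg x) := fun u => by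
    rw [BBi1]; exact p0_norm hH0 _
  have hi := (gauss_int.1.comp_sub_right (lg x)).const_mul 2
  have h1 : Integrable (fun u => ‖px H l x u‖) := hi.mono' (px_cont hH0).norm.aestronglyMeasurable (ae_of_all _ fun u => by
    rw [norm_norm]; exact hb u)
  refine ⟨h1, (integral_mono h1 hi hb).trans ?_⟩
  rw [integral_const_mul, integral_sub_right_eq_self (fun u => BBi 0 1 0 u)]
  linarith [gauss_int.2]

end PS

section AP
open Filter Topology Complex

variable {H l x : ℝ} {q : ℕ} [NeZero q] {χ : DirichletCharacter ℂ q}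

theorem dampen {A B : ℂ} {c v : ℝ} (hc : 0 ≤ c) (hv : 0 ≤ v) (hB : ‖B‖ ≤ 2) :
    ‖A - cexp (-((c:ℂ)*v)) * B‖ ≤ ‖A - B‖ + 2 * (c * v) := by
  have e : A - cexp (-((c:ℂ)*v)) * B = (A - B) + ((1 - rx (-(c*v)) : ℝ) : ℂ) * B := by push_cast; ring
  rw [e]
  refine (norm_add_le _ _).trans ?_
  rw [norm_mul, Complex.norm_real]
  have h1 : rx (-(c*v)) ≤ 1 := Real.exp_le_one_iff.2 (by nlinarith [mul_nonneg hc hv])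
  have h2 := Real.one_sub_le_exp_neg (c*v)
  rw [Real.norm_of_nonneg (by linarith)]
  have : (1 - rx (-(c*v))) * ‖B‖ ≤ (c*v) * 2 := by gcongr; linarith
  linarith

theorem EFapp (hχ : χ.IsPrimitive) (hH0 : 50 ≤ H) (hx : 1000 ≤ x) {T : ℝ} (hT : H + 5 + |l| ≤ T) :
    ∃ R Zs : ℂ, HasSum (fun ρ => (mlt (xi χ) ρ : ℂ) * (cexp (ρ * (lg x:ℝ)) * KK (p0 H l) ρ)) Zs ∧
      ∑' n : ℕ, tw χ n * px H l x (lg n) = (if q = 1 then KK (px H l x) 1 else 0) - Zs + R ∧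
      ‖R‖ ≤ (6 + 2 * lg q) / x + 9 + 6 * √T := by
  have h0 : 0 < H := by linarith
  have hx0 : 0 < x := by linarith
  have ha0 : (0:ℝ) ≤ par χ := Nat.cast_nonneg _
  have ha1 : (par χ:ℝ) ≤ 1 := by exact_mod_cast par_le χ
  have hS : ∀ v, ‖px H l x v‖ ≤ 2 := fun v => p0_S h0 _
  have hL : ∀ u v, ‖px H l x u - px H l x v‖ ≤ (2*H+6+2*|l|) * |u - v| := fun u v => by
    have := p0_lip (l := l) h0 (u - lg x) (v - lg x)
    rwa [sub_sub_sub_cancel_right] at this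
  have hE : ∀ v, ‖px H l x v‖ ≤ 2 * rx v / x := fun v => by
    have := p0_e (l := l) h0 (v - lg x)
    rwa [Real.exp_sub, Real.exp_log hx0, ← mul_div_assoc] at this
  have nr : ∀ v : ℝ, ‖refl' (px H l x) v‖ = ‖px H l x (-v)‖ * rx (-v) := fun v => by
    rw [refl', norm_mul, norm_exp]; simp
  have nr1 : ∀ v : ℝ, 0 ≤ v → ‖refl' (px H l x) v‖ ≤ ‖px H l x (-v)‖ := fun v hv => by
    rw [nr]; exact mul_le_of_le_one_right (norm_nonneg _) (Real.exp_le_one_iff.2 (by linarith))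
  obtain ⟨di, dv⟩ := px_D (l := l) (x := x) h0
  have di2 := di.comp_neg
  obtain ⟨R, Zs, z1, z2, z3⟩ := EFmain hχ (px_nice (l := l) (x := x) h0) (px_nice' h0) (S := 2) (M := 2*H+10+2*|l|) (D := 3) (B := 2/x)
    (fun v _ => hS v) (fun v hv => (nr1 v hv).trans (hS _))
    (fun v hv => by
      have d := dampen (A := px H l x 0) (B := px H l x v) ha0 hv (hS v)
      rw [ofReal_natCast] at d
      have := hL 0 v
      rw [zero_sub, abs_neg, abs_of_nonneg hv] at this
      nlinarith)
    (fun v hv => by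
      have d := dampen (A := px H l x 0) (B := px H l x (-v)) (c := par χ + 1) (by linarith) hv (hS _)
      have e : cexp (-((par χ : ℂ)*v)) * refl' (px H l x) v = cexp (-(((par χ + 1 : ℝ):ℂ)*v)) * px H l x (-v) := by
        rw [refl', mul_left_comm, ← Complex.exp_add, mul_comm]; congr 2; push_cast; ring
      rw [e]
      have := hL 0 (-v)
      rw [zero_sub, neg_neg, abs_of_nonneg hv] at this
      nlinarith)
    di.integrableOn ((setIntegral_le_integral di (ae_of_all _ fun _ => norm_nonneg _)).trans dv)
    (by
      refine di2.integrableOn.mono' (px_nice' h0).cont.norm.aestronglyMeasurable ?_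
      refine (ae_restrict_iff' measurableSet_Ioi).2 (ae_of_all _ fun v hv => ?_)
      rw [norm_norm]; exact nr1 v (le_of_lt hv))
    (by
      have i1 : IntegrableOn (fun v => ‖refl' (px H l x) v‖) (Ioi 0) := by
        refine di2.integrableOn.mono' (px_nice' h0).cont.norm.aestronglyMeasurable ?_
        refine (ae_restrict_iff' measurableSet_Ioi).2 (ae_of_all _ fun v hv => ?_)
        rw [norm_norm]; exact nr1 v (le_of_lt hv)
      refine (setIntegral_mono_on i1 di2.integrableOn measurableSet_Ioi fun v hv => nr1 v (le_of_lt hv)).trans ?_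
      refine (setIntegral_le_integral di2 (ae_of_all _ fun _ => norm_nonneg _)).trans ?_
      rw [integral_neg_eq_self (fun v => ‖px H l x v‖)]; exact dv)
    (fun n hn => by
      have hn0 : (0:ℝ) < n := by exact_mod_cast hn
      rw [nr]
      have := hE (-lg n)
      rw [Real.exp_neg, Real.exp_log hn0] at this ⊢
      calc _ ≤ 2 * (n:ℝ)⁻¹ / x * (n:ℝ)⁻¹ := by gcongr
        _ = _ := by field_simp)
  have hl : 0 ≤ lg q := Real.log_natCast_nonneg q
  have hsq : √(2 * (2*H+10+2*|l|)/4) ≤ √T := Real.sqrt_le_sqrt (by linarith)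
  have h00 : ‖px H l x 0‖ ≤ 2/x := by simpa using hE 0
  have b1 : (2 + lg q) * ‖px H l x 0‖ ≤ (2 + lg q) * (2/x) := by gcongr
  have e1 : (2 + lg q) * (2/x) + 2/x = (6 + 2 * lg q) / x := by ring
  simp_rw [KK_px] at z1
  refine ⟨R + (if q = 1 then KK (px H l x) 0 else 0), Zs, z1, ?_, ?_⟩
  · rw [z2]; split_ifs <;> ring
  · have hk : ‖(if q = 1 then KK (px H l x) 0 else 0)‖ ≤ 3 := by
      split_ifs
      · rw [KK]
        simp only [zero_mul, Complex.exp_zero, mul_one]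
        exact (norm_integral_le_integral_norm _).trans dv
      · simp
    refine (norm_add_le _ _).trans ?_
    linarith

end AP

section LZ
open Filter Topology Complex FourierTransform

variable {H l x : ℝ} {q : ℕ} [NeZero q] {χ : DirichletCharacter ℂ q}

theorem abs_le_sinh (v : ℝ) : |v| ≤ |Real.sinh v| := by
  rw [Real.abs_sinh]; exact Real.self_le_sinh_iff.2 (abs_nonneg v)

theorem usq_le (u : ℝ) : u^2 * rx u ≤ (rx u - 1)^2 := by
  have h := sq_le_sq.2 (abs_le_sinh (u/2))
  have e1 : Real.sinh (u/2) = (rx (u/2) - rx (-(u/2)))/2 := Real.sinh_eq _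
  have e2 : rx (u/2) * rx (-(u/2)) = 1 := by rw [← Real.exp_add]; simp
  have e3 : rx u = rx (u/2)^2 := by rw [← Real.exp_nat_mul]; congr 1; push_cast; ring
  rw [e1] at h
  set a := rx (u/2)
  set b := rx (-(u/2))
  have ha : 0 < a := Real.exp_pos _
  rw [e3]
  have : (a^2-1)^2 = (a-b)^2 * a^2 := by
    rw [← mul_pow]; congr 1; rw [sub_mul, mul_comm b, e2]; ring
  rw [this]
  refine mlr ?_ (sq_nonneg a)
  nlinarith

theorem uabs_le (u : ℝ) : |u| ≤ rx (u/2) + rx (-u/2) := by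
  have h := abs_le_sinh (u/2)
  rw [Real.sinh_eq, abs_div, abs_div, abs_of_pos (by norm_num : (0:ℝ)<2), neg_div'] at h
  have h1 := Real.exp_pos (u/2)
  have h2 := Real.exp_pos (-u/2)
  have := abs_sub (rx (u/2)) (rx (-u/2))
  have h3 : |rx (u/2) - rx (-u/2)| ≤ rx (u/2) + rx (-u/2) := by
    rw [abs_le]; constructor <;> linarith
  linarith

theorem t3_le (u : ℝ) : rx (3*u - rx (2*u)) ≤ 0.41 := by
  set v := rx (2*u)
  have hv : 0 < v := Real.exp_pos _
  have h1 : 2*v/3 ≤ rx (2*v/3 - 1) := by have := Real.add_one_le_exp (2*v/3-1); linarith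
  have h2 : (2*v/3)^3 ≤ rx (2*v - 3) := by
    calc (2*v/3)^3 ≤ rx (2*v/3-1)^3 := by gcongr
      _ = _ := by rw [← Real.exp_nat_mul]; congr 1; push_cast; ring
  have e : rx (3*u - v)^2 = v^3 * rx (-(2*v)) := by
    rw [← Real.exp_nat_mul, ← Real.exp_nat_mul, ← Real.exp_add]; congr 1; push_cast; ring
  have e2 : rx (2*v-3) = rx (2*v) * rx (-3) := by rw [← Real.exp_add]; congr 1
  have e3 : rx (2*v) * rx (-(2*v)) = 1 := by rw [← Real.exp_add]; simp
  have e4 : rx (-3) ≤ 0.0498 := by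
    have : rx (-3) = (rx 1)⁻¹^3 := by rw [← Real.exp_neg, ← Real.exp_nat_mul]; norm_num
    rw [this]
    have h := Real.exp_one_gt_d9
    have h' : (rx 1)⁻¹ ≤ 0.36788 := by
      rw [inv_le_comm₀ (by positivity) (by norm_num)]; norm_num; linarith
    calc (rx 1)⁻¹^3 ≤ 0.36788^3 := by gcongr
      _ ≤ _ := by norm_num
  refine (sq_le_sq₀ (Real.exp_pos _).le (by norm_num)).1 ?_
  rw [e]
  have hp := Real.exp_pos (-(2*v))
  have : (2*v/3)^3 * rx (-(2*v)) ≤ 0.0498 := by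
    calc _ ≤ rx (2*v-3) * rx (-(2*v)) := by gcongr
      _ = rx (-3) := by rw [e2, mul_right_comm, e3, one_mul]
      _ ≤ _ := e4
  nlinarith

theorem t3u_le (u : ℝ) : u^2 * rx (3*u - rx (2*u)) ≤ 0.1369 := by
  set t := rx u with ht
  have ht0 : 0 < t := Real.exp_pos _
  have e1 : rx (2*u) = t^2 := by rw [ht, ← Real.exp_nat_mul]; norm_num
  have e2 : rx (3*u - rx (2*u)) = t * (t * rx (-(t^2)/2))^2 := by
    rw [mul_pow, ← Real.exp_nat_mul, e1, ht, ← Real.exp_nat_mul, ← Real.exp_nat_mul, ← Real.exp_add, ← Real.exp_add]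
    congr 1; push_cast; ring
  rw [e2, ← mul_assoc]
  have h1 := usq_le u
  have hE : |t-1| * (t * rx (-(t^2)/2)) ≤ 0.37 := by
    have hx := Real.sum_le_exp_of_nonneg (x := t^2/2) (by positivity) 4
    simp [Finset.sum_range_succ, Nat.factorial] at hx
    have e5 : rx (-(t^2)/2) * rx (t^2/2) = 1 := by rw [← Real.exp_add]; ring_nf; simp
    set E := rx (-(t^2)/2)
    have hE : 0 < E := Real.exp_pos _
    have key : |t-1| * t ≤ 0.37 * rx (t^2/2) := by
      refine le_trans ?_ (mll hx (by norm_num))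
      rcases abs_cases (t-1) with ⟨h, _⟩ | ⟨h, _⟩ <;> rw [h]
      · nlinarith [sq_nonneg (t^2-3.2), sq_nonneg (t-1.8), mul_nonneg (sq_nonneg (t^2-3.2)) (sq_nonneg t), sq_nonneg (t^3-5.8)]
      · nlinarith [sq_nonneg (t-1/2), sq_nonneg (t^2), sq_nonneg (t^3)]
    calc |t-1| * (t*E) = (|t-1| * t) * E := by ring
      _ ≤ (0.37 * rx (t^2/2)) * E := by gcongr
      _ = 0.37 * (E * rx (t^2/2)) := by ring
      _ = 0.37 := by rw [e5, mul_one]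
  calc u^2 * t * (t * rx (-(t^2)/2))^2 ≤ (t-1)^2 * (t * rx (-(t^2)/2))^2 := by gcongr
    _ = (|t-1| * (t * rx (-(t^2)/2)))^2 := by rw [mul_pow |t-1|, sq_abs]
    _ ≤ 0.37^2 := by gcongr
    _ = _ := by norm_num

theorem cs_int {g : ℝ → ℝ} {B Y : ℝ} (hB : 0 < B) (hY : 0 < Y) (hg : Continuous g) (hi : Integrable (fun t => g t^2))
    (hb : ∫ t, g t^2 ≤ B^2) : ∫ t in (-Y)..Y, g t ≤ √(2*Y) * B := by
  set s := √(2*Y) with hs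
  have hs0 : 0 < s := Real.sqrt_pos.2 (by linarith)
  have hs2 : s^2 = 2*Y := Real.sq_sqrt (by linarith)
  have h1 : ∀ t, g t ≤ s/(2*B) * g t^2 + B/(2*s) := by
    intro t
    have : s/(2*B) * g t^2 + B/(2*s) - g t = (s * g t - B)^2 / (2*B*s) := by field_simp; ring
    have h2 : 0 ≤ (s * g t - B)^2 / (2*B*s) := by positivity
    linarith
  have h2 : ∫ t in (-Y)..Y, g t ≤ ∫ t in (-Y)..Y, (s/(2*B) * g t^2 + B/(2*s)) :=
    intervalIntegral.integral_mono_on (by linarith) (hg.intervalIntegrable _ _)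
      (Continuous.intervalIntegrable (by fun_prop) _ _) (fun t _ => h1 t)
  rw [intervalIntegral.integral_add (Continuous.intervalIntegrable (by fun_prop) _ _) (by simp),
    intervalIntegral.integral_const_mul, intervalIntegral.integral_const, intervalIntegral.integral_of_le (by linarith : -Y ≤ Y) (f := fun t => g t^2)] at h2
  have h3 : ∫ t in Ioc (-Y) Y, g t^2 ≤ B^2 := (setIntegral_le_integral hi (ae_of_all _ fun t => sq_nonneg _)).trans hb
  have h4 : s/(2*B) * ∫ t in Ioc (-Y) Y, g t^2 ≤ s/(2*B) * B^2 := by gcongr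
  refine h2.trans ((add_le_add_left h4 _).trans (le_of_eq ?_))
  rw [smul_eq_mul, sub_neg_eq_add, show Y + Y = s^2 by rw [hs2]; ring]
  field_simp; ring

theorem loc_half {g g' : ℝ → ℂ} (hg : ∀ t, HasDerivAt g (g' t) t) (hc : Continuous g') (γ ε : ℝ) (hε : |ε| = 1) :
    ‖g γ‖ / 2 ≤ ∫ y in (0:ℝ)..3, ((1/3)*(1-y/3) * ‖g (γ + ε*y)‖ + (1/2)*(1-y/3)^2 * ‖g' (γ+ε*y)‖) := by
  have hgc : Continuous g := continuous_iff_continuousAt.2 fun t => (hg t).continuousAt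
  set F' : ℝ → ℂ := fun y => ((1/2*(1-y/3)^2 : ℝ):ℂ) * (ε * g' (γ+ε*y)) - ((1/3*(1-y/3):ℝ):ℂ) * g (γ+ε*y) with hF'
  have hd : ∀ y ∈ uIcc (0:ℝ) 3, HasDerivAt (fun y : ℝ => ((1/2*(1-y/3)^2 : ℝ):ℂ) * g (γ+ε*y)) (F' y) y := by
    intro y _
    have a1 : HasDerivAt (fun y : ℝ => 1/2*(1-y/3)^2) (-(1/3*(1-y/3))) y := by
      have := ((((hasDerivAt_id y).div_const 3).const_sub 1).pow 2).const_mul (1/2)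
      refine this.congr_deriv ?_
      simp; ring
    have a2 : HasDerivAt (fun y : ℝ => γ + ε*y) ε y := by
      simpa using ((hasDerivAt_id y).const_mul ε).const_add γ
    have a3 := (hg (γ+ε*y)).scomp y a2
    have := a1.ofReal_comp.mul a3
    refine this.congr_deriv ?_
    simp only [hF', Function.comp, real_smul]; push_cast; ring
  have hcF : Continuous F' := by
    rw [hF']; fun_prop
  have h := intervalIntegral.integral_eq_sub_of_hasDerivAt hd (hcF.intervalIntegrable _ _)
  have e : ‖g γ‖/2 = ‖∫ y in (0:ℝ)..3, F' y‖ := by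
    rw [h]; norm_num; ring
  rw [e]
  refine intervalIntegral.norm_integral_le_of_norm_le (by norm_num) (ae_of_all _ fun y hy => ?_) (Continuous.intervalIntegrable (by fun_prop) _ _)
  have hy0 : 0 ≤ 1 - y/3 := by linarith [hy.2]
  rw [hF']
  refine (norm_sub_le _ _).trans ?_
  rw [norm_mul, norm_mul, norm_mul, Complex.norm_real, Complex.norm_real, Complex.norm_real, Real.norm_eq_abs ε, hε,
    Real.norm_of_nonneg (by positivity), Real.norm_of_nonneg (by positivity)]
  linarith

theorem loc_bd {g g' : ℝ → ℂ} (hg : ∀ t, HasDerivAt g (g' t) t) (hc : Continuous g') {ρ : ℂ} (hρ : ρ.re = 1/2) :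
    ‖g ρ.im‖ ≤ ∫ t in (ρ.im-3)..(ρ.im+3), Pk ρ t * (‖g t‖/4 + 3*‖g' t‖/8) := by
  have hgc : Continuous g := continuous_iff_continuousAt.2 fun t => (hg t).continuousAt
  set γ := ρ.im
  have hP : ∀ t, Pk ρ t = 3/(9/4+(t-γ)^2) := by
    intro t; rw [Pk, hρ]; norm_num; rw [← add_div]; norm_num; rfl
  have hcP : Continuous (Pk ρ) := by
    rw [show Pk ρ = fun t => 3/(9/4+(t-γ)^2) from funext hP]
    exact Continuous.div (by fun_prop) (by fun_prop) (fun t => by positivity)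
  set Q : ℝ → ℝ := fun t => Pk ρ t * (‖g t‖/4 + 3*‖g' t‖/8) with hQ
  have hcQ : Continuous Q := by rw [hQ]; fun_prop
  have key : ∀ ε : ℝ, |ε| = 1 → ‖g γ‖/2 ≤ ∫ y in (0:ℝ)..3, Q (γ+ε*y) := by
    intro ε hε
    refine (loc_half hg hc γ ε hε).trans ?_
    refine intervalIntegral.integral_mono_on (by norm_num) (Continuous.intervalIntegrable (by fun_prop) _ _)
      (Continuous.intervalIntegrable (by fun_prop) _ _) (fun y hy => ?_)
    have hε2 : ε^2 = 1 := by rw [← sq_abs, hε]; norm_num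
    have hPy : Pk ρ (γ+ε*y) = 3/(9/4+y^2) := by rw [hP]; congr 2; rw [add_sub_cancel_left, mul_pow, hε2, one_mul]
    have h0 : 0 ≤ 1 - y/3 := by linarith [hy.2]
    have hy0 := hy.1
    have k1 : (1/3)*(1-y/3) ≤ Pk ρ (γ+ε*y) / 4 := by
      rw [hPy, div_div, le_div_iff₀ (by positivity)]
      nlinarith [mul_nonneg hy0 (sq_nonneg (y-3/2))]
    have k2 : (1/2)*(1-y/3)^2 ≤ Pk ρ (γ+ε*y) * (3/8) := by
      nlinarith
    rw [hQ]; simp only []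
    calc _ ≤ Pk ρ (γ+ε*y) / 4 * ‖g (γ+ε*y)‖ + Pk ρ (γ+ε*y) * (3/8) * ‖g' (γ+ε*y)‖ := by gcongr
      _ = _ := by ring
  have p := key 1 (by simp)
  have m := key (-1) (by simp)
  have e1 : ∫ y in (0:ℝ)..3, Q (γ+1*y) = ∫ t in γ..(γ+3), Q t := by
    simp only [one_mul]; rw [intervalIntegral.integral_comp_add_left]; simp
  have e2 : ∫ y in (0:ℝ)..3, Q (γ+(-1)*y) = ∫ t in (γ-3)..γ, Q t := by
    simp only [neg_one_mul, ← sub_eq_add_neg]; rw [intervalIntegral.integral_comp_sub_left]; simp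
  rw [e1] at p
  rw [e2] at m
  have := intervalIntegral.integral_add_adjacent_intervals (hcQ.intervalIntegrable (μ := volume) (γ-3) γ) (hcQ.intervalIntegrable γ (γ+3))
  linarith

end LZ

section LZb
open Filter Topology Complex FourierTransform

variable {H l x : ℝ} {q : ℕ} [NeZero q] {χ : DirichletCharacter ℂ q}

noncomputable def Pf (H l u : ℝ) : ℂ := p0 H l u * cexp (((1/2:ℝ):ℂ) * u)
noncomputable def gl (H l τ : ℝ) : ℂ := KK (p0 H l) (((1/2:ℝ):ℂ) + τ * I)
noncomputable def gd (H l τ : ℝ) : ℂ := 𝓕 (fun u : ℝ => (I * u) * Pf H l u) ((-τ)/(2*pp))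

theorem gl_eq (τ : ℝ) : gl H l τ = 𝓕 (Pf H l) ((-τ)/(2*pp)) := by
  rw [fou_eq, gl, KK]; congr 1; ext u
  rw [Pf, mul_comm (cexp _), mul_assoc, ← Complex.exp_add]; congr 2; push_cast; ring

theorem Pf_norm (u : ℝ) : ‖Pf H l u‖ = |hH H (rx u)| * BBi 0 (3/2) 0 u := by
  rw [Pf, p0, mul_assoc, ← Psi_add, norm_mul, Complex.norm_real, Psi_n0, add_re, one_re, ofReal_re, Real.norm_eq_abs]
  norm_num

theorem BBi32 (u : ℝ) : BBi 0 (3/2) 0 u ^2 = rx (3*u - rx (2*u)) := by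
  rw [BBi, ← Real.exp_nat_mul]; congr 1; simp; ring

theorem Pf_cont (hH0 : 0 < H) : Continuous (Pf H l) := by
  have := p0_cont (l := l) hH0
  unfold Pf; fun_prop

theorem Pf_int (hH0 : 0 < H) : Integrable (Pf H l) := p0_int hH0 (by norm_num)

theorem uPf_int (hH0 : 0 < H) : Integrable (fun u : ℝ => (I * u) * Pf H l u) := by
  have i1 : Integrable (BBi 0 2 0) := BB_int (by norm_num) (by simp; positivity)
  have i2 : Integrable (BBi 0 1 0) := BB_int (by norm_num) (by simp; positivity)
  refine ((i1.add i2).const_mul 2).mono' ?_ (ae_of_all _ fun u => ?_)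
  · have := Pf_cont (l := l) hH0
    exact Continuous.aestronglyMeasurable (by fun_prop)
  · rw [norm_mul, norm_mul, norm_I, one_mul, Complex.norm_real, Real.norm_eq_abs, Pf_norm]
    have h1 := uabs_le u
    have h2 := hH_bd hH0 u
    have e1 : BBi 0 2 0 u = rx (u/2) * BBi 0 (3/2) 0 u := by
      rw [BBi, BBi, ← Real.exp_add]; congr 1; ring
    have e2 : BBi 0 1 0 u = rx (-u/2) * BBi 0 (3/2) 0 u := by
      rw [BBi, BBi, ← Real.exp_add]; congr 1; ring
    rw [Pi.add_apply, e1, e2]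
    have h3 : 0 < BBi 0 (3/2) 0 u := Real.exp_pos _
    calc _ ≤ (rx (u/2) + rx (-u/2)) * (2 * BBi 0 (3/2) 0 u) := by gcongr
      _ = _ := by ring

theorem gl_deriv (hH0 : 0 < H) (τ : ℝ) : HasDerivAt (gl H l) (gd H l τ) τ := by
  have hi := Pf_int (l := l) hH0
  have hi2 : Integrable (fun u : ℝ => u • Pf H l u) := by
    refine ((uPf_int (l := l) hH0).const_mul (-I)).congr (ae_of_all _ fun u => ?_)
    simp only [real_smul]
    calc _ = -(I*I) * (u * Pf H l u) := by ring
      _ = _ := by rw [I_mul_I]; ring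
  have h1 := Real.hasDerivAt_fourier hi hi2 ((-τ)/(2*pp))
  have h2 : HasDerivAt (fun τ : ℝ => (-τ)/(2*pp)) (-1/(2*pp)) τ := ((hasDerivAt_id τ).neg).div_const _
  have h3 := h1.scomp τ h2
  have e : gl H l = 𝓕 (Pf H l) ∘ (fun τ : ℝ => (-τ)/(2*pp)) := funext gl_eq
  rw [e]
  refine h3.congr_deriv ?_
  rw [gd, fou_eq, fou_eq, ← integral_smul]
  congr 1; ext u
  rw [real_smul, smul_eq_mul]; push_cast
  have : (pp:ℂ) ≠ 0 := by exact_mod_cast Real.pi_ne_zero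
  field_simp

theorem fcont {f : ℝ → ℂ} (hf : Integrable f) : Continuous (𝓕 f) :=
  VectorFourier.fourierIntegral_continuous Real.continuous_fourierChar (by fun_prop) hf

theorem gd_cont (hH0 : 0 < H) : Continuous (gd H l) := by
  unfold gd
  exact (fcont (uPf_int hH0)).comp (by fun_prop)

theorem sq_gen {f : ℝ → ℂ} (h1 : Integrable f) {A B : ℝ} (hH0 : 0 < H) (hA : 0 ≤ A)
    (hb : ∀ u, ‖f u‖^2 ≤ A * hH H (rx u)^2) (hB : 2*pp*(A*2.2575) ≤ B^2) :
    Integrable (fun τ => ‖𝓕 f ((-τ)/(2*pp))‖^2) ∧ ∫ τ, ‖𝓕 f ((-τ)/(2*pp))‖^2 ≤ B^2 := by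
  have hl := hH_l2 hH0
  have h2 : Integrable (fun u => ‖f u‖^2) := (hl.1.const_mul A).mono' (h1.1.norm.pow 2) (ae_of_all _ fun u => by
    rw [Real.norm_of_nonneg (by positivity)]; exact hb u)
  have hp := plancherel f h1 h2
  have hsc := scale_int _ hp.1
  have e : ∀ τ : ℝ, ‖𝓕 f ((-τ)/(2*pp))‖^2 = (fun r => ‖𝓕 f (r/(2*pp))‖^2) (-τ) := fun _ => rfl
  refine ⟨hsc.1.comp_neg, ?_⟩
  rw [show (fun τ => ‖𝓕 f ((-τ)/(2*pp))‖^2) = fun τ => (fun r => ‖𝓕 f (r/(2*pp))‖^2) (-τ) from funext e]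
  rw [integral_neg_eq_self (fun r => ‖𝓕 f (r/(2*pp))‖^2), hsc.2, hp.2]
  refine le_trans ?_ hB
  have := Real.pi_pos
  gcongr
  refine (integral_mono h2 (hl.1.const_mul A) hb).trans ?_
  rw [integral_const_mul]; gcongr; exact hl.2

theorem gl_sq (hH0 : 0 < H) : Integrable (fun τ => ‖gl H l τ‖^2) ∧ ∫ τ, ‖gl H l τ‖^2 ≤ 2.412^2 := by
  simp_rw [gl_eq]
  refine sq_gen (Pf_int hH0) (A := 0.41) hH0 (by norm_num) (fun u => ?_) (by have := pi_b; nlinarith)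
  rw [Pf_norm, mul_pow, sq_abs, BBi32, mul_comm]
  gcongr; exact t3_le u

theorem gd_sq (hH0 : 0 < H) : Integrable (fun τ => ‖gd H l τ‖^2) ∧ ∫ τ, ‖gd H l τ‖^2 ≤ 1.394^2 := by
  unfold gd
  refine sq_gen (uPf_int hH0) (A := 0.1369) hH0 (by norm_num) (fun u => ?_) (by have := pi_b; nlinarith)
  rw [norm_mul, norm_mul, norm_I, one_mul, Complex.norm_real, Real.norm_eq_abs, Pf_norm, mul_pow, mul_pow, sq_abs, sq_abs, BBi32,
    mul_comm (hH _ _ ^2), ← mul_assoc]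
  gcongr; exact t3u_le u

theorem low_bd (hχ : χ.IsPrimitive) (hH0 : 0 < H) {T : ℝ} (hT : 100 ≤ T) (S : Finset ℂ)
    (hS : ∀ ρ ∈ S, ρ.re = 1/2 ∧ |ρ.im| ≤ T) :
    ∑ ρ ∈ S, (mlt (xi χ) ρ : ℝ) * ‖KK (p0 H l) ρ‖ ≤ 1.593 * √(T+3) * (lg (q*(T+3)/(2*pp)) + 5.025) := by
  set Y := T + 3 with hY
  set N := lg (q*Y/(2*pp)) + 5.025 with hN
  set Q : ℝ → ℝ := fun t => ‖gl H l t‖/4 + 3*‖gd H l t‖/8 with hQ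
  have hglc : Continuous (gl H l) := continuous_iff_continuousAt.2 fun t => (gl_deriv hH0 t).continuousAt
  have hgdc : Continuous (gd H l) := gd_cont hH0
  have hQc : Continuous Q := by rw [hQ]; fun_prop
  have hQ0 : ∀ t, 0 ≤ Q t := fun t => by rw [hQ]; positivity
  have hPc : ∀ ρ ∈ S, Continuous (Pk ρ) := by
    intro ρ hρ
    unfold Pk
    rw [(hS ρ hρ).1]
    refine Continuous.add ?_ ?_ <;> exact Continuous.div (by fun_prop) (by fun_prop) (fun t => by positivity)
  have hN0 : 0 ≤ N := by
    have h := dens hχ (t := 50) (Y := Y) (by linarith) (by rw [abs_of_pos (by norm_num)]; linarith)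
    have h0 : 0 ≤ ∑' ρ, (mlt (xi χ) ρ : ℝ) * Pk ρ 50 := tsum_nonneg fun ρ => by
      by_cases hm : mlt (xi χ) ρ = 0
      · simp [hm]
      · have := mlt_strip hχ hm
        exact mul_nonneg (Nat.cast_nonneg _) (Pk_nonneg this.1 this.2.1 _)
    have : polet 50 ≤ 1.5 := by rw [polet]; norm_num
    rw [hN]; linarith [h.2]
  have h1 : ∀ ρ ∈ S, (mlt (xi χ) ρ : ℝ) * ‖KK (p0 H l) ρ‖ ≤ ∫ t in (-Y)..Y, (mlt (xi χ) ρ : ℝ) * Pk ρ t * Q t := by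
    intro ρ hρ
    obtain ⟨hre, him⟩ := hS ρ hρ
    have e : ‖KK (p0 H l) ρ‖ = ‖gl H l ρ.im‖ := by
      rw [gl, ← hre, re_add_im]
    rw [e]
    have hb := loc_bd (gl_deriv (l := l) hH0) hgdc hre
    simp_rw [mul_assoc, intervalIntegral.integral_const_mul]
    refine mll (hb.trans ?_) (Nat.cast_nonneg _)
    have ha := abs_le.1 him
    refine intervalIntegral.integral_mono_interval (by linarith) (by linarith) (by linarith) (ae_of_all _ fun t => ?_) ?_
    · exact mul_nonneg (Pk_nonneg (by rw [hre]; norm_num) (by rw [hre]; norm_num) t) (hQ0 t)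
    · exact ((hPc ρ hρ).mul hQc).intervalIntegrable _ _
  refine (Finset.sum_le_sum h1).trans ?_
  rw [← intervalIntegral.integral_finsetSum (f := fun ρ t => (mlt (xi χ) ρ : ℝ) * Pk ρ t * Q t) (fun ρ hρ => ((continuous_const.mul (hPc ρ hρ)).mul hQc).intervalIntegrable _ _)]
  have h2 : ∫ t in (-Y)..Y, ∑ ρ ∈ S, (mlt (xi χ) ρ : ℝ) * Pk ρ t * Q t ≤ ∫ t in (-Y)..Y, N * Q t := by
    refine intervalIntegral.integral_mono_on (by linarith) ?_ ((continuous_const.mul hQc).intervalIntegrable _ _) (fun t ht => ?_)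
    · exact Continuous.intervalIntegrable (continuous_finset_sum _ fun ρ hρ => (continuous_const.mul (hPc ρ hρ)).mul hQc) _ _
    · rw [← Finset.sum_mul]
      refine mlr ?_ (hQ0 t)
      have h := dens hχ (t := t) (Y := Y) (by linarith) (abs_le.2 ht)
      have h0 : polet t ≤ 1.5 := by
        rw [polet]
        have a1 : 2/(4+t^2) ≤ 2/4 := by gcongr; nlinarith [sq_nonneg t]
        have a2 : 1/(1+t^2) ≤ 1/1 := by gcongr; nlinarith [sq_nonneg t]
        linarith
      refine (h.1.sum_le_tsum S fun ρ _ => ?_).trans (by rw [hN]; linarith [h.2])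
      by_cases hm : mlt (xi χ) ρ = 0
      · simp [hm]
      · have := mlt_strip hχ hm
        exact mul_nonneg (Nat.cast_nonneg _) (Pk_nonneg this.1 this.2.1 _)
  refine h2.trans ?_
  rw [intervalIntegral.integral_const_mul]
  have c1 := cs_int (Y := Y) (by norm_num) (by linarith) hglc.norm (gl_sq (l := l) hH0).1 (gl_sq hH0).2
  have c2 := cs_int (Y := Y) (by norm_num) (by linarith) hgdc.norm (gd_sq (l := l) hH0).1 (gd_sq hH0).2
  have h3 : ∫ t in (-Y)..Y, Q t = (∫ t in (-Y)..Y, ‖gl H l t‖)/4 + 3 * (∫ t in (-Y)..Y, ‖gd H l t‖)/8 := by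
    rw [hQ, intervalIntegral.integral_add (Continuous.intervalIntegrable (by fun_prop) _ _) (Continuous.intervalIntegrable (by fun_prop) _ _),
      intervalIntegral.integral_div, intervalIntegral.integral_div, intervalIntegral.integral_const_mul]
  have h4 : √(2*Y) = √2 * √Y := Real.sqrt_mul (by norm_num) _
  have h5 : √2 ≤ 1.41422 := by rw [Real.sqrt_le_left (by norm_num)]; norm_num
  rw [h4] at c1 c2
  have hs := Real.sqrt_nonneg Y
  have h6 : √2 * √Y ≤ 1.41422 * √Y := by gcongr
  have h7 : ∫ t in (-Y)..Y, Q t ≤ 1.593 * √Y := by rw [h3]; linarith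
  calc N * ∫ t in (-Y)..Y, Q t ≤ N * (1.593 * √Y) := by gcongr
    _ = _ := by ring

end LZb

section TL
open Filter Topology Complex

variable {H l x : ℝ} {q : ℕ} [NeZero q] {χ : DirichletCharacter ℂ q}

theorem mono0 {f f' : ℝ → ℝ} (h : ∀ y, HasDerivAt f (f' y) y) (h0 : ∀ y, 0 ≤ y → 0 ≤ f' y) {x : ℝ} (hx : 0 ≤ x) : f 0 ≤ f x := by
  have : MonotoneOn f (Ici 0) := monotoneOn_of_deriv_nonneg (convex_Ici 0)
    (fun y _ => (h y).continuousAt.continuousWithinAt) (fun y _ => (h y).differentiableAt.differentiableWithinAt)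
    (fun y hy => by rw [(h y).deriv]; rw [interior_Ici] at hy; exact h0 y (le_of_lt hy))
  exact this (mem_Ici.2 le_rfl) (mem_Ici.2 hx) hx

theorem cos_low {x : ℝ} (hx : 0 ≤ x) : 1 - x^2/2 + x^4/24 - x^6/720 ≤ cs x := by
  have c1 : ∀ y : ℝ, 0 ≤ y → cs y ≤ 1 - y^2/2 + y^4/24 := by
    intro y hy
    have := mono0 (f := fun y => 1 - y^2/2 + y^4/24 - cs y) (f' := fun y => sn y - (y - y^3/6)) (fun y => by
      have h := ((((hasDerivAt_pow 2 y).div_const 2).const_sub 1).add ((hasDerivAt_pow 4 y).div_const 24)).sub (Real.hasDerivAt_cos y)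
      refine h.congr_deriv ?_
      norm_num; ring) (fun y hy => by linarith [Real.sin_ge_sub_cube hy]) hy
    simp at this; linarith
  have c2 : ∀ y : ℝ, 0 ≤ y → sn y ≤ y - y^3/6 + y^5/120 := by
    intro y hy
    have := mono0 (f := fun y => y - y^3/6 + y^5/120 - sn y) (f' := fun y => (1 - y^2/2 + y^4/24) - cs y) (fun y => by
      have h := (((hasDerivAt_id y).sub ((hasDerivAt_pow 3 y).div_const 6)).add ((hasDerivAt_pow 5 y).div_const 120)).sub (Real.hasDerivAt_sin y)
      refine h.congr_deriv ?_
      norm_num; ring) (fun y hy => by linarith [c1 y hy]) hy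
    simp at this; linarith
  have := mono0 (f := fun y => cs y - (1 - y^2/2 + y^4/24 - y^6/720)) (f' := fun y => (y - y^3/6 + y^5/120) - sn y) (fun y => by
      have h := (Real.hasDerivAt_cos y).sub (((((hasDerivAt_pow 2 y).div_const 2).const_sub 1).add ((hasDerivAt_pow 4 y).div_const 24)).sub ((hasDerivAt_pow 6 y).div_const 720))
      refine h.congr_deriv ?_
      norm_num; ring) (fun y hy => by linarith [c2 y hy]) hx
  simp at this; linarith

theorem gs_int {c B : ℝ} (hc : 0 < c) : Integrable (fun t : ℝ => rx (-(c*t^2/2) + B*t)) ∧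
    ∫ t : ℝ, rx (-(c*t^2/2) + B*t) = √(2*pp/c) * rx (B^2/(2*c)) := by
  have e : ∀ t : ℝ, rx (-(c*t^2/2) + B*t) = rx (-(c/2) * (t - B/c)^2) * rx (B^2/(2*c)) := by
    intro t; rw [← Real.exp_add]; congr 1; field_simp; ring
  have h := integral_gaussian (c/2)
  have hi := integrable_exp_neg_mul_sq (b := c/2) (by positivity)
  rw [show (fun t : ℝ => rx (-(c*t^2/2) + B*t)) = fun t => rx (-(c/2) * (t - B/c)^2) * rx (B^2/(2*c)) from funext e]
  refine ⟨(hi.comp_sub_right (B/c)).mul_const _, ?_⟩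
  rw [integral_mul_const, integral_sub_right_eq_self (fun t => rx (-(c/2) * t^2)), h]
  congr 2; field_simp

theorem gs_1 {c B : ℝ} (hc : 0 < c) : ∫ t in Ioi (0:ℝ), rx (-(c*t^2/2) + B*t) ≤ √(2*pp/c) * rx (B^2/(2*c)) := by
  rw [← (gs_int hc).2]
  exact setIntegral_le_integral (gs_int hc).1 (ae_of_all _ fun t => (Real.exp_pos _).le)

theorem gs_2i {c B : ℝ} (hc : 0 < c) : IntegrableOn (fun t : ℝ => t * rx (-(c*t^2/2) + B*t)) (Ioi 0) := by
  refine ((gs_int (c := c) (B := B+1) hc).1.integrableOn).mono' (Continuous.aestronglyMeasurable (by fun_prop)) ?_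
  refine (ae_restrict_iff' measurableSet_Ioi).2 (ae_of_all _ fun t ht => ?_)
  rw [Real.norm_of_nonneg (mul_nonneg (le_of_lt ht) (Real.exp_pos _).le)]
  rw [show -(c*t^2/2) + (B+1)*t = t + (-(c*t^2/2) + B*t) by ring, Real.exp_add t]
  exact mlr (by linarith [Real.add_one_le_exp t]) (Real.exp_pos _).le

theorem gs_2 {c B : ℝ} (hc : 0 < c) : ∫ t in Ioi (0:ℝ), t * rx (-(c*t^2/2) + B*t) =
    1/c + B/c * ∫ t in Ioi (0:ℝ), rx (-(c*t^2/2) + B*t) := by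
  set g : ℝ → ℝ := fun t => rx (-(c*t^2/2) + B*t) with hg
  have hd : ∀ t ∈ Ici (0:ℝ), HasDerivAt (fun t => g t) (B * g t - c * (t * g t)) t := by
    intro t _
    have h := ((((hasDerivAt_pow 2 t).const_mul c).div_const 2).neg.add ((hasDerivAt_id t).const_mul B)).exp
    refine h.congr_deriv ?_
    simp only [hg, id]; norm_num; ring
  have i1 : IntegrableOn g (Ioi 0) := (gs_int hc).1.integrableOn
  have i2 : IntegrableOn (fun t => t * g t) (Ioi 0) := gs_2i hc
  have ht : Tendsto g atTop (𝓝 0) := by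
    refine Real.tendsto_exp_atBot.comp ?_
    have : (fun t : ℝ => -(c*t^2/2) + B*t) = fun t => t * (B - c/2*t) := by funext t; ring
    rw [this]
    refine tendsto_id.atTop_mul_atBot₀ ?_
    have := (tendsto_id (α := ℝ) (x := atTop)).const_mul_atTop (show 0 < c/2 by positivity)
    exact tendsto_atBot_add_const_left _ B (tendsto_neg_atTop_atBot.comp this)
  have h := integral_Ioi_of_hasDerivAt_of_tendsto' hd ((i1.const_mul B).sub (i2.const_mul c)) ht
  rw [integral_sub (i1.const_mul B) (i2.const_mul c), integral_const_mul, integral_const_mul] at h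
  have g0 : g 0 = 1 := by simp [hg]
  rw [g0] at h
  change ∫ t in Ioi (0:ℝ), t * g t = 1/c + B/c * ∫ t in Ioi (0:ℝ), g t
  generalize (∫ t in Ioi (0:ℝ), t * g t) = J2 at *
  generalize (∫ t in Ioi (0:ℝ), g t) = J1 at *
  field_simp
  linarith

theorem BB_bd {θ β B : ℝ} (hβ : 0 < β ∧ β < 1) (hθ : |θ| < pp/4) (hB : 0 ≤ B) (hb : -(l * sn θ) ≤ B) {M : ℝ}
    (h1 : √(2*pp/cs (2*θ)) * rx (B^2/(2*cs (2*θ))) ≤ M)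
    (h2 : 1/cs (2*θ) + B/cs (2*θ) * (√(2*pp/cs (2*θ)) * rx (B^2/(2*cs (2*θ)))) ≤ M) :
    BB l (1+β) θ ≤ M := by
  have hc := cos_pos4 hθ
  set c := cs (2*θ) with hcd
  set F : ℝ → ℝ := fun t => (1-β) * rx (-(c*t^2/2) + B*t) + β * (t * rx (-(c*t^2/2) + B*t)) with hF
  have i1 : IntegrableOn (fun t => rx (-(c*t^2/2) + B*t)) (Ioi 0) := (gs_int hc).1.integrableOn
  have i2 : IntegrableOn (fun t => t * rx (-(c*t^2/2) + B*t)) (Ioi 0) := gs_2i hc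
  have iF : IntegrableOn F (Ioi 0) := (i1.const_mul _).add (i2.const_mul _)
  have hle : BB l (1+β) θ ≤ ∫ t in Ioi (0:ℝ), F t := by
    rw [integral_exp_sub F, BB]
    refine integral_mono (BB_int (by linarith) hθ) ((integrable_exp_sub F).1 iF) (fun u => ?_)
    simp only [smul_eq_mul]
    rw [hF, BBi]; simp only []
    have e1 : rx ((1+β)*u) ≤ rx u * ((1-β) + β * rx u) := by
      rw [show (1+β)*u = u + β*u by ring, Real.exp_add]
      gcongr
      have := convexOn_exp.2 (mem_univ (0:ℝ)) (mem_univ u) (by linarith : 0 ≤ 1-β) hβ.1.le (by ring)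
      simpa using this
    have e2 : rx ((1+β)*u - c * rx (2*u)/2 + (-(l*sn θ))*rx u) ≤
        rx ((1+β)*u) * rx (-(c*(rx u)^2/2) + B*rx u) := by
      rw [← Real.exp_add]
      apply Real.exp_le_exp.2
      rw [show rx (2*u) = rx u^2 by rw [← Real.exp_nat_mul]; norm_num]
      have : (-(l*sn θ))*rx u ≤ B * rx u := by gcongr
      linarith
    refine e2.trans ?_
    calc _ ≤ (rx u * ((1-β) + β * rx u)) * rx (-(c*(rx u)^2/2) + B*rx u) := by gcongr
      _ = _ := by ring
  refine hle.trans ?_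
  rw [hF, integral_add (i1.const_mul _) (i2.const_mul _), integral_const_mul, integral_const_mul, gs_2 hc]
  have g1 := gs_1 (c := c) (B := B) hc
  set J := ∫ t in Ioi (0:ℝ), rx (-(c*t^2/2) + B*t)
  have g2 : 1/c + B/c * J ≤ M := le_trans (by gcongr) h2
  have h1β : 0 ≤ 1-β := by linarith
  calc (1-β)*J + β*(1/c+B/c*J) ≤ (1-β)*M + β*M := by
        have := hβ.1.le
        gcongr
        exact g1.trans h1
    _ = M := by ring

theorem W_bd (hH : 50 ≤ H) {θ ε : ℝ} (hθ : 0 ≤ θ) (hε : ε = 1 ∨ ε = -1) :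
    ∫ r : ℝ, ‖PH H r‖ * rx (-(θ * (H + ε * r))) ≤ 2 ∧
    ∫ r : ℝ, ‖PH H r‖ * rx (-(θ * (H + ε * r))) ≤ 2 * rx (-(25*θ)) + 0.211 := by
  have hr : ∀ r : ℝ, ‖PH H r‖ * rx (-(θ * (H + ε * r))) ≤ ‖PH H r‖ := by
    intro r
    by_cases h : |r| ≤ H
    · have h2 := abs_le.1 h
      have : 0 ≤ H + ε * r := by rcases hε with rfl | rfl <;> linarith
      have h3 : rx (-(θ * (H + ε * r))) ≤ 1 := Real.exp_le_one_iff.2 (by nlinarith [mul_nonneg hθ this])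
      nlinarith [norm_nonneg (PH H r)]
    · rw [PH_zero h]; simp
  have hi : Integrable (fun r : ℝ => ‖PH H r‖ * rx (-(θ * (H + ε * r)))) := by
    refine (PH_int H).norm.mono' ((PH_int H).norm.1.mul (Continuous.aestronglyMeasurable (by fun_prop))) (ae_of_all _ fun r => ?_)
    rw [Real.norm_of_nonneg (by positivity)]; exact hr r
  refine ⟨(integral_mono hi (PH_int H).norm hr).trans (PH_norm H), ?_⟩
  obtain ⟨A, hA, hAm, hAb⟩ : ∃ A : Set ℝ, MeasurableSet A ∧ (∀ r, ε * r < -25 → r ∈ A) ∧ ∫ r in A, ‖Pr r‖ ≤ 0.211 := by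
    rcases hε with rfl | rfl
    · exact ⟨Iic (-25), measurableSet_Iic, fun r hr => by simp at hr ⊢; linarith, (Pr_tail le_rfl).2⟩
    · exact ⟨Ioi 25, measurableSet_Ioi, fun r hr => by simp at hr ⊢; linarith, (Pr_tail le_rfl).1⟩
  have hpt : ∀ r : ℝ, ‖PH H r‖ * rx (-(θ * (H + ε * r))) ≤ ‖PH H r‖ * rx (-(25*θ)) + A.indicator (fun r => ‖Pr r‖) r := by
    intro r
    by_cases h : ε * r < -25
    · rw [indicator_of_mem (hAm r h)]
      have := hr r
      have h2 := PH_le H r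
      have : 0 ≤ ‖PH H r‖ * rx (-(25*θ)) := by positivity
      linarith
    · have h1 : 0 ≤ A.indicator (fun r => ‖Pr r‖) r := indicator_nonneg (fun _ _ => norm_nonneg _) r
      have : ‖PH H r‖ * rx (-(θ * (H + ε * r))) ≤ ‖PH H r‖ * rx (-(25*θ)) := by
        push Not at h
        refine mll (Real.exp_le_exp.2 ?_) (norm_nonneg _)
        nlinarith
      linarith
  have i2 := (PH_int H).norm.mul_const (rx (-(25*θ)))
  have i3 := Pr_int.1.norm.indicator hA
  refine (integral_mono hi (i2.add i3) hpt).trans ?_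
  rw [integral_add' i2 i3, integral_mul_const, integral_indicator hA]
  have := PH_norm H
  gcongr

theorem win {a θ : ℝ} (ha : 0 < a) : pp - a/3 ≤ ∫ y in (-6:ℝ)..6, a/(a^2+y^2) * rx (-(θ*y)) := by
  have hc : Continuous (fun y : ℝ => a/(a^2+y^2)) := Continuous.div (by fun_prop) (by fun_prop) (fun y => by positivity)
  have h1 : ∫ y in (-6:ℝ)..6, a/(a^2+y^2) * (1 - θ*y) ≤ ∫ y in (-6:ℝ)..6, a/(a^2+y^2) * rx (-(θ*y)) := by
    refine intervalIntegral.integral_mono_on (by norm_num) (Continuous.intervalIntegrable (by fun_prop) _ _) (Continuous.intervalIntegrable (by fun_prop) _ _) (fun y _ => ?_)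
    gcongr
    linarith [Real.add_one_le_exp (-(θ*y))]
  refine le_trans ?_ h1
  have hd : ∀ y ∈ uIcc (-6:ℝ) 6, HasDerivAt (fun y => Real.arctan (y/a) - θ*a/2 * lg (a^2+y^2)) (a/(a^2+y^2) * (1 - θ*y)) y := by
    intro y _
    have h := (((hasDerivAt_id y).div_const a).arctan).sub ((((hasDerivAt_pow 2 y).const_add (a^2)).log (by positivity)).const_mul (θ*a/2))
    refine h.congr_deriv ?_
    simp only [id]
    have : a^2+y^2 ≠ 0 := by positivity
    have h2 : 1 + (y/a)^2 ≠ 0 := by positivity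
    field_simp; norm_num; ring
  rw [intervalIntegral.integral_eq_sub_of_hasDerivAt hd (Continuous.intervalIntegrable (by fun_prop) _ _)]
  rw [neg_div, Real.arctan_neg, show ((-6:ℝ))^2 = 6^2 by norm_num]
  have h3 : Real.arctan (6/a) = pp/2 - Real.arctan (a/6) := by
    rw [← Real.arctan_inv_of_pos (by positivity), inv_div]
  have h4 : Real.arctan (a/6) ≤ a/6 := by
    have := Real.le_tan (Real.arctan_nonneg.2 (by positivity : 0 ≤ a/6)) (Real.arctan_lt_pi_div_two _)
    rwa [Real.tan_arctan] at this
  rw [h3]; linarith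

end TL

section TLb
open Filter Topology Complex

variable {H l x : ℝ} {q : ℕ} [NeZero q] {χ : DirichletCharacter ℂ q}

theorem Pk_shift {ρ : ℂ} {ε : ℝ} (hε : ε = 1 ∨ ε = -1) (t : ℝ) :
    Pk ρ (ε * t) = (2-ρ.re)/((2-ρ.re)^2+(t-ε*ρ.im)^2) + (1+ρ.re)/((1+ρ.re)^2+(t-ε*ρ.im)^2) := by
  rw [Pk]
  have : (ε*t-ρ.im)^2 = (t-ε*ρ.im)^2 := by rcases hε with rfl | rfl <;> ring
  rw [this]

theorem Pk_le {ρ : ℂ} (h0 : 0 < ρ.re) (h1 : ρ.re < 1) (t : ℝ) : Pk ρ t ≤ 2 := by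
  have k : ∀ a : ℝ, 1 ≤ a → a/(a^2+(t-ρ.im)^2) ≤ 1 := by
    intro a ha
    rw [div_le_one (by positivity)]
    nlinarith [sq_nonneg (t-ρ.im)]
  rw [Pk]
  have := k (2-ρ.re) (by linarith)
  have := k (1+ρ.re) (by linarith)
  linarith

theorem Pk_cont {ρ : ℂ} (h0 : 0 < ρ.re) (h1 : ρ.re < 1) : Continuous (Pk ρ) := by
  unfold Pk
  have : 0 < 2 - ρ.re := by linarith
  refine Continuous.add ?_ ?_ <;> exact Continuous.div (by fun_prop) (by fun_prop) (fun t => by positivity)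

theorem expI {θ : ℝ} (hθ : 0 < θ) : IntegrableOn (fun v : ℝ => rx (-(θ*v))) (Ioi 0) ∧
    ∫ v in Ioi (0:ℝ), rx (-(θ*v)) = 1/θ ∧ IntegrableOn (fun v : ℝ => v * rx (-(θ*v))) (Ioi 0) ∧
    ∫ v in Ioi (0:ℝ), v * rx (-(θ*v)) = 1/θ^2 := by
  have e : (fun v : ℝ => rx (-(θ*v))) = fun v => rx ((-θ)*v) := by funext v; congr 1; ring
  have h2 := Real.integral_rpow_mul_exp_neg_mul_Ioi (a := 2) (by norm_num) hθ
  have e2 : ∀ v : ℝ, v^((2:ℝ)-1) = v := fun v => by norm_num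
  simp_rw [e2, Real.Gamma_two] at h2
  have h3 : ∫ v in Ioi (0:ℝ), v * rx (-(θ*v)) = 1/θ^2 := by
    rw [h2]; norm_num
  refine ⟨?_, ?_, ?_, h3⟩
  · rw [e]; exact integrableOn_exp_mul_Ioi (by linarith) 0
  · rw [e, integral_exp_mul_Ioi (by linarith)]; simp
  · by_contra hn
    rw [integral_undef hn] at h3
    have : 0 < 1/θ^2 := by positivity
    linarith

theorem zwin {ρ : ℂ} (h0 : 0 < ρ.re) (h1 : ρ.re < 1) {ε T θ : ℝ} (hε : ε = 1 ∨ ε = -1) (hθ : 0 < θ) (hT : T ≤ ε * ρ.im) :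
    IntegrableOn (fun v => Pk ρ (ε*(T-6+v)) * rx (-(θ*v))) (Ioi 0) ∧
    5.283 * rx (-(θ*(ε*ρ.im - T))) ≤ rx (6*θ) * ∫ v in Ioi (0:ℝ), Pk ρ (ε*(T-6+v)) * rx (-(θ*v)) := by
  have hc := Pk_cont h0 h1
  have hi : IntegrableOn (fun v => Pk ρ (ε*(T-6+v)) * rx (-(θ*v))) (Ioi 0) := by
    refine ((expI hθ).1.const_mul 2).mono' (Continuous.aestronglyMeasurable (by fun_prop)) (ae_of_all _ fun v => ?_)
    rw [Real.norm_of_nonneg (mul_nonneg (Pk_nonneg h0 h1 _) (Real.exp_pos _).le)]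
    gcongr; exact Pk_le h0 h1 _
  refine ⟨hi, ?_⟩
  set v0 := ε*ρ.im - T + 6 with hv0
  have hsub : ∫ v in (v0-6)..(v0+6), Pk ρ (ε*(T-6+v)) * rx (-(θ*v)) ≤ ∫ v in Ioi (0:ℝ), Pk ρ (ε*(T-6+v)) * rx (-(θ*v)) := by
    rw [intervalIntegral.integral_of_le (by linarith)]
    refine setIntegral_mono_set hi (ae_of_all _ fun v => mul_nonneg (Pk_nonneg h0 h1 _) (Real.exp_pos _).le) ?_
    refine HasSubset.Subset.eventuallyLE (fun v hv => ?_)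
    have := hv.1
    rw [mem_Ioi]; linarith
  have hsh : ∫ v in (v0-6)..(v0+6), Pk ρ (ε*(T-6+v)) * rx (-(θ*v)) =
      rx (-(θ*v0)) * ∫ y in (-6:ℝ)..6, ((2-ρ.re)/((2-ρ.re)^2+y^2) * rx (-(θ*y)) + (1+ρ.re)/((1+ρ.re)^2+y^2) * rx (-(θ*y))) := by
    rw [← intervalIntegral.integral_const_mul]
    have := intervalIntegral.integral_comp_add_left (a := -6) (b := 6) (fun v => Pk ρ (ε*(T-6+v)) * rx (-(θ*v))) v0
    rw [show v0 - 6 = v0 + -6 by ring, ← this]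
    congr 1; funext y
    rw [Pk_shift hε, show T - 6 + (v0+y) - ε*ρ.im = y by rw [hv0]; ring, show -(θ*(v0+y)) = -(θ*v0) + -(θ*y) by ring, Real.exp_add]
    ring
  have hk : ∀ a : ℝ, 0 < a → Continuous (fun y : ℝ => a/(a^2+y^2) * rx (-(θ*y))) := fun a ha =>
    (Continuous.div (by fun_prop) (by fun_prop) (fun y => by positivity)).mul (by fun_prop)
  have ha : 0 < 2 - ρ.re := by linarith
  have hb : 0 < 1 + ρ.re := by linarith
  rw [intervalIntegral.integral_add ((hk _ ha).intervalIntegrable _ _) ((hk _ hb).intervalIntegrable _ _)] at hsh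
  have w1 := win (θ := θ) ha
  have w2 := win (θ := θ) hb
  have hpi := pi_b.1
  have e : rx (-(θ*(ε*ρ.im - T))) = rx (6*θ) * rx (-(θ*v0)) := by
    rw [← Real.exp_add]; congr 1; rw [hv0]; ring
  rw [e]
  calc 5.283 * (rx (6*θ) * rx (-(θ*v0))) = rx (6*θ) * (rx (-(θ*v0)) * 5.283) := by ring
    _ ≤ rx (6*θ) * (∫ v in (v0-6)..(v0+6), Pk ρ (ε*(T-6+v)) * rx (-(θ*v))) := by
        rw [hsh]; gcongr; linarith
    _ ≤ _ := by gcongr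

theorem zsum (hχ : χ.IsPrimitive) {ε T θ : ℝ} (hε : ε = 1 ∨ ε = -1) (hθ : 0 < θ) (hT : 150 ≤ T) (S : Finset ℂ)
    (hS : ∀ ρ ∈ S, 0 < ρ.re ∧ ρ.re < 1 ∧ T ≤ ε * ρ.im) :
    5.283 * ∑ ρ ∈ S, (mlt (xi χ) ρ : ℝ) * rx (-(θ*(ε*ρ.im - T))) ≤
      rx (6*θ) / θ * (lg (q*T/(2*pp)) + 2.0255 + 1/(θ*T)) := by
  have hq : 0 < (q:ℝ) := Nat.cast_pos.2 (Nat.pos_of_ne_zero (NeZero.ne q))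
  have hp := Real.pi_pos
  set A := lg (q*T/(2*pp)) + 2.0255 with hA
  rw [Finset.mul_sum]
  have h1 : ∀ ρ ∈ S, 5.283 * ((mlt (xi χ) ρ : ℝ) * rx (-(θ*(ε*ρ.im - T)))) ≤
      rx (6*θ) * ∫ v in Ioi (0:ℝ), (mlt (xi χ) ρ : ℝ) * (Pk ρ (ε*(T-6+v)) * rx (-(θ*v))) := by
    intro ρ hρ
    obtain ⟨a, b, c⟩ := hS ρ hρ
    have := (zwin a b hε hθ c).2
    rw [integral_const_mul]
    have hm : (0:ℝ) ≤ mlt (xi χ) ρ := Nat.cast_nonneg _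
    nlinarith [mll this hm]
  refine (Finset.sum_le_sum h1).trans ?_
  have hint : ∀ ρ ∈ S, IntegrableOn (fun v => (mlt (xi χ) ρ : ℝ) * (Pk ρ (ε*(T-6+v)) * rx (-(θ*v)))) (Ioi 0) := fun ρ hρ =>
    (zwin (hS ρ hρ).1 (hS ρ hρ).2.1 hε hθ (hS ρ hρ).2.2).1.const_mul _
  rw [← Finset.mul_sum, ← integral_finsetSum _ hint]
  have hE := expI hθ
  have hle : ∫ v in Ioi (0:ℝ), ∑ ρ ∈ S, (mlt (xi χ) ρ : ℝ) * (Pk ρ (ε*(T-6+v)) * rx (-(θ*v))) ≤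
      ∫ v in Ioi (0:ℝ), (A * rx (-(θ*v)) + 1/T * (v * rx (-(θ*v)))) := by
    refine setIntegral_mono_on (integrable_finsetSum _ hint) ((hE.1.const_mul _).add (hE.2.2.1.const_mul _)) measurableSet_Ioi (fun v hv => ?_)
    have hv0 : 0 < v := hv
    simp_rw [← mul_assoc]
    rw [← Finset.sum_mul, ← add_mul]
    refine mlr ?_ (Real.exp_pos _).le
    set t := T - 6 + v with ht
    have ht0 : 144 ≤ t := by linarith
    have hd := dens hχ (t := ε*t) (Y := t) (by linarith) (by rcases hε with rfl | rfl <;> simp [abs_of_pos (by linarith : 0 < t)])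
    have hpo : polet (ε*t) ≤ 0.00015 := by
      have e : (ε*t)^2 = t^2 := by rcases hε with rfl | rfl <;> ring
      rw [polet, e]
      have hsq : (144:ℝ)^2 ≤ t^2 := by gcongr
      have a1 : 2/(4+t^2) ≤ 2/(144^2) := by gcongr; linarith
      have a2 : 1/(1+t^2) ≤ 1/(144^2) := by gcongr; linarith
      norm_num at a1 a2 ⊢; linarith
    have hlog : lg (q*t/(2*pp)) ≤ lg (q*T/(2*pp)) + 1/T*v := by
      have e : q*t/(2*pp) = (q*T/(2*pp)) * (t/T) := by field_simp
      have htT : 0 < t/T := div_pos (by linarith) (by linarith)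
      rw [e, Real.log_mul (by have : 0 < T := by linarith
                              positivity) htT.ne']
      have h2 := Real.log_le_sub_one_of_pos htT
      have h3 : t/T - 1 ≤ 1/T*v := by
        rw [ht]; field_simp; linarith
      linarith
    refine (hd.1.sum_le_tsum S fun ρ _ => ?_).trans (by rw [hA]; linarith [hd.2])
    by_cases hm : mlt (xi χ) ρ = 0
    · simp [hm]
    · have := mlt_strip hχ hm
      exact mul_nonneg (Nat.cast_nonneg _) (Pk_nonneg this.1 this.2.1 _)
  calc _ ≤ rx (6*θ) * ∫ v in Ioi (0:ℝ), (A * rx (-(θ*v)) + 1/T * (v * rx (-(θ*v)))) := by gcongr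
    _ = _ := by
      rw [integral_add (hE.1.const_mul _) (hE.2.2.1.const_mul _), integral_const_mul, integral_const_mul, hE.2.1, hE.2.2.2]
      have : 0 < T := by linarith
      field_simp

theorem G_tail (hH : 50 ≤ H) {ρ : ℂ} (h0 : 0 < ρ.re) {ε T θ W : ℝ} (hε : ε = 1 ∨ ε = -1) (hθ : 0 < θ) (hθ2 : θ < pp/4)
    (hW : ∀ ε : ℝ, (ε = 1 ∨ ε = -1) → ∫ r : ℝ, ‖PH H r‖ * rx (-(θ * (H + ε * r))) ≤ W) :
    ‖KK (p0 H l) ρ‖ ≤ rx (-(θ*(ε*ρ.im - T))) * (rx (-(θ*(T-H))) * W) * BB l (1+ρ.re) (ε*θ) := by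
  have ha : |ε*θ| < pp/4 := by rcases hε with rfl | rfl <;> simpa [abs_of_pos hθ] using hθ2
  refine (G_bd (by linarith) (by linarith) ha).trans ?_
  refine mlr ?_ (BB_nonneg ..)
  have e : ∀ r : ℝ, ‖PH H r‖ * rx (-(ε*θ*(ρ.im+r))) =
      (rx (-(θ*(ε*ρ.im - T))) * rx (-(θ*(T-H)))) * (‖PH H r‖ * rx (-(θ * (H + ε * r)))) := by
    intro r
    rw [mul_left_comm, ← Real.exp_add, ← Real.exp_add]; congr 2; ring
  simp_rw [e]
  rw [integral_const_mul, mul_assoc]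
  gcongr
  exact hW ε hε

theorem tail_gen (hχ : χ.IsPrimitive) (hH : 50 ≤ H) {T θ W M1 M2 : ℝ} (hθ : 0 < θ) (hθ2 : θ < pp/4) (hT : 150 ≤ T)
    (hW : ∀ ε : ℝ, (ε = 1 ∨ ε = -1) → ∫ r : ℝ, ‖PH H r‖ * rx (-(θ * (H + ε * r))) ≤ W)
    (hM1 : ∀ β : ℝ, 0 < β → β < 1 → BB l (1+β) θ ≤ M1) (hM2 : ∀ β : ℝ, 0 < β → β < 1 → BB l (1+β) (-θ) ≤ M2)
    (S : Finset ℂ) (hS : ∀ ρ ∈ S, 0 < ρ.re ∧ ρ.re < 1 ∧ T ≤ |ρ.im|) :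
    5.283 * ∑ ρ ∈ S, (mlt (xi χ) ρ : ℝ) * ‖KK (p0 H l) ρ‖ ≤
      rx (-(θ*(T-H))) * W * (M1 + M2) * (rx (6*θ) / θ * (lg (q*T/(2*pp)) + 2.0255 + 1/(θ*T))) := by
  classical
  have hW0 : 0 ≤ W := le_trans (integral_nonneg fun r => by positivity) (hW 1 (Or.inl rfl))
  have key : ∀ ε : ℝ, (ε = 1 ∨ ε = -1) → ∀ M, (∀ β : ℝ, 0 < β → β < 1 → BB l (1+β) (ε*θ) ≤ M) → ∀ S' : Finset ℂ,
      (∀ ρ ∈ S', 0 < ρ.re ∧ ρ.re < 1 ∧ T ≤ ε * ρ.im) → 5.283 * ∑ ρ ∈ S', (mlt (xi χ) ρ : ℝ) * ‖KK (p0 H l) ρ‖ ≤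
      rx (-(θ*(T-H))) * W * M * (rx (6*θ) / θ * (lg (q*T/(2*pp)) + 2.0255 + 1/(θ*T))) := by
    intro ε hε M hM S' hS'
    have hM0 : 0 ≤ M := (BB_nonneg ..).trans (hM (1/2) (by norm_num) (by norm_num))
    refine le_trans ?_ (mll (zsum hχ hε hθ hT S' hS') (by positivity))
    rw [Finset.mul_sum, Finset.mul_sum, Finset.mul_sum]
    refine Finset.sum_le_sum fun ρ hρ => ?_
    obtain ⟨a, b, c⟩ := hS' ρ hρ
    have h1 := G_tail (l := l) (T := T) hH a hε hθ hθ2 hW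
    have h2 : ‖KK (p0 H l) ρ‖ ≤ rx (-(θ*(ε*ρ.im - T))) * (rx (-(θ*(T-H))) * W) * M :=
      h1.trans (mll (hM _ a b) (by positivity))
    calc 5.283 * ((mlt (xi χ) ρ : ℝ) * ‖KK (p0 H l) ρ‖) ≤ 5.283 * ((mlt (xi χ) ρ : ℝ) * (rx (-(θ*(ε*ρ.im - T))) * (rx (-(θ*(T-H))) * W) * M)) := by gcongr
      _ = _ := by ring
  rw [← Finset.sum_filter_add_sum_filter_not S (fun ρ => 0 ≤ ρ.im), mul_add, mul_add, add_mul]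
  refine add_le_add (key 1 (Or.inl rfl) M1 (by simpa using hM1) _ fun ρ hρ => ?_) (key (-1) (Or.inr rfl) M2 (by simpa using hM2) _ fun ρ hρ => ?_)
  · rw [Finset.mem_filter] at hρ
    obtain ⟨a, b, c⟩ := hS ρ hρ.1
    rw [abs_of_nonneg hρ.2] at c
    exact ⟨a, b, by linarith⟩
  · rw [Finset.mem_filter] at hρ
    obtain ⟨a, b, c⟩ := hS ρ hρ.1
    rw [abs_of_neg (not_le.1 hρ.2)] at c
    exact ⟨a, b, by linarith⟩

end TLb

section
open Filter Topology Complex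

lemma expup {x : ℝ} (n : ℕ) (hn : 0 < n) (h : x < n) : rx x ≤ (1/(1-x/n))^n := by
  have hn' : (0:ℝ) < n := by exact_mod_cast hn
  have h1 : x / n < 1 := by rw [div_lt_one hn']; exact h
  have : rx x = (rx (x/n))^n := by
    rw [← Real.exp_nat_mul]; congr 1; field_simp
  rw [this]
  refine pow_le_pow_left₀ (Real.exp_pos _).le ?_ n
  have h2 := Real.add_one_le_exp (-(x/n))
  rw [le_div_iff₀ (by linarith)]
  calc rx (x/n) * (1 - x/n) ≤ rx (x/n) * rx (-(x/n)) :=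
        mll (by linarith) (Real.exp_pos _).le
    _ = 1 := by rw [← Real.exp_add]; simp

lemma cfac {θ : ℝ} (h0 : 0 < θ) (h1 : θ ≤ 9/32) : 0.8459 ≤ cs (2*θ) ∧ 1 - cs (2*θ) ≤ 2.3036*θ^2*cs (2*θ)
    ∧ (θ ≤ 0.03 → 0.9982 ≤ cs (2*θ)) ∧ sn θ^2 = (1 - cs (2*θ))/2 := by
  have hc := cos_low (x := 2*θ) (by linarith)
  set c := cs (2*θ) with hcd
  obtain ⟨y, hy⟩ : ∃ y, y = θ^2 := ⟨_, rfl⟩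
  have hc' : 1 - 2*y + 2/3*y^2 - 4/45*y^3 ≤ c := by rw [hy]; nlinarith [hc]
  have hy0 : 0 ≤ y := by rw [hy]; positivity
  have hy1 : y ≤ 81/1024 := by rw [hy]; nlinarith
  rw [← hy]
  refine ⟨?_, ?_, ?_, ?_⟩
  · nlinarith [mul_nonneg hy0 hy0, mul_nonneg (mul_nonneg hy0 hy0) (sub_nonneg.2 hy1), mul_nonneg hy0 (sub_nonneg.2 hy1), mul_nonneg (sub_nonneg.2 hy1) (sub_nonneg.2 hy1)]
  · have : (1 - 2*y + 2/3*y^2 - 4/45*y^3)*(1+2.3036*y) ≤ c*(1+2.3036*y) :=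
      mlr hc' (by positivity)
    have h2 : 0 ≤ y * (0.3036 - 3.9406*y + 1.44*y^2 - 0.205*y^3) := by
      refine mul_nonneg hy0 ?_
      nlinarith [mul_nonneg (mul_nonneg hy0 hy0) (sub_nonneg.2 hy1), mul_nonneg hy0 (sub_nonneg.2 hy1), mul_nonneg (sub_nonneg.2 hy1) (sub_nonneg.2 hy1)]
    have h3 : 0 ≤ y^2 := by positivity
    have h4 : 0 ≤ y^3 := by positivity
    have h5 : 0 ≤ y^4 := by positivity
    nlinarith
  · intro h
    have : y ≤ 0.0009 := by rw [hy]; nlinarith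
    nlinarith [mul_nonneg hy0 hy0, mul_nonneg (mul_nonneg hy0 hy0) (sub_nonneg.2 hy1)]
  · rw [Real.sin_sq_eq_half_sub]; ring

lemma W1 {θ : ℝ} (h0 : 0.03 ≤ θ) (h1 : θ ≤ 9/32) : (2*rx (-(25*θ)) + 0.211)*rx (6*θ) ≤ 1.52 := by
  have e : (2*rx (-(25*θ)) + 0.211)*rx (6*θ) = 2*rx (-(19*θ)) + 0.211*rx (6*θ) := by
    rw [add_mul, mul_assoc, ← Real.exp_add]; congr 4; ring
  rw [e]
  rcases le_total θ 0.1 with h | h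
  · have a : rx (-(19*θ)) ≤ 0.5665 := (Real.exp_le_exp.2 (show -(19*θ) ≤ -0.57 by linarith)).trans
      ((expup (x := -0.57) 100 (by norm_num) (by norm_num)).trans (by norm_num))
    have b : rx (6*θ) ≤ 1.826 := (Real.exp_le_exp.2 (show 6*θ ≤ 0.6 by linarith)).trans
      ((expup (x := 0.6) 100 (by norm_num) (by norm_num)).trans (by norm_num))
    linarith
  · have a : rx (-(19*θ)) ≤ 0.16 := (Real.exp_le_exp.2 (show -(19*θ) ≤ -1.9 by linarith)).trans
      ((expup (x := -1.9) 100 (by norm_num) (by norm_num)).trans (by norm_num))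
    have b : rx (6*θ) ≤ 5.5 := (Real.exp_le_exp.2 (show 6*θ ≤ 1.6875 by linarith)).trans
      ((expup (x := 1.6875) 100 (by norm_num) (by norm_num)).trans (by norm_num))
    linarith

variable {q : ℕ} [NeZero q] {χ : DirichletCharacter ℂ q} {H T l θ W : ℝ}

lemma tail_core (hχ : χ.IsPrimitive) (hH : 50 ≤ H) (hθ : 0 < θ) (hθ2 : θ ≤ 9/32) (hT : 150 ≤ T)
    (hW : ∀ ε : ℝ, (ε = 1 ∨ ε = -1) → ∫ r, ‖PH H r‖ * rx (-(θ*(H+ε*r))) ≤ W) {M B : ℝ}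
    (hB : B = |l| * sn θ)
    (h1 : √(2*pp/cs (2*θ)) * rx (B^2/(2*cs (2*θ))) ≤ M)
    (h2 : 1/cs (2*θ) + B/cs (2*θ) * (√(2*pp/cs (2*θ)) * rx (B^2/(2*cs (2*θ)))) ≤ M)
    (S : Finset ℂ) (hS : ∀ ρ ∈ S, 0 < ρ.re ∧ ρ.re < 1 ∧ T ≤ |ρ.im|) :
    5.283 * ∑ ρ ∈ S, (mlt (xi χ) ρ : ℝ) * ‖KK (p0 H l) ρ‖ ≤
      rx (-(θ*(T-H))) * W * (M + 2.73) * (rx (6*θ)/θ * (lg (q*T/(2*pp)) + 2.0255 + 1/(θ*T))) := by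
  obtain ⟨c1, c2, -, -⟩ := cfac hθ hθ2
  have hpi := pi_b
  have hs : 0 < sn θ := Real.sin_pos_of_pos_of_lt_pi hθ (by linarith)
  have hB0 : 0 ≤ B := by rw [hB]; positivity
  have hsq : √(2*pp/cs (2*θ)) ≤ 2.73 := by
    rw [Real.sqrt_le_left (by norm_num), div_le_iff₀ (by linarith)]; nlinarith
  have good1 : √(2*pp/cs (2*θ)) * rx ((0:ℝ)^2/(2*cs (2*θ))) ≤ 2.73 := by
    simpa using hsq
  have good2 : 1/cs (2*θ) + 0/cs (2*θ) * (√(2*pp/cs (2*θ)) * rx ((0:ℝ)^2/(2*cs (2*θ)))) ≤ 2.73 := by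
    rw [zero_div, zero_mul, add_zero, div_le_iff₀ (by linarith)]; linarith
  have hcn : cs (2*(-θ)) = cs (2*θ) := by rw [mul_neg, Real.cos_neg]
  have hθ4 : θ < pp/4 := by linarith
  have ha : |θ| < pp/4 := by rw [abs_of_pos hθ]; exact hθ4
  have hb : |-θ| < pp/4 := by rw [abs_neg]; exact ha
  rcases le_total 0 l with hl | hl
  · rw [abs_of_nonneg hl] at hB
    have := tail_gen (l := l) hχ hH hθ hθ4 hT hW (M1 := 2.73) (M2 := M)
      (fun β b0 b1 => BB_bd ⟨b0, b1⟩ ha le_rfl (by have := mul_nonneg hl hs.le; linarith) good1 good2)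
      (fun β b0 b1 => BB_bd ⟨b0, b1⟩ hb hB0 (by rw [Real.sin_neg, hB]; linarith) (by rw [hcn]; exact h1) (by rw [hcn]; exact h2)) S hS
    rwa [add_comm 2.73 M] at this
  · rw [abs_of_nonpos hl] at hB
    exact tail_gen (l := l) hχ hH hθ hθ4 hT hW (M1 := M) (M2 := 2.73)
      (fun β b0 b1 => BB_bd ⟨b0, b1⟩ ha hB0 (by rw [hB]; linarith) h1 h2)
      (fun β b0 b1 => BB_bd ⟨b0, b1⟩ hb le_rfl (by rw [Real.sin_neg]; have := mul_nonneg (neg_nonneg.2 hl) hs.le; linarith) (by rw [hcn]; exact good1) (by rw [hcn]; exact good2)) S hS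

end

section
open Filter Topology Complex
variable {q : ℕ} [NeZero q] {χ : DirichletCharacter ℂ q} {H T l θ W : ℝ}

theorem L_low (n : ℕ) {A : ℝ} (hA : 2.71829^n * 6.2832 ≤ A) (hT : A ≤ T) : n ≤ lg (q*T/(2*pp)) := by
  have hq : (1:ℝ) ≤ q := by exact_mod_cast NeZero.one_le
  have hpi := pi_b
  have hA0 : 0 < A := lt_of_lt_of_le (by positivity) hA
  have : rx n ≤ q*T/(2*pp) := by
    have h1 : rx n ≤ 2.71829^n := by
      have : rx n = (rx 1)^n := by rw [← Real.exp_nat_mul, mul_one]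
      rw [this]
      exact pow_le_pow_left₀ (Real.exp_pos _).le (by have := Real.exp_one_lt_d9; linarith) n
    rw [le_div_iff₀ (by positivity)]
    have h3 : rx n * (2*pp) ≤ 2.71829^n * 6.2832 :=
      mul_le_mul h1 (by linarith) (by positivity) (by positivity)
    nlinarith
  rw [← Real.log_exp n]
  exact Real.log_le_log (Real.exp_pos _) this

theorem comb4 {A W M e6 Q θ a w b : ℝ} (h1 : A*M ≤ a) (h2 : W*e6 ≤ w) (h3 : 1/θ*Q ≤ b) (h4 : 0 ≤ A*M) (h5 : 0 ≤ W*e6) (h6 : 0 ≤ 1/θ*Q)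
    (h7 : 0 ≤ a) (h8 : 0 ≤ w) : A*W*M*(e6/θ*Q) ≤ a*w*b := by
  have : A*W*M*(e6/θ*Q) = A*M*(W*e6)*(1/θ*Q) := by ring
  rw [this]
  exact mul_le_mul (mul_le_mul h1 h2 h5 h7) h3 h6 (mul_nonneg h7 h8)

set_option maxHeartbeats 400000 in
theorem tail_exp (hχ : χ.IsPrimitive) (hH : 50 ≤ H) (hT : 100 ≤ T - H) (hl : l^2 ≤ 8/3*(T-H))
    (S : Finset ℂ) (hS : ∀ ρ ∈ S, 0 < ρ.re ∧ ρ.re < 1 ∧ T ≤ |ρ.im|) :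
    ∑ ρ ∈ S, (mlt (xi χ) ρ : ℝ) * ‖KK (p0 H l) ρ‖ ≤
      9.462 * √(T-H) * rx (-0.1598*(T-H)) * lg (q*T/(2*pp)) := by
  have hL : 3 ≤ lg (q*T/(2*pp)) := by
    have := L_low (q := q) (T := T) 3 (A := 150) (by norm_num) (by linarith)
    exact_mod_cast this
  set L := lg (q*T/(2*pp)) with hLd
  set D := T - H with hD
  have hθ : (0:ℝ) < 9/32 := by norm_num
  obtain ⟨c1, -, -, c4⟩ := cfac hθ le_rfl
  have hpi := pi_b
  have hcl : cs (2*(9/32:ℝ)) ≤ 1 := Real.cos_le_one _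
  have hs : 0 < sn (9/32:ℝ) := Real.sin_pos_of_pos_of_lt_pi hθ (by linarith)
  have hs1 : sn (9/32:ℝ) ≤ 9/32 := (Real.sin_lt hθ).le
  have hsq : √(2*pp/cs (2*(9/32:ℝ))) ≤ 2.73 := by
    rw [Real.sqrt_le_left (by norm_num), div_le_iff₀ (by linarith)]; nlinarith
  have key := fun (M B : ℝ) => tail_core (l := l) (M := M) (B := B) hχ hH hθ le_rfl (show 150 ≤ T by linarith) (fun ε hε => (W_bd hH hθ.le hε).2)
  have hw := W1 (θ := 9/32) (by norm_num) le_rfl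
  set c := cs (2*(9/32:ℝ)) with hc
  set s := √(2*pp/c) with hsd
  have hs0 : 0 ≤ s := Real.sqrt_nonneg _
  have hc0 : 0 < c := by linarith
  obtain ⟨B, hB⟩ : ∃ B, B = |l| * sn (9/32:ℝ) := ⟨_, rfl⟩
  have hB0 : 0 ≤ B := by rw [hB]; positivity
  set e := rx (B^2/(2*c)) with he
  have he1 : 1 ≤ e := Real.one_le_exp (by positivity)
  have hic : 1/c ≤ 1.1823 := by rw [div_le_iff₀ hc0]; linarith
  have hic0 : 0 ≤ 1/c := by positivity
  have hBc : B/c ≤ 1.1823*B := by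
    rw [div_eq_mul_one_div, mul_comm]; exact mlr hic hB0
  have hBc0 : 0 ≤ B/c := by positivity
  have hD0 : 0 ≤ √D := Real.sqrt_nonneg _
  have hDsq : √D^2 = D := Real.sq_sqrt (by linarith)
  have hD10 : 10 ≤ √D := Real.le_sqrt_of_sq_le (by linarith)
  have hBD : B ≤ 0.4594*√D := by
    have hl2 : |l| ≤ 1.633*√D := by
      refine abs_le_of_sq_le_sq ?_ (by positivity)
      rw [mul_pow, hDsq]; linarith
    rw [hB]
    calc |l| * sn (9/32:ℝ) ≤ (1.633*√D)*(9/32) := mul_le_mul hl2 hs1 hs.le (by positivity)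
      _ ≤ _ := by linarith
  have k := key (e*(2.73*(1+B/c)+1/c)) B hB
    (by
      calc s * e ≤ 2.73 * e := mlr hsq (by linarith)
        _ ≤ _ := by nlinarith [mul_nonneg hBc0 (by linarith : 0 ≤ e), mul_nonneg hic0 (by linarith : 0 ≤ e)])
    (by
      have t1 : B/c*(s*e) ≤ B/c*(2.73*e) := mll (mlr hsq (by linarith)) hBc0
      nlinarith [mul_nonneg hic0 (by linarith : 0 ≤ e-1)]) S hS
  have m1 : e*(2.73*(1+B/c)+1/c) + 2.73 ≤ e*(2.15*√D) := by
    have : e*(2.73*(1+B/c)+1/c) + 2.73 ≤ e*(2.73*(1+B/c)+1/c + 2.73) := by nlinarith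
    refine this.trans (mll ?_ (by linarith))
    linarith
  have hE : rx (-(9/32*D)) * e ≤ rx (-0.1598*D) := by
    rw [he, ← Real.exp_add]
    refine Real.exp_le_exp.2 ?_
    have : B^2/(2*c) ≤ 0.12145*D := by
      rw [div_le_iff₀ (by positivity), hB, mul_pow, c4, sq_abs]
      have h1 : l^2*((1-c)/2) ≤ 8/3*D*((1-c)/2) := mlr hl (by linarith)
      have h2 := mlr (show 4/3*(1-c) ≤ 0.2429*c by linarith) (show 0 ≤ D by linarith)
      linarith
    linarith
  have hT' : 0 ≤ 1/(9/32*T) ∧ 1/(9/32*T) ≤ 0.0245 := by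
    refine ⟨div_nonneg zero_le_one (by linarith only [hT, hD, hH]), ?_⟩
    rw [div_le_iff₀ (by linarith only [hT, hD, hH])]; linarith only [hT, hD, hH]
  have f1 : rx (-(9/32*D)) * (e*(2.73*(1+B/c)+1/c) + 2.73) ≤ rx (-0.1598*D)*(2.15*√D) := by
    calc _ ≤ rx (-(9/32*D)) * (e*(2.15*√D)) := mll m1 (Real.exp_pos _).le
      _ = (rx (-(9/32*D)) * e)*(2.15*√D) := by ring
      _ ≤ _ := mlr hE (by positivity)
  have k2 := k.trans (comb4 f1 hw (b := 32/9*(1.684*L)) (by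
    rw [div_mul_eq_mul_div, div_le_iff₀ hθ]; linarith only [hT'.2, hL]) (by positivity) (by positivity) (by
    refine mul_nonneg (by norm_num) (by linarith only [hT'.1, hL])) (by positivity) (by norm_num))
  have f4 : 0 ≤ √D * rx (-0.1598*D) * L := by positivity
  linarith only [k2, f4]

end

section
open Filter Topology Complex
variable {q : ℕ} [NeZero q] {χ : DirichletCharacter ℂ q} {H T l θ W : ℝ}

theorem exp8 {t : ℝ} (h : 8 ≤ t) : 1000 ≤ rx t := by
  have h1 : rx 8 = (rx 1)^8 := by rw [← Real.exp_nat_mul]; norm_num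
  have h2 : (2.7:ℝ)^8 ≤ (rx 1)^8 := pow_le_pow_left₀ (by norm_num) (by linarith [Real.exp_one_gt_d9]) 8
  have h3 := Real.exp_le_exp.2 h
  have h4 : (1000:ℝ) ≤ 2.7^8 := by norm_num
  linarith

set_option maxHeartbeats 400000 in
theorem gauss_core (hχ : χ.IsPrimitive) (hH : 50 ≤ H) {D a w s0 X : ℝ} (hD : D = T - H) (ha : a = |l|) (ha0 : 0 < a) (hT : 100 ≤ D)
    (hθa : θ*a^2 = 0.75*D) (hDa : 6.283*a ≤ D) (hθ2 : θ ≤ 9/32) (hX : X = D^2/a^2) (hW0 : 0 ≤ W)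
    (hW : ∀ ε : ℝ, (ε = 1 ∨ ε = -1) → ∫ r, ‖PH H r‖ * rx (-(θ*(H+ε*r))) ≤ W)
    (hw : W * rx (6*θ) ≤ w) (hs0 : √(2*pp/cs (2*θ))/cs (2*θ) ≤ s0) (hL : 0 ≤ lg (q*T/(2*pp)))
    (S : Finset ℂ) (hS : ∀ ρ ∈ S, 0 < ρ.re ∧ ρ.re < 1 ∧ T ≤ |ρ.im|) :
    5.283 * ∑ ρ ∈ S, (mlt (xi χ) ρ : ℝ) * ‖KK (p0 H l) ρ‖ ≤
      rx (-(0.426*X)) * a * (s0+0.012) * w * (lg (q*T/(2*pp)) + 2.0595) := by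
  have hθ : 0 < θ := by
    by_contra h
    have := mul_nonpos_of_nonpos_of_nonneg (not_lt.1 h) (sq_nonneg a)
    linarith
  obtain ⟨c1, c2, -, c4⟩ := cfac hθ hθ2
  have hpi := pi_b
  have hcl : cs (2*θ) ≤ 1 := Real.cos_le_one _
  have hs : 0 < sn θ := Real.sin_pos_of_pos_of_lt_pi hθ (by linarith)
  have hs1 : sn θ ≤ θ := (Real.sin_lt hθ).le
  have hs2 : 0.9*θ ≤ sn θ := by
    have := Real.sin_gt_sub_cube hθ
    nlinarith only [mul_pos hθ hθ, this, hθ, hθ2]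
  have key := fun (M B : ℝ) => tail_core (l := l) (M := M) (B := B) hχ hH hθ hθ2 (show 150 ≤ T by linarith) hW
  set c := cs (2*θ) with hc
  set s := √(2*pp/c) with hsd
  have hsn : 0 ≤ s := Real.sqrt_nonneg _
  have hc0 : 0 < c := by linarith
  have haθ : 4.712 ≤ a*θ := by
    have : a*4.712 ≤ a*(a*θ) := by nlinarith only [hθa, hDa, ha0]
    exact le_of_mul_le_mul_left this ha0
  have hXe : θ*D = 0.75*X := by
    rw [hX]; field_simp; linear_combination hθa
  have hX2 : a^2*θ^2 = 0.5625*X := by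
    rw [hX]; field_simp; linear_combination (θ*a^2 + 0.75*D)*hθa
  have hX1 : 39 ≤ X := by nlinarith only [hX2, haθ]
  obtain ⟨B, hB⟩ : ∃ B, B = |l| * sn θ := ⟨_, rfl⟩
  have hB' : B = a*sn θ := by rw [hB, ha]
  have hB4 : 4 ≤ B := by
    rw [hB']
    have := mll hs2 ha0.le
    linarith
  have hBu : B ≤ a*θ := by rw [hB']; exact mll hs1 ha0.le
  have hic : 1/c ≤ 1.1823 := by rw [div_le_iff₀ hc0]; linarith
  have hBc : 1 ≤ B/c := by rw [le_div_iff₀ hc0]; linarith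
  have hE0 : 8 ≤ B^2/(2*c) := by
    rw [le_div_iff₀ (by linarith)]; nlinarith only [hB4, hcl]
  have hE1 : B^2/(2*c) ≤ 0.324*X := by
    rw [div_le_iff₀ (by linarith), hB', mul_pow, c4]
    have h1 := mll c2 (sq_nonneg a)
    have h2 : a^2*(2.3036*θ^2*c) = 2.3036*0.5625*X*c := by
      linear_combination 2.3036*c*hX2
    have h3 : 0 ≤ X*c := by positivity
    nlinarith only [h1, h2, h3]
  have he8 := exp8 hE0
  set e := rx (B^2/(2*c)) with he
  have k := key (1/c + B/c*(s*e)) B hB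
    (by
      have h1 : 1*(s*e) ≤ B/c*(s*e) := mlr hBc (by positivity)
      have : 0 ≤ 1/c := by positivity
      linarith only [h1, this]) le_rfl S hS
  have m1 : 1/c + B/c*(s*e) + 2.73 ≤ e*((a*θ)*(s0+0.012)) := by
    have h1 : B/c*(s*e) = e*(B*(s/c)) := by ring
    have h2 : B*(s/c) ≤ (a*θ)*s0 := mul_le_mul hBu hs0 (by positivity) (by positivity)
    have h3 := mll h2 (by positivity : 0 ≤ e)
    have h4 : 1000*4.712 ≤ e*(a*θ) := mul_le_mul he8 haθ (by norm_num) (by positivity)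
    rw [h1]
    nlinarith only [h3, h4, hic]
  have hss : 0 ≤ s0 := le_trans (by positivity) hs0
  have hww : 0 ≤ w := le_trans (by positivity) hw
  have f1 : rx (-(θ*(T-H))) * (1/c + B/c*(s*e) + 2.73) ≤ rx (-(0.426*X))*((a*θ)*(s0+0.012)) := by
    calc _ ≤ rx (-(θ*(T-H))) * (e*((a*θ)*(s0+0.012))) := mll m1 (Real.exp_pos _).le
      _ = (rx (-(θ*(T-H))) * e)*((a*θ)*(s0+0.012)) := by ring
      _ ≤ _ := by
        refine mlr ?_ (by positivity)
        rw [he, ← Real.exp_add, ← hD]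
        exact Real.exp_le_exp.2 (by linarith only [hE1, hXe])
  have hT0 : 29 ≤ θ*T := by nlinarith only [hXe, hX1, hD, hH, hθ]
  have hT2 : 0.75*39.47 ≤ θ*T := by
    have : 39.47 ≤ X := by
      rw [hX, le_div_iff₀ (by positivity)]; nlinarith only [hDa, ha0]
    nlinarith only [hXe, this, hD, hH, hθ]
  have hT' : 0 ≤ 1/(θ*T) ∧ 1/(θ*T) ≤ 0.034 := by
    refine ⟨div_nonneg zero_le_one (by linarith only [hT0]), ?_⟩
    rw [div_le_iff₀ (by linarith only [hT0])]; linarith only [hT2]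
  have k2 := k.trans (comb4 f1 hw (b := 1/θ*(lg (q*T/(2*pp)) + 2.0595)) (mll (by linarith only [hT'.2]) (by positivity)) (by positivity) (by positivity) (mul_nonneg (by positivity) (by linarith only [hT'.1, hL])) (by positivity) hww)
  refine k2.trans (le_of_eq ?_)
  field_simp

theorem tail_gauss (hχ : χ.IsPrimitive) (hH : 50 ≤ H) (hT : 100 ≤ T - H) (hl : 8/3*(T-H) < l^2) (hDa : 2*pp*|l| ≤ T-H)
    (S : Finset ℂ) (hS : ∀ ρ ∈ S, 0 < ρ.re ∧ ρ.re < 1 ∧ T ≤ |ρ.im|) :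
    ∑ ρ ∈ S, (mlt (xi χ) ρ : ℝ) * ‖KK (p0 H l) ρ‖ ≤
      1.796 * |l| * rx (-(0.426*((T-H)^2/|l|^2))) * lg (q*T/(2*pp)) := by
  have hpi := pi_b
  have hL : 3 ≤ lg (q*T/(2*pp)) := by
    have := L_low (q := q) (T := T) 3 (A := 150) (by norm_num) (by linarith)
    exact_mod_cast this
  have ha0 : 0 < |l| := by
    refine abs_pos.2 ?_
    rintro rfl; norm_num at hl; linarith
  have hl2 : |l|^2 = l^2 := sq_abs l
  have hDa' : 6.283*|l| ≤ T - H := by nlinarith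
  obtain ⟨θ, hθ⟩ : ∃ θ, θ = 0.75*(T-H)/|l|^2 := ⟨_, rfl⟩
  have hθ0 : 0 < θ := by rw [hθ]; apply div_pos <;> [linarith; positivity]
  have hθa : θ*|l|^2 = 0.75*(T-H) := by rw [hθ]; field_simp
  have hθ2 : θ ≤ 9/32 := by rw [hθ, div_le_iff₀ (by positivity), hl2]; linarith
  obtain ⟨c1, -, c3, -⟩ := cfac hθ0 hθ2
  have g := fun (W w s0 : ℝ) => gauss_core (W := W) (w := w) (s0 := s0) (θ := θ) (l := l) (T := T) hχ hH rfl rfl ha0 hT hθa hDa' hθ2 rfl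
  have hlog : 0 ≤ lg (q*T/(2*pp)) := by linarith
  have hc0 : 0 < cs (2*θ) := by linarith
  have hp : 0 ≤ rx (-(0.426*((T-H)^2/|l|^2))) * |l| := by positivity
  rcases le_total θ 0.03 with h | h
  · have hc := c3 h
    have hL5 : 5 ≤ lg (q*T/(2*pp)) := by
      have hD : 960 ≤ T - H := by
        have h1 : 0.75*(T-H) ≤ 0.03*|l|^2 := by
          rw [← hθa]; exact mlr h (by positivity)
        have h2 : (6.283*|l|)^2 ≤ (T-H)^2 := pow_le_pow_left₀ (by positivity) hDa' 2
        have h3 : (T-H)*960 ≤ (T-H)*(T-H) := by nlinarith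
        exact le_of_mul_le_mul_left h3 (by linarith)
      have := L_low (q := q) (T := T) 5 (A := 960) (by norm_num) (by linarith)
      exact_mod_cast this
    have e6 : rx (6*θ) ≤ 1.2 := (Real.exp_le_exp.2 (show 6*θ ≤ 0.18 by linarith)).trans
      ((expup (x := 0.18) 20 (by norm_num) (by norm_num)).trans (by norm_num))
    have := g 2 2.4 2.52 (by norm_num) (fun ε hε => (W_bd hH hθ0.le hε).1) (by linarith) (by
      rw [div_le_iff₀ hc0]
      have : √(2*pp/cs (2*θ)) ≤ 2.51 := by
        rw [Real.sqrt_le_left (by norm_num), div_le_iff₀ hc0]; nlinarith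
      linarith) hlog S hS
    have h5 := mll hL5 hp
    nlinarith only [this, h5, hp]
  · have := g _ 1.52 3.23 (by positivity) (fun ε hε => (W_bd hH hθ0.le hε).2) (W1 h hθ2) (by
      rw [div_le_iff₀ hc0]
      have : √(2*pp/cs (2*θ)) ≤ 2.73 := by
        rw [Real.sqrt_le_left (by norm_num), div_le_iff₀ hc0]; nlinarith
      linarith) hlog S hS
    have h5 := mll hL hp
    nlinarith only [this, h5, hp]

theorem tail_all (hχ : χ.IsPrimitive) (hH : 50 ≤ H) {δ : ℝ} (hT : H + max (4 * pp^2 * |δ|) 100 ≤ T)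
    (S : Finset ℂ) (hS : ∀ ρ ∈ S, 0 < ρ.re ∧ ρ.re < 1 ∧ T ≤ |ρ.im|) :
    ∑ ρ ∈ S, (mlt (xi χ) ρ : ℝ) * ‖KK (p0 H (2*pp*δ)) ρ‖ ≤
      (9.462 * Real.sqrt (T - H) * rx (-0.1598 * (T - H))
                + 11.287 * |δ| * rx (-0.1065 * ((T - H) / (pp * δ))^2))
              * lg (q * T / (2 * pp)) := by
  have hpi := pi_b
  have h1 := le_max_left (4 * pp^2 * |δ|) 100
  have h2 := le_max_right (4 * pp^2 * |δ|) 100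
  have hL : 3 ≤ lg (q*T/(2*pp)) := by
    have := L_low (q := q) (T := T) 3 (A := 150) (by norm_num) (by linarith)
    exact_mod_cast this
  have habs : |2*pp*δ| = 2*pp*|δ| := by rw [abs_mul, abs_of_pos (by positivity)]
  rw [add_mul]
  rcases le_or_gt ((2*pp*δ)^2) (8/3*(T-H)) with h | h
  · refine (tail_exp hχ hH (by linarith) h S hS).trans ?_
    have : 0 ≤ 11.287 * |δ| * rx (-0.1065 * ((T - H) / (pp * δ))^2) * lg (q * T / (2 * pp)) := by positivity
    linarith
  · refine (tail_gauss hχ hH (by linarith) h (by rw [habs]; linarith) S hS).trans ?_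
    have : 0 ≤ 9.462 * Real.sqrt (T - H) * rx (-0.1598 * (T - H)) * lg (q * T / (2 * pp)) := by positivity
    refine le_add_of_nonneg_of_le this ?_
    refine mlr ?_ (by linarith)
    have e : -(0.426*((T-H)^2/|2*pp*δ|^2)) = -0.1065 * ((T - H) / (pp * δ))^2 := by
      rw [sq_abs, div_pow, mul_assoc, mul_pow]
      rw [show (T-H)^2/(2^2*(pp*δ)^2) = (T-H)^2/(pp*δ)^2/4 by rw [div_div]; ring]
      ring
    rw [e]
    refine mlr ?_ (Real.exp_pos _).le
    rw [habs]
    have := abs_nonneg δ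
    nlinarith

end

section
open Filter Topology Complex
variable {q : ℕ} [NeZero q] {χ : DirichletCharacter ℂ q} {H T l x : ℝ}

theorem Zs_bd (hχ : χ.IsPrimitive) (hx : 1000 ≤ x) {A B : ℝ}
    (hGRH : ∀ ρ : ℂ, χ.LFunction ρ = 0 → 0 < ρ.re → ρ.re < 1 → |ρ.im| ≤ T → ρ.re = 1/2)
    (hA : ∀ S : Finset ℂ, (∀ ρ ∈ S, ρ.re = 1/2 ∧ |ρ.im| ≤ T) → ∑ ρ ∈ S, (mlt (xi χ) ρ : ℝ) * ‖KK (p0 H l) ρ‖ ≤ A)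
    (hB : ∀ S : Finset ℂ, (∀ ρ ∈ S, 0 < ρ.re ∧ ρ.re < 1 ∧ T ≤ |ρ.im|) → ∑ ρ ∈ S, (mlt (xi χ) ρ : ℝ) * ‖KK (p0 H l) ρ‖ ≤ B)
    {Zs : ℂ} (hZ : HasSum (fun ρ => (mlt (xi χ) ρ : ℂ) * (cexp (ρ * (lg x:ℝ)) * KK (p0 H l) ρ)) Zs) :
    ‖Zs‖ ≤ √x * A + x * B := by
  classical
  refine le_of_tendsto hZ.norm (Eventually.of_forall fun S => ?_)
  have hx0 : 0 < x := by linarith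
  set g : ℂ → ℝ := fun ρ => (mlt (xi χ) ρ : ℝ) * ‖KK (p0 H l) ρ‖ with hg
  have hg0 : ∀ ρ, 0 ≤ g ρ := fun ρ => by positivity
  have hterm : ∀ ρ ∈ S, ‖(mlt (xi χ) ρ : ℂ) * (cexp (ρ * (lg x:ℝ)) * KK (p0 H l) ρ)‖ ≤
      √x * (if mlt (xi χ) ρ ≠ 0 ∧ |ρ.im| ≤ T then g ρ else 0) + x * (if mlt (xi χ) ρ ≠ 0 ∧ ¬ |ρ.im| ≤ T then g ρ else 0) := by
    intro ρ _
    by_cases hm : mlt (xi χ) ρ = 0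
    · simp [hm]
    have e : ‖(mlt (xi χ) ρ : ℂ) * (cexp (ρ * (lg x:ℝ)) * KK (p0 H l) ρ)‖ = x^ρ.re * g ρ := by
      rw [norm_mul, norm_mul, Complex.norm_exp, Complex.re_mul_ofReal, Complex.norm_natCast, Real.rpow_def_of_pos hx0, hg, mul_comm ρ.re]
      ring
    rw [e]
    obtain ⟨h0, h1, hz⟩ := mlt_strip hχ hm
    by_cases ht : |ρ.im| ≤ T
    · simp only [hm, ht, not_true, and_true, and_false, if_false, ne_eq, not_false_iff, if_true, mul_zero, add_zero]
      rw [hGRH ρ hz h0 h1 ht, ← Real.sqrt_eq_rpow]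
    · simp only [hm, ht, not_true, and_true, and_false, if_false, ne_eq, not_false_iff, if_true, mul_zero, zero_add]
      refine mlr ?_ (hg0 _)
      calc x^ρ.re ≤ x^(1:ℝ) := Real.rpow_le_rpow_of_exponent_le (by linarith) h1.le
        _ = x := Real.rpow_one x
  refine (norm_sum_le _ _).trans ((Finset.sum_le_sum hterm).trans ?_)
  rw [Finset.sum_add_distrib, ← Finset.mul_sum, ← Finset.mul_sum, ← Finset.sum_filter, ← Finset.sum_filter]
  refine add_le_add (mll (hA _ ?_) (Real.sqrt_nonneg _)) (mll (hB _ ?_) hx0.le)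
  · intro ρ hρ
    rw [Finset.mem_filter] at hρ
    obtain ⟨h0, h1, hz⟩ := mlt_strip hχ hρ.2.1
    exact ⟨hGRH ρ hz h0 h1 hρ.2.2, hρ.2.2⟩
  · intro ρ hρ
    rw [Finset.mem_filter] at hρ
    obtain ⟨h0, h1, hz⟩ := mlt_strip hχ hρ.2.1
    exact ⟨h0, h1, (not_le.1 hρ.2.2).le⟩

theorem low_num (hT : 150 ≤ T) :
    1.593 * √(T+3) * (lg (q*(T+3)/(2*pp)) + 5.025) ≤ 1.609*√T*lg (q*T) + 5.2*√T ∧ 0 ≤ lg (q*T) := by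
  have hq : (1:ℝ) ≤ q := by exact_mod_cast NeZero.one_le
  have hpi := pi_b
  have h1 : √(T+3) ≤ 1.01*√T := by
    rw [Real.sqrt_le_left (by positivity), mul_pow, Real.sq_sqrt (by linarith)]; linarith
  have h2 : lg (q*(T+3)/(2*pp)) ≤ lg (q*T) - 1.8 := by
    have e : rx 1.8 ≤ 6.15 := (expup (x := 1.8) 200 (by norm_num) (by norm_num)).trans (by norm_num)
    have : q*(T+3)/(2*pp) ≤ q*T/rx 1.8 := by
      rw [div_le_div_iff₀ (by positivity) (by positivity), mul_assoc, mul_assoc]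
      refine mll ?_ (by positivity)
      calc (T+3)*rx 1.8 ≤ (T+3)*6.15 := mll e (by linarith)
        _ ≤ T*6.283 := by linarith
        _ ≤ _ := mll (by linarith) (by linarith)
    have h3 := Real.log_le_log (by have : 0 < T + 3 := by linarith
                                   positivity) this
    rwa [Real.log_div (by have : 0 < T := by linarith
                          positivity) (Real.exp_pos _).ne', Real.log_exp] at h3
  have h3 : 0 ≤ lg (q*T) := Real.log_nonneg (by nlinarith)
  refine ⟨?_, h3⟩
  have h4 : lg (q*(T+3)/(2*pp)) + 5.025 ≤ lg (q*T) + 3.225 := by linarith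
  calc _ ≤ 1.593 * √(T+3) * (lg (q*T) + 3.225) := mll h4 (by positivity)
    _ ≤ 1.593 * (1.01*√T) * (lg (q*T) + 3.225) := by
      refine mlr (by linarith) (by linarith)
    _ ≤ _ := by
      have := mul_nonneg (Real.sqrt_nonneg T) h3
      nlinarith [Real.sqrt_nonneg T]

theorem sum_conv (hx : 0 < x) (δ : ℝ) :
    (∑' n : ℕ, (ArithmeticFunction.vonMangoldt n : ℂ) * χ (n : ZMod q) * e2pi (δ * n / x) * (etaPlus H (n / x) : ℂ)) =
      ∑' n : ℕ, tw χ n * px H (2*pp*δ) x (lg n) := by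
  refine tsum_congr fun n => ?_
  rcases Nat.eq_zero_or_pos n with rfl | hn
  · simp [tw_apply]
  · rw [← px_eta hx H δ (y := n) (by exact_mod_cast hn), tw_apply]
    ring

theorem main_conv (hx : 0 < x) (δ : ℝ) :
    KK (px H (2*pp*δ) x) 1 = (∫ t in Set.Ioi (0:ℝ), e2pi (δ * t) * (etaPlus H t : ℂ)) * x := by
  rw [KK_px, integral_exp_sub, one_mul, ← Complex.ofReal_exp, Real.exp_log hx, mul_comm]
  congr 1
  rw [KK]
  congr 1; funext u
  rw [p0_eta, one_mul, Complex.real_smul, Complex.ofReal_exp, mul_comm]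

end

theorem etaPlus_major_arc_conditional
    (H : ℝ) (hH50 : 50 ≤ H)
    (x : ℝ) (hx : (10:ℝ)^3 ≤ x) (δ : ℝ)
    (q : ℕ) [NeZero q] (χ : DirichletCharacter ℂ q) (hχ : χ.IsPrimitive)
    (T₀ : ℝ) (hT₀ : H + max (4 * Real.pi^2 * |δ|) 100 ≤ T₀)
    (hGRH : ∀ ρ : ℂ, χ.LFunction ρ = 0 → 0 < ρ.re → ρ.re < 1 → |ρ.im| ≤ T₀ →
      ρ.re = 1/2) :
    ∃ E : ℂ,
      (∑' n : ℕ, (ArithmeticFunction.vonMangoldt n : ℂ) * χ (n : ZMod q)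
          * e2pi (δ * n / x) * (etaPlus H (n / x) : ℂ))
        = (if q = 1 then
            (∫ t in Set.Ioi (0:ℝ), e2pi (δ * t) * (etaPlus H t : ℂ)) * x
          else 0) + E * x ∧
      ‖E‖ ≤ (9.462 * Real.sqrt (T₀ - H) * Real.exp (-0.1598 * (T₀ - H))
                + 11.287 * |δ| * Real.exp (-0.1065 * ((T₀ - H) / (Real.pi * δ))^2))
              * Real.log (q * T₀ / (2 * Real.pi))
            + (1.631 * Real.sqrt T₀ * Real.log (q * T₀) + 12.42 * Real.sqrt T₀
                + 1.321 * Real.log q + 34.51) * x ^ (-(1:ℝ)/2)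
            + (9 + 11 * |δ|) * x⁻¹
            + Real.log q * (11 + 6 * |δ|) * x ^ (-(3:ℝ)/2) := by
  have hx3 : 1000 ≤ x := by norm_num at hx; exact hx
  have hx0 : 0 < x := by linarith
  have hq : (1:ℝ) ≤ q := by exact_mod_cast NeZero.one_le
  have hlq : 0 ≤ lg q := Real.log_nonneg hq
  have hpi := pi_b
  have m1 := le_max_left (4 * pp^2 * |δ|) 100
  have m2 := le_max_right (4 * pp^2 * |δ|) 100
  have habs : |2*pp*δ| = 2*pp*|δ| := by rw [abs_mul, abs_of_pos (by positivity)]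
  have hT : H + 5 + |2*pp*δ| ≤ T₀ := by
    rw [habs]
    have h1 : 2*(2*pp*|δ|) ≤ 4 * pp^2 * |δ| := by
      have := mul_nonneg (abs_nonneg δ) Real.pi_pos.le
      nlinarith
    linarith
  obtain ⟨R, Zs, hZ, hsum, hR⟩ := EFapp hχ hH50 hx3 hT
  have hT150 : 150 ≤ T₀ := by linarith
  have zb := Zs_bd (H := H) (l := 2*pp*δ) hχ hx3 hGRH (fun S hS => low_bd hχ (by linarith) (by linarith) S hS)
    (fun S hS => tail_all hχ hH50 hT₀ S hS) hZ
  obtain ⟨ln, hlqT⟩ := low_num (q := q) hT150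
  set Tl := (9.462 * Real.sqrt (T₀ - H) * rx (-0.1598 * (T₀ - H))
                + 11.287 * |δ| * rx (-0.1065 * ((T₀ - H) / (pp * δ))^2))
              * lg (q * T₀ / (2 * pp)) with hTl
  have hxc : (x:ℂ) ≠ 0 := by exact_mod_cast hx0.ne'
  refine ⟨(-Zs + R)/x, ?_, ?_⟩
  · rw [sum_conv hx0, hsum, div_mul_cancel₀ _ hxc, main_conv hx0]
    ring
  · have hs0 : 0 < √x := Real.sqrt_pos.2 hx0
    have hss : √x*√x = x := Real.mul_self_sqrt hx0.le
    have hs31 : 31 ≤ √x := Real.le_sqrt_of_sq_le (by linarith)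
    have e1 : x ^ (-(1:ℝ)/2) = 1/√x := by
      rw [neg_div, Real.rpow_neg hx0.le, Real.sqrt_eq_rpow, one_div, one_div]
    have p1 : 0 ≤ (9 + 11 * |δ|) * x⁻¹ := by positivity
    have p2 : 0 ≤ lg q * (11 + 6 * |δ|) * x ^ (-(3:ℝ)/2) := by positivity
    rw [e1]
    have hn : ‖(-Zs + R)/x‖ ≤ (√x * (1.609*√T₀*lg (q*T₀) + 5.2*√T₀) + x * Tl + (0.006 + 0.002*lg q + 9 + 6*√T₀))/x := by
      rw [norm_div, Complex.norm_real, Real.norm_of_nonneg hx0.le]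
      refine div_le_div_of_nonneg_right ?_ hx0.le
      have t1 := norm_add_le (-Zs) R
      rw [norm_neg] at t1
      have t2 := mll ln hs0.le
      have t3 : (6 + 2*lg q)/x ≤ 0.006 + 0.002*lg q := by
        rw [div_le_iff₀ hx0]; nlinarith
      linarith
    have hd : (√x * (1.609*√T₀*lg (q*T₀) + 5.2*√T₀) + x * Tl + (0.006 + 0.002*lg q + 9 + 6*√T₀))/x ≤
        Tl + (1.631 * Real.sqrt T₀ * lg (q * T₀) + 12.42 * Real.sqrt T₀
                + 1.321 * lg q + 34.51) * (1/√x) := by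
      rw [div_le_iff₀ hx0]
      have e2 : (1/√x)*x = √x := by rw [div_mul_eq_mul_div, one_mul, div_eq_iff hs0.ne', hss]
      rw [add_mul, mul_assoc _ (1/√x) x, e2]
      have u0 := Real.sqrt_nonneg T₀
      have u1 := mul_nonneg (mul_nonneg u0 hlqT) hs0.le
      have u2 := mul_nonneg u0 (sub_nonneg.2 hs31)
      have u3 := mul_nonneg hlq (sub_nonneg.2 hs31)
      nlinarith only [u0, u1, u2, u3, hlq, hs31]
    linarith
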